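/- Let u be a bounded weak solution of the Navier–Stokes equations in ℝ³×(−∞,0) which is axi-symmetric and has no swirl. Then there exists a bounded measurable function b₃ : (−∞,0) → ℝ such that u(x,t) = (0,0,b₃(t)) for almost every (x,t) ∈ ℝ³×(−∞,0). -/

import Mathlib

open MeasureTheory Real Filter Topology

noncomputable section

/-- Euclidean space ℝⁿ. -/
abbrev Euc (n : ℕ) := EuclideanSpace ℝ (Fin n)

/-- The heat kernel Γ(x,t) = (4πt)^{-n/2} exp(-|x|²/(4t)). -/
noncomputable def heatKer (n : ℕ) (x : Euc n) (t : ℝ) : ℝ :=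
  (4 * π * t) ^ (-(n : ℝ) / 2) * Real.exp (-‖x‖ ^ 2 / (4 * t))

/-- The fundamental solution G of the Laplacian on ℝⁿ (n ≥ 2). -/
noncomputable def lapFund (n : ℕ) (x : Euc n) : ℝ :=
  if n = 2 then (2 * π)⁻¹ * Real.log ‖x‖
  else -((((n : ℝ) - 2) * (2 * π ^ ((n : ℝ) / 2) / Real.Gamma ((n : ℝ) / 2)))⁻¹) *
      ‖x‖ ^ (2 - (n : ℝ))

/-- The generating function Φ(x,t) = ∫_{ℝⁿ} G(y) Γ(x-y,t) dy. -/
noncomputable def genPhi (n : ℕ) (x : Euc n) (t : ℝ) : ℝ :=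
  ∫ y : Euc n, lapFund n y * heatKer n (x - y) t

/-- Spatial partial derivative ∂f/∂x_i of a scalar function on ℝⁿ. -/
noncomputable def pd (n : ℕ) (i : Fin n) (f : Euc n → ℝ) (x : Euc n) : ℝ :=
  fderiv ℝ f x (EuclideanSpace.single i 1)

/-- The Laplacian of a scalar function on ℝⁿ. -/
noncomputable def lap (n : ℕ) (f : Euc n → ℝ) (x : Euc n) : ℝ :=
  ∑ i : Fin n, pd n i (pd n i f) x

/-- The Oseen kernel K_{ij} = (-δ_{ij}Δ + ∂²/∂x_i∂x_j)Φ. -/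
noncomputable def Kmat (n : ℕ) (i j : Fin n) (x : Euc n) (t : ℝ) : ℝ :=
  (if i = j then -(lap n (fun y => genPhi n y t) x) else 0)
    + pd n i (pd n j (fun y => genPhi n y t)) x

/-- The kernel K_{ijk} = ∂K_{ij}/∂x_k. -/
noncomputable def Kten (n : ℕ) (i j k : Fin n) (x : Euc n) (t : ℝ) : ℝ :=
  pd n k (fun y => Kmat n i j y t) x

/-- Mild solution of the Navier–Stokes equations on ℝⁿ × (t₀,t₁) with initial datum u₀:
u_i(x,t) = ∫ Γ(x-y,t-t₀) u₀ᵢ(y) dy - ∫_{t₀}^t ∫ K_{ijk}(x-y,t-s) u_k u_j dy ds. -/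
def IsMildNS (n : ℕ) (t₀ t₁ : ℝ) (u₀ : Euc n → Euc n) (u : Euc n → ℝ → Euc n) : Prop :=
  ∀ x : Euc n, ∀ t : ℝ, t ∈ Set.Ioo t₀ t₁ → ∀ i : Fin n,
    u x t i = (∫ y : Euc n, heatKer n (x - y) (t - t₀) * u₀ y i)
      - ∫ s in Set.Ioo t₀ t, ∫ y : Euc n,
          ∑ j : Fin n, ∑ k : Fin n, Kten n i j k (x - y) (t - s) * u y s k * u y s j

/-- Spatial partial derivative for functions on space-time ℝⁿ × ℝ. -/
noncomputable def pdx (n : ℕ) (i : Fin n) (g : Euc n × ℝ → ℝ) (p : Euc n × ℝ) : ℝ :=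
  fderiv ℝ g p (EuclideanSpace.single i 1, 0)

/-- Time derivative for functions on space-time ℝⁿ × ℝ. -/
noncomputable def pdt (n : ℕ) (g : Euc n × ℝ → ℝ) (p : Euc n × ℝ) : ℝ :=
  fderiv ℝ g p (0, 1)

/-- Spatial Laplacian for functions on space-time ℝⁿ × ℝ. -/
noncomputable def lapx (n : ℕ) (g : Euc n × ℝ → ℝ) (p : Euc n × ℝ) : ℝ :=
  ∑ i : Fin n, pdx n i (pdx n i g) p

/-- Weak solution of the Navier–Stokes equations on ℝⁿ × S (S ⊆ ℝ a time interval):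
div u = 0 in the sense of distributions, and
∫∫ u·(∂_tφ + Δφ) dx dt = -∫∫ u_k u·∂_kφ dx dt for every smooth compactly supported
divergence-free test field φ supported in ℝⁿ × S. -/
def IsWeakNS (n : ℕ) (S : Set ℝ) (u : Euc n → ℝ → Euc n) : Prop :=
  (∀ ψ : Euc n × ℝ → ℝ, ContDiff ℝ (⊤ : ℕ∞) ψ → HasCompactSupport ψ →
      tsupport ψ ⊆ Set.univ ×ˢ S →
      (∫ p in (Set.univ ×ˢ S : Set (Euc n × ℝ)),
        ∑ i : Fin n, u p.1 p.2 i * pdx n i ψ p) = 0) ∧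
  (∀ φ : Euc n × ℝ → Euc n, ContDiff ℝ (⊤ : ℕ∞) φ → HasCompactSupport φ →
      tsupport φ ⊆ Set.univ ×ˢ S →
      (∀ p : Euc n × ℝ, (∑ i : Fin n, pdx n i (fun q => φ q i) p) = 0) →
      (∫ p in (Set.univ ×ˢ S : Set (Euc n × ℝ)),
          ∑ i : Fin n, u p.1 p.2 i *
            (pdt n (fun q => φ q i) p + lapx n (fun q => φ q i) p))
        = -(∫ p in (Set.univ ×ˢ S : Set (Euc n × ℝ)),
            ∑ i : Fin n, ∑ k : Fin n,
              u p.1 p.2 k * u p.1 p.2 i * pdx n k (fun q => φ q i) p))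

/-- Rotation by angle α about the x₃-axis in ℝ³. -/
noncomputable def rotZ (α : ℝ) (x : Euc 3) : Euc 3 :=
  (WithLp.equiv 2 (Fin 3 → ℝ)).symm
    ![Real.cos α * x 0 - Real.sin α * x 1,
      Real.sin α * x 0 + Real.cos α * x 1, x 2]

/-- Space-time `ℝ³ × ℝ`. -/
abbrev SpT := Euc 3 × ℝ

instance : (volume : Measure SpT).IsAddHaarMeasure :=
  inferInstanceAs ((volume.prod volume : Measure (Euc 3 × ℝ)).IsAddHaarMeasure)

/-- Spatial coordinate directions in space-time. -/
def ex (i : Fin 3) : SpT := (EuclideanSpace.single i 1, 0)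

/-- The time direction in space-time. -/
def et : SpT := (0, 1)

/-- Directional derivative on space-time. -/
def dd (v : SpT) (f : SpT → ℝ) : SpT → ℝ := fun p => fderiv ℝ f p v

/-- Smooth functions on space-time. -/
abbrev Smooth (f : SpT → ℝ) : Prop := ContDiff ℝ (⊤ : ℕ∞) f

lemma Smooth.differentiable {f : SpT → ℝ} (hf : Smooth f) : Differentiable ℝ f :=
  ContDiff.differentiable hf (by simp)

lemma Smooth.dd {f : SpT → ℝ} (hf : Smooth f) (v : SpT) : Smooth (dd v f) :=
  ContDiff.clm_apply (hf.fderiv_right (m := (⊤ : ℕ∞)) (by simp)) contDiff_const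

lemma Smooth.continuous {f : SpT → ℝ} (hf : Smooth f) : Continuous f := ContDiff.continuous hf

lemma dd_comm {f : SpT → ℝ} (hf : Smooth f) (v w : SpT) : dd v (dd w f) = dd w (dd v f) := by
  funext p
  have h2 : IsSymmSndFDerivAt ℝ f p := hf.contDiffAt.isSymmSndFDerivAt (by simp; norm_cast)
  have hd : DifferentiableAt ℝ (fderiv ℝ f) p :=
    ((hf.fderiv_right (m := (⊤ : ℕ∞)) (by simp)).differentiable (by simp)) p
  have key : ∀ v w : SpT, dd v (dd w f) p = fderiv ℝ (fderiv ℝ f) p v w := by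
    intro v w
    have : dd w f = fun q => (fderiv ℝ f q) w := rfl
    unfold dd
    rw [fderiv_clm_apply hd (differentiableAt_const w)]
    simp
  rw [key, key]
  exact h2 v w

lemma dd_add {f g : SpT → ℝ} (hf : Differentiable ℝ f) (hg : Differentiable ℝ g) (v : SpT) :
    dd v (fun p => f p + g p) = fun p => dd v f p + dd v g p := by
  funext p; unfold dd; rw [fderiv_fun_add (hf p) (hg p)]; rfl

lemma dd_sub {f g : SpT → ℝ} (hf : Differentiable ℝ f) (hg : Differentiable ℝ g) (v : SpT) :
    dd v (fun p => f p - g p) = fun p => dd v f p - dd v g p := by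
  funext p; unfold dd; rw [fderiv_fun_sub (hf p) (hg p)]; rfl

lemma dd_mul {f g : SpT → ℝ} (hf : Differentiable ℝ f) (hg : Differentiable ℝ g) (v : SpT) :
    dd v (fun p => f p * g p) = fun p => dd v f p * g p + f p * dd v g p := by
  funext p; unfold dd; rw [fderiv_fun_mul (hf p) (hg p)]
  simp; ring

lemma dd_const_mul {f : SpT → ℝ} (hf : Differentiable ℝ f) (c : ℝ) (v : SpT) :
    dd v (fun p => c * f p) = fun p => c * dd v f p := by
  funext p; unfold dd; rw [fderiv_const_mul (hf p)]; rfl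

lemma dd_sum {ι : Type*} (s : Finset ι) {f : ι → SpT → ℝ} (hf : ∀ i, Differentiable ℝ (f i))
    (v : SpT) : dd v (fun p => ∑ i ∈ s, f i p) = fun p => ∑ i ∈ s, dd v (f i) p := by
  funext p; unfold dd; rw [fderiv_fun_sum (fun i _ => hf i p)]; simp

/-- Smooth kernels with compact support. -/
structure Ker (k : SpT → ℝ) : Prop where
  smooth : Smooth k
  cpt : HasCompactSupport k

lemma tsupport_dd_subset (v : SpT) (k : SpT → ℝ) : tsupport (dd v k) ⊆ tsupport k :=
  tsupport_fderiv_apply_subset ℝ v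

lemma Ker.dd {k : SpT → ℝ} (hk : Ker k) (v : SpT) : Ker (dd v k) :=
  ⟨hk.smooth.dd v, hk.cpt.fderiv_apply ℝ v⟩

lemma Ker.integrable {k : SpT → ℝ} (hk : Ker k) : Integrable k :=
  hk.smooth.continuous.integrable_of_hasCompactSupport hk.cpt

/-- Everywhere bounded measurable functions. -/
structure BM (f : SpT → ℝ) : Prop where
  meas : Measurable f
  bdd : ∃ C, ∀ p, |f p| ≤ C

lemma BM.locallyIntegrable {f : SpT → ℝ} (hf : BM f) : LocallyIntegrable f := by
  obtain ⟨C, hC⟩ := hf.bdd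
  exact (memLp_top_of_bound hf.meas.aestronglyMeasurable C
    (Eventually.of_forall hC)).locallyIntegrable le_top

lemma BM.comp_add {f : SpT → ℝ} (hf : BM f) (h : SpT) : BM (fun p => f (p + h)) :=
  ⟨hf.meas.comp (measurable_add_const h), hf.bdd.imp fun _ hC _ => hC _⟩

lemma BM.sub {f g : SpT → ℝ} (hf : BM f) (hg : BM g) : BM (fun p => f p - g p) := by
  obtain ⟨C, hC⟩ := hf.bdd
  obtain ⟨D, hD⟩ := hg.bdd
  exact ⟨hf.meas.sub hg.meas, C + D, fun p => (abs_sub _ _).trans (add_le_add (hC p) (hD p))⟩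

lemma BM.add {f g : SpT → ℝ} (hf : BM f) (hg : BM g) : BM (fun p => f p + g p) := by
  obtain ⟨C, hC⟩ := hf.bdd
  obtain ⟨D, hD⟩ := hg.bdd
  exact ⟨hf.meas.add hg.meas, C + D, fun p => (abs_add_le _ _).trans (add_le_add (hC p) (hD p))⟩

lemma BM.mul {f g : SpT → ℝ} (hf : BM f) (hg : BM g) : BM (fun p => f p * g p) := by
  obtain ⟨C, hC⟩ := hf.bdd
  obtain ⟨D, hD⟩ := hg.bdd
  refine ⟨hf.meas.mul hg.meas, C * D, fun p => ?_⟩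
  rw [abs_mul]
  exact mul_le_mul (hC p) (hD p) (abs_nonneg _) ((abs_nonneg _).trans (hC p))

lemma BM.const_mul {f : SpT → ℝ} (hf : BM f) (c : ℝ) : BM (fun p => c * f p) :=
  BM.mul ⟨measurable_const, |c|, fun _ => le_rfl⟩ hf

/-- Space-time convolution. -/
def J (k f : SpT → ℝ) (p : SpT) : ℝ := ∫ q, k q * f (p - q)

lemma J_eq_convolution (k f : SpT → ℝ) :
    J k f = convolution k f (ContinuousLinearMap.mul ℝ ℝ) volume := rfl

lemma J_eq (k f : SpT → ℝ) (p : SpT) : J k f p = ∫ q, k (p - q) * f q := by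
  unfold J
  rw [← integral_sub_left_eq_self _ _ p]
  simp

lemma J_integrable {k f : SpT → ℝ} (hk : Integrable k) (hf : BM f) (p : SpT) :
    Integrable (fun q => k q * f (p - q)) := by
  obtain ⟨C, hC⟩ := hf.bdd
  exact hk.mul_bdd (c := C) (hf.meas.comp (measurable_const.sub measurable_id)).aestronglyMeasurable
    (Eventually.of_forall fun q => hC _)

lemma J_smooth {k f : SpT → ℝ} (hk : Ker k) (hf : BM f) : Smooth (J k f) := by
  rw [J_eq_convolution]
  exact hk.cpt.contDiff_convolution_left _ hk.smooth hf.locallyIntegrable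

lemma dd_J {k f : SpT → ℝ} (hk : Ker k) (hf : BM f) (v : SpT) : dd v (J k f) = J (dd v k) f := by
  funext p
  have h := hk.cpt.hasFDerivAt_convolution_left (ContinuousLinearMap.mul ℝ ℝ)
    (hk.smooth.of_le (by simp)) hf.locallyIntegrable p
  rw [← J_eq_convolution] at h
  unfold dd
  rw [h.fderiv]
  unfold convolution J
  have hc : HasCompactSupport (fderiv ℝ k) := hk.cpt.fderiv ℝ
  rw [ContinuousLinearMap.integral_apply]
  · rfl
  · exact hc.convolutionExists_left _ ((hk.smooth.fderiv_right (m := (⊤ : ℕ∞)) (by simp)).continuous)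
      hf.locallyIntegrable p

lemma J_abs_le {k f : SpT → ℝ} (hk : Integrable k) {C : ℝ} (hf : ∀ᵐ p, |f p| ≤ C)
    (p : SpT) : |J k f p| ≤ (∫ q, |k q|) * C := by
  unfold J
  have h1 : ∀ᵐ q, |f (p - q)| ≤ C :=
    (quasiMeasurePreserving_sub_left volume p).ae hf
  calc |∫ q, k q * f (p - q)| ≤ ∫ q, |k q| * C := by
        rw [← Real.norm_eq_abs]
        refine norm_integral_le_of_norm_le (hk.abs.mul_const C) ?_
        filter_upwards [h1] with q hq
        rw [norm_mul]
        exact mul_le_mul_of_nonneg_left hq (abs_nonneg _)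
    _ = _ := integral_mul_const _ _

lemma J_add {k f g : SpT → ℝ} (hk : Integrable k) (hf : BM f) (hg : BM g) :
    J k (fun p => f p + g p) = fun p => J k f p + J k g p := by
  funext p
  unfold J
  rw [← integral_add (J_integrable hk hf p) (J_integrable hk hg p)]
  simp_rw [mul_add]

lemma J_sub {k f g : SpT → ℝ} (hk : Integrable k) (hf : BM f) (hg : BM g) :
    J k (fun p => f p - g p) = fun p => J k f p - J k g p := by
  funext p
  unfold J
  rw [← integral_sub (J_integrable hk hf p) (J_integrable hk hg p)]
  simp_rw [mul_sub]

lemma J_const_mul (k f : SpT → ℝ) (c : ℝ) :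
    J k (fun p => c * f p) = fun p => c * J k f p := by
  funext p
  unfold J
  rw [← integral_const_mul]
  congr 1; funext q; ring

lemma J_shift (k f : SpT → ℝ) (h : SpT) :
    J k (fun p => f (p + h)) = fun p => J k f (p + h) := by
  funext p
  unfold J
  congr 1; funext q
  rw [add_sub_right_comm]

lemma J_comm {k l f : SpT → ℝ} (hk : Ker k) (hl : Ker l) (hf : BM f) :
    J k (J l f) = J l (J k f) := by
  funext p
  unfold J
  simp_rw [← integral_const_mul]
  rw [integral_integral_swap]
  · congr 1; funext q; congr 1; funext q'
    rw [sub_right_comm]; ring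
  · obtain ⟨C, hC⟩ := hf.bdd
    have h1 : Integrable (fun z : SpT × SpT => k z.1 * l z.2) (volume.prod volume) :=
      hk.integrable.mul_prod hl.integrable
    have h2 := h1.mul_bdd (c := C) (g := fun z : SpT × SpT => f (p - z.1 - z.2))
      (hf.meas.comp ((measurable_const.sub measurable_fst).sub measurable_snd)).aestronglyMeasurable
      (Eventually.of_forall fun q => hC _)
    refine h2.congr (Eventually.of_forall fun z => ?_)
    simp [Function.uncurry]; ring

lemma J_dd {k f : SpT → ℝ} (hk : Ker k) (hf : Smooth f) (v : SpT) :
    J (dd v k) f = J k (dd v f) := by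
  funext p
  unfold J
  have hs : Smooth (fun q => f (p - q)) := hf.comp (contDiff_const.sub contDiff_id)
  have hd : ∀ q, fderiv ℝ (fun q => f (p - q)) q v = - dd v f (p - q) := by
    intro q
    have h1 : HasFDerivAt (fun q : SpT => p - q) (-(ContinuousLinearMap.id ℝ SpT)) q := by
      simpa using (hasFDerivAt_id q).const_sub p
    have h2 := ((hf.differentiable (p - q)).hasFDerivAt).comp q h1
    have h3 : (f ∘ fun q => p - q) = fun q => f (p - q) := rfl
    rw [h3] at h2
    rw [h2.fderiv]; simp [dd]
  have hk' : ∀ q, fderiv ℝ k q v = dd v k q := fun q => rfl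
  have hi := fun (a b : SpT → ℝ) (ha : Ker a) (hb : Continuous b) =>
    (ha.smooth.continuous.mul hb).integrable_of_hasCompactSupport (μ := (volume : Measure SpT))
      (ha.cpt.mul_right (f' := b))
  have := integral_mul_fderiv_eq_neg_fderiv_mul_of_integrable (μ := (volume : Measure SpT))
    (f := k) (g := fun q => f (p - q)) (v := v)
    (hi _ _ (hk.dd v) hs.continuous) (hi k _ hk (hs.dd v).continuous) (hi k _ hk hs.continuous)
    (fun q _ => hk.smooth.differentiable q) (fun q _ => hs.differentiable q)
  simp_rw [hd, hk', mul_neg, integral_neg] at this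
  linarith

/-- Smooth functions all of whose iterated directional derivatives are bounded. -/
structure SB (f : SpT → ℝ) : Prop where
  smooth : Smooth f
  bdd : ∀ l : List SpT, ∃ C, ∀ p, |l.foldr dd f p| ≤ C

lemma SB.dd {f : SpT → ℝ} (hf : SB f) (v : SpT) : SB (dd v f) :=
  ⟨hf.smooth.dd v, fun l => by simpa using hf.bdd (l ++ [v])⟩

lemma SB.BM {f : SpT → ℝ} (hf : SB f) : BM f :=
  ⟨hf.smooth.continuous.measurable, hf.bdd []⟩

lemma Ker.foldr {k : SpT → ℝ} (hk : Ker k) (l : List SpT) : Ker (l.foldr _root_.dd k) := by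
  induction l with
  | nil => exact hk
  | cons v l ih => exact ih.dd v

lemma foldr_dd_J {k f : SpT → ℝ} (hk : Ker k) (hf : BM f) (l : List SpT) :
    l.foldr dd (J k f) = J (l.foldr dd k) f := by
  induction l with
  | nil => rfl
  | cons v l ih => rw [List.foldr_cons, List.foldr_cons, ih, dd_J (hk.foldr l) hf]

lemma SB_J {k f : SpT → ℝ} (hk : Ker k) (hf : BM f) : SB (J k f) := by
  refine ⟨J_smooth hk hf, fun l => ?_⟩
  obtain ⟨C, hC⟩ := hf.bdd
  rw [foldr_dd_J hk hf]
  exact ⟨_, J_abs_le (hk.foldr l).integrable (Eventually.of_forall hC)⟩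

/-- Polynomial functions on `ℝ³`. -/
inductive PolyFn : (Euc 3 → ℝ) → Prop
  | const (c : ℝ) : PolyFn fun _ => c
  | coord (i : Fin 3) : PolyFn fun y => y i
  | add {p q : Euc 3 → ℝ} : PolyFn p → PolyFn q → PolyFn fun y => p y + q y
  | mul {p q : Euc 3 → ℝ} : PolyFn p → PolyFn q → PolyFn fun y => p y * q y

lemma PolyFn.contDiff {p : Euc 3 → ℝ} (hp : PolyFn p) : ContDiff ℝ (⊤ : ℕ∞) p := by
  induction hp with
  | const c => exact contDiff_const
  | coord i => exact (EuclideanSpace.proj i : Euc 3 →L[ℝ] ℝ).contDiff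
  | add _ _ h1 h2 => exact h1.add h2
  | mul _ _ h1 h2 => exact h1.mul h2

lemma PolyFn.growth {p : Euc 3 → ℝ} (hp : PolyFn p) :
    ∃ C : ℝ, ∃ k : ℕ, 0 ≤ C ∧ ∀ y, |p y| ≤ C * (1 + ‖y‖) ^ k := by
  have h1 : ∀ y : Euc 3, 1 ≤ 1 + ‖y‖ := fun y => by linarith [norm_nonneg y]
  induction hp with
  | const c => exact ⟨|c|, 0, abs_nonneg _, fun y => by simp⟩
  | coord i =>
    refine ⟨1, 1, zero_le_one, fun y => ?_⟩
    have := PiLp.norm_apply_le y i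
    rw [Real.norm_eq_abs] at this
    linarith
  | add _ _ ih1 ih2 =>
    obtain ⟨C, k, hC, h⟩ := ih1
    obtain ⟨D, l, hD, h'⟩ := ih2
    refine ⟨C + D, k + l, add_nonneg hC hD, fun y => (abs_add_le _ _).trans ?_⟩
    have e1 : (1 + ‖y‖) ^ k ≤ (1 + ‖y‖) ^ (k + l) := pow_le_pow_right₀ (h1 y) (by omega)
    have e2 : (1 + ‖y‖) ^ l ≤ (1 + ‖y‖) ^ (k + l) := pow_le_pow_right₀ (h1 y) (by omega)
    have e3 := mul_le_mul_of_nonneg_left e1 hC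
    have e4 := mul_le_mul_of_nonneg_left e2 hD
    linarith [h y, h' y]
  | mul _ _ ih1 ih2 =>
    obtain ⟨C, k, hC, h⟩ := ih1
    obtain ⟨D, l, hD, h'⟩ := ih2
    refine ⟨C * D, k + l, mul_nonneg hC hD, fun y => ?_⟩
    rw [abs_mul, pow_add]
    calc _ ≤ (C * (1 + ‖y‖) ^ k) * (D * (1 + ‖y‖) ^ l) :=
          mul_le_mul (h y) (h' y) (abs_nonneg _) (by positivity)
      _ = _ := by ring

lemma PolyFn.pd {p : Euc 3 → ℝ} (hp : PolyFn p) (i : Fin 3) : PolyFn (pd 3 i p) := by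
  unfold _root_.pd
  induction hp with
  | const c => simpa using PolyFn.const 0
  | coord j =>
    have : (fun x => fderiv ℝ (fun y : Euc 3 => y j) x (EuclideanSpace.single i 1)) =
        fun _ => (EuclideanSpace.single i (1 : ℝ) : Euc 3) j := by
      funext x
      exact congrArg (fun L : Euc 3 →L[ℝ] ℝ => L (EuclideanSpace.single i 1))
        (EuclideanSpace.proj j : Euc 3 →L[ℝ] ℝ).fderiv
    rw [this]
    exact PolyFn.const _
  | @add p q hp hq h1 h2 =>
    have : (fun x => fderiv ℝ (fun y => p y + q y) x (EuclideanSpace.single i 1)) =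
        fun x => fderiv ℝ p x (EuclideanSpace.single i 1) +
          fderiv ℝ q x (EuclideanSpace.single i 1) := by
      funext x
      rw [fderiv_fun_add (hp.contDiff.differentiable (by simp) x)
        (hq.contDiff.differentiable (by simp) x)]; rfl
    rw [this]
    exact h1.add h2
  | @mul p q hp hq h1 h2 =>
    have : (fun x => fderiv ℝ (fun y => p y * q y) x (EuclideanSpace.single i 1)) =
        fun x => fderiv ℝ p x (EuclideanSpace.single i 1) * q x +
          p x * fderiv ℝ q x (EuclideanSpace.single i 1) := by
      funext x
      rw [fderiv_fun_mul (hp.contDiff.differentiable (by simp) x)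
        (hq.contDiff.differentiable (by simp) x)]
      simp; ring
    rw [this]
    exact (h1.mul hq).add (hp.mul h2)

/-- The unnormalized Gaussian. -/
def gexp (y : Euc 3) : ℝ := Real.exp (-(‖y‖ ^ 2 / 4))

lemma gexp_contDiff : ContDiff ℝ (⊤ : ℕ∞) gexp :=
  (((contDiff_norm_sq ℝ).div_const 4).neg).exp

lemma pd_gexp (i : Fin 3) : pd 3 i gexp = fun y => (-(1 / 2) * y i) * gexp y := by
  funext y
  unfold pd gexp
  have h := (((hasStrictFDerivAt_norm_sq y).hasFDerivAt.mul_const (4⁻¹ : ℝ)).neg).exp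
  simp only [div_eq_mul_inv]
  simp only [Pi.neg_apply] at h
  rw [h.fderiv]
  simp [EuclideanSpace.inner_single_right]
  ring

/-- Polynomial times Gaussian. -/
def GS (g : Euc 3 → ℝ) : Prop := ∃ p, PolyFn p ∧ g = fun y => p y * gexp y

lemma GS.contDiff {g : Euc 3 → ℝ} (hg : GS g) : ContDiff ℝ (⊤ : ℕ∞) g := by
  obtain ⟨p, hp, rfl⟩ := hg
  exact hp.contDiff.mul gexp_contDiff

lemma GS.pd {g : Euc 3 → ℝ} (hg : GS g) (i : Fin 3) : GS (pd 3 i g) := by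
  obtain ⟨p, hp, rfl⟩ := hg
  refine ⟨fun y => _root_.pd 3 i p y + p y * (-(1 / 2) * y i),
    (hp.pd i).add (hp.mul ((PolyFn.const _).mul (PolyFn.coord i))), ?_⟩
  funext y
  have h2 := congrFun (pd_gexp i) y
  unfold _root_.pd at h2 ⊢
  rw [fderiv_fun_mul (hp.contDiff.differentiable (by simp) y)
    (gexp_contDiff.differentiable (by simp) y)]
  simp only [_root_.add_apply, _root_.smul_apply, smul_eq_mul, h2]
  ring

lemma GS.coord_mul {g : Euc 3 → ℝ} (hg : GS g) (i : Fin 3) : GS (fun y => y i * g y) := by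
  obtain ⟨p, hp, rfl⟩ := hg
  exact ⟨fun y => y i * p y, (PolyFn.coord i).mul hp, by funext y; ring⟩

lemma gexp_le (n : ℕ) : ∃ C, ∀ y, (1 + ‖y‖) ^ n * gexp y ≤ C := by
  refine ⟨(n.factorial : ℝ) * Real.exp 2, fun y => ?_⟩
  have h := Real.pow_div_factorial_le_exp (1 + ‖y‖) (by positivity) n
  rw [div_le_iff₀ (by positivity)] at h
  unfold gexp
  have h2 : Real.exp (1 + ‖y‖) * Real.exp (-(‖y‖ ^ 2 / 4)) ≤ Real.exp 2 := by
    rw [← Real.exp_add]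
    apply Real.exp_le_exp.mpr
    nlinarith [sq_nonneg (‖y‖ - 2)]
  calc _ ≤ (Real.exp (1 + ‖y‖) * n.factorial) * Real.exp (-(‖y‖ ^ 2 / 4)) :=
        mul_le_mul_of_nonneg_right h (Real.exp_pos _).le
    _ = n.factorial * (Real.exp (1 + ‖y‖) * Real.exp (-(‖y‖ ^ 2 / 4))) := by ring
    _ ≤ _ := mul_le_mul_of_nonneg_left h2 (by positivity)

lemma GS.integrable_weight {g : Euc 3 → ℝ} (hg : GS g) :
    Integrable (fun y => (1 + ‖y‖) * g y) := by
  have hc := hg.contDiff.continuous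
  obtain ⟨p, hp, rfl⟩ := hg
  obtain ⟨C, k, hC, h⟩ := hp.growth
  obtain ⟨D, hD⟩ := gexp_le (k + 5)
  have hi : Integrable (fun x : Euc 3 => (1 + ‖x‖) ^ (-(4 : ℝ))) :=
    integrable_one_add_norm (by simp; norm_num)
  refine (hi.const_mul (C * D)).mono' (by fun_prop) (Eventually.of_forall fun y => ?_)
  have h0 : 0 < 1 + ‖y‖ := by positivity
  have hg0 : 0 < gexp y := Real.exp_pos _
  rw [Real.rpow_neg h0.le, show (4 : ℝ) = ((4 : ℕ) : ℝ) by norm_num, Real.rpow_natCast,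
    ← div_eq_mul_inv, le_div_iff₀ (by positivity), norm_mul, norm_mul, Real.norm_of_nonneg h0.le,
    Real.norm_of_nonneg hg0.le, Real.norm_eq_abs]
  calc _ ≤ (1 + ‖y‖) * ((C * (1 + ‖y‖) ^ k) * gexp y) * (1 + ‖y‖) ^ 4 := by
        gcongr; exact h y
    _ = C * ((1 + ‖y‖) ^ (k + 5) * gexp y) := by ring
    _ ≤ _ := mul_le_mul_of_nonneg_left (hD y) hC

lemma GS.integrable {g : Euc 3 → ℝ} (hg : GS g) : Integrable g := by
  refine hg.integrable_weight.mono hg.contDiff.continuous.aestronglyMeasurable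
    (Eventually.of_forall fun y => ?_)
  rw [norm_mul, Real.norm_of_nonneg (by positivity : 0 ≤ 1 + ‖y‖)]
  nlinarith [norm_nonneg y, norm_nonneg (g y), mul_nonneg (norm_nonneg y) (norm_nonneg (g y))]

/-- The Gaussian convolution at scale `s ^ 2`, in the space variables. -/
def Tg (g : Euc 3 → ℝ) (s : ℝ) (f : SpT → ℝ) (p : SpT) : ℝ :=
  ∫ y, g y * f (p + s ^ 2 • ((y, 0) : SpT))

lemma SB.measurable_shift {f : SpT → ℝ} (hf : Continuous f) (s : ℝ) (p : SpT) :
    Continuous fun y : Euc 3 => f (p + s ^ 2 • ((y, 0) : SpT)) :=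
  hf.comp (continuous_const.add ((continuous_id.prodMk continuous_const).const_smul (s ^ 2)))

lemma Tg_integrable {g : Euc 3 → ℝ} (hg : Integrable g) {f : SpT → ℝ} (hf : SB f) (s : ℝ)
    (p : SpT) : Integrable fun y => g y * f (p + s ^ 2 • ((y, 0) : SpT)) := by
  obtain ⟨C, hC⟩ := hf.BM.bdd
  exact hg.mul_bdd (c := C) (SB.measurable_shift hf.smooth.continuous s p).aestronglyMeasurable
    (Eventually.of_forall fun q => hC _)

lemma Tg_abs_le {g : Euc 3 → ℝ} (hg : Integrable g) {f : SpT → ℝ} {C : ℝ} {p : SpT}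
    (hf : ∀ y : Euc 3, |f (p + ((y, 0) : SpT))| ≤ C) (s : ℝ) :
    |Tg g s f p| ≤ (∫ y, |g y|) * C := by
  unfold Tg
  rw [← integral_mul_const, ← Real.norm_eq_abs]
  refine norm_integral_le_of_norm_le (hg.abs.mul_const C) (Eventually.of_forall fun y => ?_)
  rw [norm_mul, Real.norm_eq_abs, Real.norm_eq_abs]
  refine mul_le_mul_of_nonneg_left ?_ (abs_nonneg _)
  have := hf (s ^ 2 • y)
  simpa using this

lemma SB.fderiv_bound {f : SpT → ℝ} (hf : SB f) : ∃ L, 0 ≤ L ∧ ∀ p, ‖fderiv ℝ f p‖ ≤ L := by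
  obtain ⟨C0, h0⟩ := (hf.dd et).BM.bdd
  choose C hC using fun i => (hf.dd (ex i)).BM.bdd
  have hpos0 : 0 ≤ C0 := (abs_nonneg _).trans (h0 0)
  have hpos : ∀ i, 0 ≤ C i := fun i => (abs_nonneg _).trans (hC i 0)
  refine ⟨C0 + ∑ i, C i, add_nonneg hpos0 (Finset.sum_nonneg fun i _ => hpos i), fun p => ?_⟩
  refine ContinuousLinearMap.opNorm_le_bound _
    (add_nonneg hpos0 (Finset.sum_nonneg fun i _ => hpos i)) fun v => ?_
  have hv : v = v.2 • et + ∑ i, v.1 i • ex i := by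
    refine Prod.ext ?_ ?_
    · rw [Prod.fst_add, Prod.fst_sum]
      simp only [et, ex, Prod.smul_mk, smul_zero, zero_add]
      ext j
      simp [Finset.sum_apply, Pi.single_apply]
    · simp [et, ex, Prod.snd_sum]
  have e1 : fderiv ℝ f p v = v.2 * _root_.dd et f p + ∑ i, v.1 i * _root_.dd (ex i) f p := by
    conv_lhs => rw [hv]
    simp [_root_.dd]
  rw [e1, add_mul, Finset.sum_mul, Real.norm_eq_abs]
  refine (abs_add_le _ _).trans (add_le_add ?_ ((Finset.abs_sum_le_sum_abs _ _).trans
    (Finset.sum_le_sum fun i _ => ?_)))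
  · rw [abs_mul, mul_comm]
    exact mul_le_mul (h0 p) (by simpa using norm_snd_le v) (abs_nonneg _) hpos0
  · rw [abs_mul, mul_comm]
    exact mul_le_mul (hC i p) ((PiLp.norm_apply_le v.1 i).trans (norm_fst_le v))
      (abs_nonneg _) (hpos i)

lemma Tg_hasDerivAt {g : Euc 3 → ℝ} (hg : GS g) {f : SpT → ℝ} (hf : SB f) {s : ℝ → ℝ}
    {c : ℝ → SpT} {s' : ℝ} {c' : SpT} {r : ℝ} (hs : HasDerivAt s s' r) (hc : HasDerivAt c c' r) :
    HasDerivAt (fun r => Tg g (s r) f (c r))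
      (Tg g (s r) (dd c' f) (c r) +
        2 * s r * s' * ∑ i, Tg (fun y => y i * g y) (s r) (dd (ex i) f) (c r)) r := by
  obtain ⟨L, hL0, hL⟩ := hf.fderiv_bound
  have hgi := hg.integrable_weight
  have hgc := hg.contDiff.continuous
  -- joint differentiability of `(a, p) ↦ ∫ g y * f (p + a • (y, 0))`
  let D : Euc 3 → (ℝ × SpT →L[ℝ] SpT) := fun y =>
    ContinuousLinearMap.snd ℝ ℝ SpT +
      (ContinuousLinearMap.fst ℝ ℝ SpT).smulRight ((y, 0) : SpT)
  have hD : ∀ (z : ℝ × SpT) (y : Euc 3), D y z = z.2 + z.1 • ((y, 0) : SpT) := fun z y => rfl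
  have hDn : ∀ y, ‖D y‖ ≤ 1 + ‖y‖ := by
    intro y
    refine ContinuousLinearMap.opNorm_le_bound _ (by positivity) fun z => ?_
    rw [hD]
    refine (norm_add_le _ _).trans ?_
    rw [norm_smul, add_mul, one_mul, mul_comm]
    refine add_le_add (norm_snd_le z) (mul_le_mul ?_ (norm_fst_le z) (norm_nonneg _)
      (norm_nonneg _))
    simp
  have hDc : Continuous D := by
    have : Continuous fun y : Euc 3 => ((y, 0) : SpT) := by fun_prop
    exact continuous_const.add ((ContinuousLinearMap.smulRightL ℝ (ℝ × SpT) SpT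
      (ContinuousLinearMap.fst ℝ ℝ SpT)).continuous.comp this)
  have hfc : Continuous (fderiv ℝ f) :=
    (hf.smooth.fderiv_right (m := (⊤ : ℕ∞)) (by simp)).continuous
  have hDz : ∀ z : ℝ × SpT, Continuous fun y => D y z := fun z =>
    hDc.clm_apply continuous_const
  let F' : ℝ × SpT → Euc 3 → (ℝ × SpT →L[ℝ] ℝ) := fun z y =>
    g y • (fderiv ℝ f (D y z)).comp (D y)
  have hF'c : ∀ z, Continuous (F' z) := fun z =>
    hgc.smul ((hfc.comp (hDz z)).clm_comp hDc)
  have hF'b : ∀ z y, ‖F' z y‖ ≤ ‖L * ((1 + ‖y‖) * g y)‖ := by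
    intro z y
    rw [norm_smul, norm_mul, norm_mul, Real.norm_of_nonneg hL0,
      Real.norm_of_nonneg (by positivity : 0 ≤ 1 + ‖y‖)]
    have := ContinuousLinearMap.opNorm_comp_le (fderiv ℝ f (D y z)) (D y)
    calc _ ≤ ‖g y‖ * (L * (1 + ‖y‖)) := by
          refine mul_le_mul_of_nonneg_left (this.trans ?_) (norm_nonneg _)
          exact mul_le_mul (hL _) (hDn y) (norm_nonneg _) hL0
      _ = _ := by ring
  have hF'i : ∀ z, Integrable (F' z) := fun z =>
    (hgi.const_mul L).mono (hF'c z).aestronglyMeasurable (Eventually.of_forall (hF'b z))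
  have key : ∀ z : ℝ × SpT, HasFDerivAt (fun z => ∫ y, g y * f (D y z)) (∫ y, F' z y) z := by
    intro z
    refine hasFDerivAt_integral_of_dominated_of_fderiv_le (s := Set.univ) univ_mem
      (bound := fun y => ‖L * ((1 + ‖y‖) * g y)‖)
      (Eventually.of_forall fun z => ?_) ?_ (hF'c z).aestronglyMeasurable
      (Eventually.of_forall fun y z _ => hF'b z y) (hgi.const_mul L).norm
      (Eventually.of_forall fun y z _ => ?_)
    · exact (hgc.mul (hf.smooth.continuous.comp (hDz z))).aestronglyMeasurable
    · obtain ⟨C, hC⟩ := hf.BM.bdd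
      exact hg.integrable.mul_bdd (c := C)
        (hf.smooth.continuous.comp (hDz z)).aestronglyMeasurable
        (Eventually.of_forall fun q => hC _)
    · exact (((hf.smooth.differentiable (D y z)).hasFDerivAt).comp z
        (D y).hasFDerivAt).const_mul (g y)
  have hcurve : HasDerivAt (fun r => ((s r ^ 2, c r) : ℝ × SpT)) (2 * s r * s', c') r := by
    have := (hs.pow 2).prodMk hc
    simpa using this
  have h := (key (s r ^ 2, c r)).comp_hasDerivAt r hcurve
  have e1 : ((fun z : ℝ × SpT => ∫ y, g y * f (D y z)) ∘ fun r => ((s r ^ 2, c r) : ℝ × SpT)) =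
      fun r => Tg g (s r) f (c r) := by
    funext r; rfl
  rw [e1] at h
  refine h.congr_deriv (Eq.symm ?_)
  rw [ContinuousLinearMap.integral_apply (hF'i _)]
  have hi1 := Tg_integrable hg.integrable (hf.dd c') (s r) (c r)
  have hi2 := fun i => Tg_integrable (hg.coord_mul i).integrable (hf.dd (ex i)) (s r) (c r)
  unfold Tg
  rw [← integral_finsetSum _ (fun i _ => hi2 i), ← integral_const_mul, ← integral_add hi1
    ((integrable_finsetSum _ (fun i _ => hi2 i)).const_mul _)]
  congr 1
  funext y
  have hy : ((y, 0) : SpT) = ∑ i, y i • ex i := by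
    refine Prod.ext ?_ ?_
    · rw [Prod.fst_sum]
      simp only [ex, Prod.smul_mk]
      ext j
      simp [Finset.sum_apply, Pi.single_apply]
    · simp [ex, Prod.snd_sum]
  have e2 : F' (s r ^ 2, c r) y (2 * s r * s', c') =
      g y * fderiv ℝ f (c r + s r ^ 2 • ((y, 0) : SpT)) (c' + (2 * s r * s') • ((y, 0) : SpT)) :=
    rfl
  rw [e2, map_add, map_smul]
  conv_rhs => rw [hy]
  rw [map_sum]
  simp only [map_smul, smul_eq_mul, dd, ← hy, mul_add, Finset.mul_sum]
  congr 1
  refine Finset.sum_congr rfl fun i _ => ?_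
  ring

lemma SB.add {f g : SpT → ℝ} (hf : SB f) (hg : SB g) : SB (fun p => f p + g p) := by
  have key : ∀ l : List SpT, (l.foldr _root_.dd fun p => f p + g p) =
      fun p => l.foldr _root_.dd f p + l.foldr _root_.dd g p := by
    have hs : ∀ {h : SpT → ℝ}, SB h → ∀ l : List SpT, Smooth (l.foldr _root_.dd h) := by
      intro h hh l
      induction l with
      | nil => exact hh.smooth
      | cons v l ih => exact ih.dd v
    intro l
    induction l with
    | nil => rfl
    | cons v l ih =>
      rw [List.foldr_cons, ih, dd_add (hs hf l).differentiable (hs hg l).differentiable]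
      rfl
  refine ⟨hf.smooth.add hg.smooth, fun l => ?_⟩
  obtain ⟨C, hC⟩ := hf.bdd l
  obtain ⟨D, hD⟩ := hg.bdd l
  exact ⟨C + D, fun p => by rw [key]; exact (abs_add_le _ _).trans (add_le_add (hC p) (hD p))⟩

lemma SB.const_mul {f : SpT → ℝ} (hf : SB f) (c : ℝ) : SB (fun p => c * f p) := by
  have key : ∀ l : List SpT, ((l.foldr _root_.dd fun p => c * f p) =
      fun p => c * l.foldr _root_.dd f p) ∧ Smooth (l.foldr _root_.dd f) := by
    intro l
    induction l with
    | nil => exact ⟨rfl, hf.smooth⟩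
    | cons v l ih =>
      rw [List.foldr_cons, ih.1, dd_const_mul ih.2.differentiable]
      exact ⟨rfl, ih.2.dd v⟩
  refine ⟨contDiff_const.mul hf.smooth, fun l => ?_⟩
  obtain ⟨C, hC⟩ := hf.bdd l
  refine ⟨|c| * C, fun p => ?_⟩
  rw [(key l).1, abs_mul]
  exact mul_le_mul_of_nonneg_left (hC p) (abs_nonneg _)

lemma SB.zero : SB (fun _ => 0) := by
  refine ⟨contDiff_const, fun l => ⟨0, fun p => ?_⟩⟩
  have : l.foldr _root_.dd (fun _ : SpT => (0 : ℝ)) = fun _ => 0 := by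
    induction l with
    | nil => rfl
    | cons v l ih => rw [List.foldr_cons, ih]; funext p; simp [_root_.dd]
  rw [this]; simp

lemma SB.sum {ι : Type*} (s : Finset ι) {f : ι → SpT → ℝ} (hf : ∀ i, SB (f i)) :
    SB (fun p => ∑ i ∈ s, f i p) := by
  classical
  induction s using Finset.induction_on with
  | empty => simpa using SB.zero
  | insert a s ha ih => simpa [Finset.sum_insert ha] using (hf a).add ih

/-- The normalized Gaussian. -/
def gau (y : Euc 3) : ℝ := (∫ z, gexp z)⁻¹ * gexp y

lemma gau_GS : GS gau := ⟨_, PolyFn.const _, rfl⟩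

lemma gexp_GS : GS gexp := ⟨_, PolyFn.const 1, by funext y; simp⟩

lemma integral_gexp_pos : 0 < ∫ z, gexp z := integral_exp_pos gexp_GS.integrable

lemma integral_gau : ∫ y, gau y = 1 := by
  unfold gau
  rw [integral_const_mul, inv_mul_cancel₀ integral_gexp_pos.ne']

lemma pd_gau (i : Fin 3) : pd 3 i gau = fun y => (-(1 / 2)) * (y i * gau y) := by
  funext y
  have h := congrFun (pd_gexp i) y
  unfold pd gau at *
  rw [fderiv_const_mul (gexp_contDiff.differentiable (by simp) y), _root_.smul_apply, h]
  simp only [smul_eq_mul]; ring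

lemma Tg_const_mul_left (c : ℝ) (g : Euc 3 → ℝ) (s : ℝ) (f : SpT → ℝ) (p : SpT) :
    Tg (fun y => c * g y) s f p = c * Tg g s f p := by
  unfold Tg
  rw [← integral_const_mul]
  congr 1; funext y; ring

lemma Tg_add {g : Euc 3 → ℝ} (hg : Integrable g) {f h : SpT → ℝ} (hf : SB f) (hh : SB h) (s : ℝ)
    (p : SpT) : Tg g s (fun q => f q + h q) p = Tg g s f p + Tg g s h p := by
  unfold Tg
  rw [← integral_add (Tg_integrable hg hf s p) (Tg_integrable hg hh s p)]
  simp_rw [mul_add]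

lemma Tg_const_mul (g : Euc 3 → ℝ) (f : SpT → ℝ) (c s : ℝ)
    (p : SpT) : Tg g s (fun q => c * f q) p = c * Tg g s f p := by
  unfold Tg
  rw [← integral_const_mul]
  congr 1; funext y; ring

lemma Tg_sum {ι : Type*} (t : Finset ι) {g : Euc 3 → ℝ} (hg : Integrable g) {f : ι → SpT → ℝ}
    (hf : ∀ i, SB (f i)) (s : ℝ) (p : SpT) :
    Tg g s (fun q => ∑ i ∈ t, f i q) p = ∑ i ∈ t, Tg g s (f i) p := by
  unfold Tg
  rw [← integral_finsetSum _ (fun i _ => Tg_integrable hg (hf i) s p)]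
  simp_rw [Finset.mul_sum]

lemma Tg_pd {g : Euc 3 → ℝ} (hg : GS g) {f : SpT → ℝ} (hf : SB f) (i : Fin 3) (s : ℝ) (p : SpT) :
    Tg (pd 3 i g) s f p = -(s ^ 2 * Tg g s (dd (ex i) f) p) := by
  have hd : ∀ y, HasFDerivAt (fun y : Euc 3 => f (p + s ^ 2 • ((y, 0) : SpT)))
      ((fderiv ℝ f (p + s ^ 2 • ((y, 0) : SpT))).comp
        (s ^ 2 • ContinuousLinearMap.inl ℝ (Euc 3) ℝ)) y := by
    intro y
    refine HasFDerivAt.comp y (hf.smooth.differentiable _).hasFDerivAt ?_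
    exact ((s ^ 2 • ContinuousLinearMap.inl ℝ (Euc 3) ℝ).hasFDerivAt).const_add p
  have hd' : ∀ y, fderiv ℝ (fun y : Euc 3 => f (p + s ^ 2 • ((y, 0) : SpT))) y
      (EuclideanSpace.single i 1) = s ^ 2 * dd (ex i) f (p + s ^ 2 • ((y, 0) : SpT)) := by
    intro y
    rw [(hd y).fderiv]
    simp only [ContinuousLinearMap.comp_apply, _root_.smul_apply, map_smul, smul_eq_mul]
    rfl
  have hi := Tg_integrable hg.integrable (hf.dd (ex i)) s p
  have h := integral_mul_fderiv_eq_neg_fderiv_mul_of_integrable (μ := (volume : Measure (Euc 3)))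
    (f := g) (g := fun y => f (p + s ^ 2 • ((y, 0) : SpT))) (v := EuclideanSpace.single i 1)
    (Tg_integrable (hg.pd i).integrable hf s p)
    (by simp_rw [hd']; exact (hi.const_mul (s ^ 2)).congr (Eventually.of_forall fun y => by ring))
    (Tg_integrable hg.integrable hf s p)
    (fun y _ => hg.contDiff.differentiable (by simp) y) (fun y _ => (hd y).differentiableAt)
  simp_rw [hd'] at h
  unfold Tg
  rw [← integral_const_mul, ← integral_neg]
  have e : ∀ y, pd 3 i g y = fderiv ℝ g y (EuclideanSpace.single i 1) := fun y => rfl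
  simp_rw [e]
  rw [← neg_eq_iff_eq_neg.mpr h, integral_neg]
  congr 2; funext y; ring

lemma Tg_coord_gau {f : SpT → ℝ} (hf : SB f) (i : Fin 3) (s : ℝ) (p : SpT) :
    Tg (fun y => y i * gau y) s f p = 2 * s ^ 2 * Tg gau s (dd (ex i) f) p := by
  have h := Tg_pd gau_GS hf i s p
  rw [pd_gau, Tg_const_mul_left] at h
  linarith

/-- The Laplacian in the space variables. -/
def Lap (f : SpT → ℝ) (p : SpT) : ℝ := ∑ i, dd (ex i) (dd (ex i) f) p

lemma SB.Lap {f : SpT → ℝ} (hf : SB f) : SB (Lap f) :=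
  SB.sum _ fun i => (hf.dd (ex i)).dd (ex i)

lemma Tg_gau_hasDerivAt {f : SpT → ℝ} (hf : SB f) (p : SpT) (a b r : ℝ) :
    HasDerivAt (fun r => Tg gau r f (p + (a * (b - r ^ 4)) • et))
      (4 * r ^ 3 * (Tg gau r (Lap f) (p + (a * (b - r ^ 4)) • et)
        - a * Tg gau r (dd et f) (p + (a * (b - r ^ 4)) • et))) r := by
  have hc : HasDerivAt (fun r : ℝ => p + (a * (b - r ^ 4)) • et) ((a * -(4 * r ^ 3)) • et) r := by
    have h1 : HasDerivAt (fun r : ℝ => a * (b - r ^ 4)) (a * -(4 * r ^ 3)) r := by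
      simpa using ((hasDerivAt_pow 4 r).const_sub b).const_mul a
    exact (h1.smul_const et).const_add p
  refine (Tg_hasDerivAt gau_GS hf (hasDerivAt_id r) hc).congr_deriv ?_
  have e1 : dd ((a * -(4 * r ^ 3)) • et) f = fun q => (a * -(4 * r ^ 3)) * dd et f q := by
    funext q; simp [dd]
  have e2 : Tg gau r (Lap f) (p + (a * (b - r ^ 4)) • et) =
      ∑ i, Tg gau r (dd (ex i) (dd (ex i) f)) (p + (a * (b - r ^ 4)) • et) :=
    Tg_sum _ gau_GS.integrable (fun i => (hf.dd (ex i)).dd (ex i)) _ _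
  rw [e1, Tg_const_mul, e2]
  simp only [id]
  simp_rw [fun i => Tg_coord_gau (hf.dd (ex i)) i r (p + (a * (b - r ^ 4)) • et)]
  rw [← Finset.mul_sum]
  ring

/-- Iterated partial derivatives of the Gaussian. -/
def dgau (l : List (Fin 3)) : Euc 3 → ℝ := l.foldr (pd 3) gau

lemma dgau_GS (l : List (Fin 3)) : GS (dgau l) := by
  induction l with
  | nil => exact gau_GS
  | cons i l ih => exact ih.pd i

/-- Iterated spatial derivatives. -/
def ddx (l : List (Fin 3)) (f : SpT → ℝ) : SpT → ℝ := l.foldr (fun i f => dd (ex i) f) f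

lemma SB.ddx {f : SpT → ℝ} (hf : SB f) (l : List (Fin 3)) : SB (ddx l f) := by
  induction l with
  | nil => exact hf
  | cons i l ih => exact ih.dd _

lemma ddx_cons_comm {f : SpT → ℝ} (hf : SB f) (i : Fin 3) (l : List (Fin 3)) :
    ddx l (dd (ex i) f) = ddx (i :: l) f := by
  induction l with
  | nil => rfl
  | cons j l ih =>
    show dd (ex j) (ddx l (dd (ex i) f)) = dd (ex i) (dd (ex j) (ddx l f))
    rw [ih]
    exact dd_comm (hf.ddx l).smooth _ _

lemma Tg_dgau (l : List (Fin 3)) {f : SpT → ℝ} (hf : SB f) (s : ℝ) (p : SpT) :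
    Tg (dgau l) s f p = (-1) ^ l.length * s ^ (2 * l.length) * Tg gau s (ddx l f) p := by
  induction l generalizing f with
  | nil => simp [dgau, ddx]
  | cons i l ih =>
    show Tg (pd 3 i (dgau l)) s f p = _
    rw [Tg_pd (dgau_GS l) hf, ih (hf.dd (ex i)), ddx_cons_comm hf, List.length_cons]
    ring

lemma exists_dgau_bound : ∃ M : ℝ, 1 ≤ M ∧ ∀ l : List (Fin 3), l.length ≤ 4 →
    (∫ y, (1 + ‖y‖) * |dgau l y|) ≤ M := by
  have hf := (List.finite_length_le (Fin 3) 4).image fun l => ∫ y, (1 + ‖y‖) * |dgau l y|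
  obtain ⟨M, hM⟩ := hf.bddAbove
  exact ⟨max M 1, le_max_right _ _, fun l hl => (hM ⟨l, hl, rfl⟩).trans (le_max_left _ _)⟩

/-- A common bound for the weighted `L¹` norms of low order derivatives of the Gaussian. -/
def gM : ℝ := exists_dgau_bound.choose

lemma one_le_gM : 1 ≤ gM := exists_dgau_bound.choose_spec.1

lemma dgau_weight_integrable (l : List (Fin 3)) : Integrable fun y => (1 + ‖y‖) * |dgau l y| := by
  refine (dgau_GS l).integrable_weight.abs.congr (Eventually.of_forall fun y => ?_)
  simp only [abs_mul]
  rw [abs_of_nonneg (by positivity : 0 ≤ 1 + ‖y‖)]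

lemma dgau_weight_le {l : List (Fin 3)} (hl : l.length ≤ 4) :
    (∫ y, (1 + ‖y‖) * |dgau l y|) ≤ gM := exists_dgau_bound.choose_spec.2 l hl

lemma dgau_le {l : List (Fin 3)} (hl : l.length ≤ 4) : (∫ y, |dgau l y|) ≤ gM := by
  refine le_trans (integral_mono (dgau_GS l).integrable.abs (dgau_weight_integrable l)
    fun y => ?_) (dgau_weight_le hl)
  have := mul_nonneg (norm_nonneg y) (abs_nonneg (dgau l y))
  simp only
  linarith

lemma Tg_gau_ddx_le {l : List (Fin 3)} (hl : l.length ≤ 4) {f : SpT → ℝ} (hf : SB f) {s : ℝ}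
    (hs : 0 < s) {p : SpT} {C : ℝ} (hC : ∀ y : Euc 3, |f (p + ((y, 0) : SpT))| ≤ C) :
    |Tg gau s (ddx l f) p| ≤ gM * C / s ^ (2 * l.length) := by
  have h := Tg_dgau l hf s p
  have h2 := Tg_abs_le (dgau_GS l).integrable hC s
  have hC0 : 0 ≤ C := (abs_nonneg _).trans (hC 0)
  rw [h, abs_mul, abs_mul, abs_pow, abs_neg, abs_one, one_pow, one_mul,
    abs_of_pos (by positivity : 0 < s ^ (2 * l.length))] at h2
  rw [le_div_iff₀ (by positivity), mul_comm]
  exact h2.trans (mul_le_mul_of_nonneg_right (dgau_le hl) hC0)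

lemma integral_dgau {l : List (Fin 3)} (hl : l ≠ []) : ∫ y, dgau l y = 0 := by
  have h1 : SB (fun _ => 1) := by
    refine ⟨contDiff_const, fun l => ?_⟩
    rcases List.eq_nil_or_concat l with rfl | ⟨l', v, rfl⟩
    · exact ⟨1, fun p => by simp⟩
    · have : dd v (fun _ : SpT => (1 : ℝ)) = fun _ => 0 := by funext p; simp [dd]
      simpa [this] using SB.zero.bdd l'
  have h := Tg_dgau l h1 1 0
  obtain ⟨i, l, rfl⟩ := List.exists_cons_of_ne_nil hl
  have e : ddx l (dd (ex i) fun _ => 1) = ddx l fun _ => 0 := by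
    congr 1; funext p; simp [dd]
  have e2 : ddx l (fun _ => 0) = fun _ => 0 := by
    clear h e hl
    induction l with
    | nil => rfl
    | cons j l ih =>
      show dd (ex j) (ddx l fun _ => 0) = _
      rw [ih]; funext p; simp [dd]
  rw [← ddx_cons_comm h1, e, e2] at h
  simpa [Tg] using h

lemma Tg_gau_ddx_le_holder {l : List (Fin 3)} (hl : l.length ≤ 4) (hl0 : l ≠ []) {f : SpT → ℝ}
    (hf : SB f) {s : ℝ} (hs : 0 < s) {p : SpT} {C : ℝ} (hC0 : 0 ≤ C)
    (hC : ∀ y : Euc 3, |f (p + ((y, 0) : SpT)) - f p| ≤ C * √‖y‖) :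
    |Tg gau s (ddx l f) p| ≤ gM * C * s / s ^ (2 * l.length) := by
  have h := Tg_dgau l hf s p
  have e1 : Tg (dgau l) s f p = ∫ y, dgau l y * (f (p + s ^ 2 • ((y, 0) : SpT)) - f p) := by
    simp_rw [mul_sub]
    rw [integral_sub (Tg_integrable (dgau_GS l).integrable hf s p)
      ((dgau_GS l).integrable.mul_const _), integral_mul_const, integral_dgau hl0]
    simp [Tg]
  have h2 : |Tg (dgau l) s f p| ≤ (∫ y, (1 + ‖y‖) * |dgau l y|) * (C * s) := by
    rw [e1, ← integral_mul_const, ← Real.norm_eq_abs]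
    refine norm_integral_le_of_norm_le ((dgau_weight_integrable l).mul_const _)
      (Eventually.of_forall fun y => ?_)
    rw [norm_mul, Real.norm_eq_abs, Real.norm_eq_abs]
    have h3 := hC (s ^ 2 • y)
    have h4 : √‖s ^ 2 • y‖ = s * √‖y‖ := by
      rw [norm_smul, Real.norm_of_nonneg (by positivity), Real.sqrt_mul (by positivity),
        Real.sqrt_sq hs.le]
    have h5 : √‖y‖ ≤ 1 + ‖y‖ := by
      rw [Real.sqrt_le_left (by positivity)]
      nlinarith [norm_nonneg y]
    have h6 : ((s ^ 2 • y, 0) : SpT) = s ^ 2 • ((y, 0) : SpT) := by simp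
    rw [h6, h4] at h3
    calc |dgau l y| * |f (p + s ^ 2 • ((y, 0) : SpT)) - f p|
        ≤ |dgau l y| * (C * (s * (1 + ‖y‖))) := by
          refine mul_le_mul_of_nonneg_left (h3.trans ?_) (abs_nonneg _)
          gcongr
      _ = _ := by ring
  rw [h, abs_mul, abs_mul, abs_pow, abs_neg, abs_one, one_pow, one_mul,
    abs_of_pos (by positivity : 0 < s ^ (2 * l.length))] at h2
  rw [le_div_iff₀ (by positivity), mul_comm, mul_assoc]
  exact h2.trans (mul_le_mul_of_nonneg_right (dgau_weight_le hl) (by positivity))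

lemma heat_decay {f N : SpT → ℝ} (hf : SB f) (hN : SB N) {t₀ b A : ℝ} {n : ℕ} (hn : 1 ≤ n)
    (hb : 0 ≤ b) (heq : ∀ p : SpT, p.2 < t₀ → dd et f p = Lap f p + N p)
    (hNb : ∀ s > 0, ∀ p : SpT, p.2 < t₀ → |Tg gau s N p| ≤ b / s ^ (n + 4))
    (hA : ∀ s > 0, ∀ p : SpT, |Tg gau s f p| ≤ A / s ^ 2) {s : ℝ} (hs : 0 < s) {p : SpT}
    (hp : p.2 < t₀) : |Tg gau s f p| ≤ 4 * b / s ^ n := by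
  have hc2 : ∀ r, s ≤ r → (p + (1 * (s ^ 4 - r ^ 4)) • et).2 < t₀ := by
    intro r hr
    have : s ^ 4 ≤ r ^ 4 := pow_le_pow_left₀ hs.le hr 4
    simp only [et, Prod.snd_add, Prod.smul_snd, smul_eq_mul]
    linarith
  have hK : ∀ r, s ≤ r → HasDerivAt (fun r => Tg gau r f (p + (1 * (s ^ 4 - r ^ 4)) • et))
      (-(4 * r ^ 3 * Tg gau r N (p + (1 * (s ^ 4 - r ^ 4)) • et))) r := by
    intro r hr
    refine (Tg_gau_hasDerivAt hf p 1 (s ^ 4) r).congr_deriv ?_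
    have : Tg gau r (dd et f) (p + (1 * (s ^ 4 - r ^ 4)) • et) =
        Tg gau r (fun q => Lap f q + N q) (p + (1 * (s ^ 4 - r ^ 4)) • et) := by
      unfold Tg
      congr 1; funext y
      rw [heq _ (by simpa using hc2 r hr)]
    rw [this, Tg_add gau_GS.integrable hf.Lap hN]
    ring
  have hKb : ∀ r, s ≤ r → |4 * r ^ 3 * Tg gau r N (p + (1 * (s ^ 4 - r ^ 4)) • et)|
      ≤ 4 * b / r ^ (n + 1) := by
    intro r hr
    have hr0 : 0 < r := hs.trans_le hr
    rw [abs_mul, abs_of_pos (by positivity)]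
    refine (mul_le_mul_of_nonneg_left (hNb r hr0 _ (hc2 r hr)) (by positivity)).trans
      (le_of_eq ?_)
    field_simp
    ring
  have main : ∀ ε : ℝ, |ε| = 1 → 0 ≤ ε * Tg gau s f p + 4 * b / s ^ n := by
    intro ε hε
    let φ : ℝ → ℝ := fun r =>
      ε * Tg gau r f (p + (1 * (s ^ 4 - r ^ 4)) • et) + 4 * b * (r ^ n)⁻¹
    have hφ : ∀ r, s ≤ r → HasDerivAt φ
        (ε * -(4 * r ^ 3 * Tg gau r N (p + (1 * (s ^ 4 - r ^ 4)) • et)) +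
          4 * b * (-(n * r ^ (n - 1)) / (r ^ n) ^ 2)) r := by
      intro r hr
      have hr0 : 0 < r := hs.trans_le hr
      exact ((hK r hr).const_mul ε).add
        (((hasDerivAt_pow n r).fun_inv (pow_ne_zero n hr0.ne')).const_mul (4 * b))
    have hanti : AntitoneOn φ (Set.Ici s) := by
      refine antitoneOn_of_deriv_nonpos (convex_Ici s)
        (fun r hr => (hφ r hr).continuousAt.continuousWithinAt)
        (fun r hr => ((hφ r (interior_subset hr)).differentiableAt).differentiableWithinAt)
        fun r hr => ?_
      have hr' : s ≤ r := interior_subset hr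
      have hr0 : 0 < r := hs.trans_le hr'
      rw [(hφ r hr').deriv]
      have h1 := hKb r hr'
      have h2 : ε * -(4 * r ^ 3 * Tg gau r N (p + (1 * (s ^ 4 - r ^ 4)) • et)) ≤
          4 * b / r ^ (n + 1) := by
        refine (le_abs_self _).trans ?_
        rw [abs_mul, hε, one_mul, abs_neg]
        exact h1
      have h3 : 4 * b * (-(n * r ^ (n - 1)) / (r ^ n) ^ 2) = -(n * (4 * b / r ^ (n + 1))) := by
        obtain ⟨m, rfl⟩ : ∃ m, n = m + 1 := ⟨n - 1, by omega⟩
        simp only [Nat.add_sub_cancel]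
        field_simp
        ring
      have h4 : (1 : ℝ) ≤ n := by exact_mod_cast hn
      have h5 : 0 ≤ 4 * b / r ^ (n + 1) := by positivity
      rw [h3]
      nlinarith
    have hlim : Tendsto (fun r : ℝ => -(A / r ^ 2)) atTop (𝓝 0) := by
      have := (tendsto_const_nhds (x := A)).div_atTop (tendsto_pow_atTop (α := ℝ) (n := 2) (by norm_num))
      simpa using this.neg
    have hs' : φ s = ε * Tg gau s f p + 4 * b / s ^ n := by
      simp [φ, div_eq_mul_inv]
    rw [← hs']
    refine le_of_tendsto hlim ?_
    filter_upwards [eventually_ge_atTop s] with r hr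
    have hr0 : 0 < r := hs.trans_le hr
    refine le_trans ?_ (hanti (Set.self_mem_Ici) hr hr)
    have h1 := hA r hr0 (p + (1 * (s ^ 4 - r ^ 4)) • et)
    have h2 : -|Tg gau r f (p + (1 * (s ^ 4 - r ^ 4)) • et)| ≤
        ε * Tg gau r f (p + (1 * (s ^ 4 - r ^ 4)) • et) := by
      have := neg_abs_le (ε * Tg gau r f (p + (1 * (s ^ 4 - r ^ 4)) • et))
      rwa [abs_mul, hε, one_mul] at this
    have h3 : 0 ≤ 4 * b * (r ^ n)⁻¹ := by positivity
    simp only [φ]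
    linarith
  rw [abs_le]
  constructor
  · linarith [main 1 (by simp)]
  · linarith [main (-1) (by simp)]

lemma heat_diff {U : SpT → ℝ} (hU : SB U) {t₀ b : ℝ} {n : ℕ} (hn : n ≤ 3) (hb : 0 ≤ b)
    (hb' : ∀ s > 0, ∀ p : SpT, p.2 < t₀ → |Tg gau s (Lap U) p| ≤ b / s ^ n) {s : ℝ} (hs : 0 < s)
    {p : SpT} (hp : p.2 < t₀) : |U p - Tg gau s U p| ≤ 4 * b * s ^ (4 - n) := by
  have h1 : ∀ r ∈ Set.Icc 0 s, HasDerivWithinAt (fun r => Tg gau r U p)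
      (4 * r ^ 3 * Tg gau r (Lap U) p) (Set.Icc 0 s) r := by
    intro r _
    have := Tg_gau_hasDerivAt hU p 0 0 r
    simp only [zero_mul, zero_smul, add_zero, sub_zero] at this
    exact this.hasDerivWithinAt
  have h2 : ∀ r ∈ Set.Icc 0 s, ‖4 * r ^ 3 * Tg gau r (Lap U) p‖ ≤ 4 * b * s ^ (3 - n) := by
    intro r hr
    rcases hr.1.eq_or_lt with h0 | h0
    · rw [← h0]; simp; positivity
    rw [norm_mul, Real.norm_of_nonneg (by positivity), Real.norm_eq_abs]
    calc _ ≤ 4 * r ^ 3 * (b / r ^ n) := by gcongr; exact hb' r h0 p hp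
      _ = 4 * b * r ^ (3 - n) := by
        have : r ^ 3 = r ^ (3 - n) * r ^ n := by rw [← pow_add]; congr 1; omega
        rw [this]; field_simp
      _ ≤ _ := by gcongr; exact hr.2
  have h3 := (convex_Icc 0 s).norm_image_sub_le_of_norm_hasDerivWithin_le h1 h2
    (Set.right_mem_Icc.mpr hs.le) (Set.left_mem_Icc.mpr hs.le)
  have h4 : Tg gau 0 U p = U p := by
    simp [Tg, integral_mul_const, integral_gau]
  rw [h4, Real.norm_eq_abs, Real.norm_eq_abs] at h3
  refine h3.trans (le_of_eq ?_)
  rw [show 4 - n = (3 - n) + 1 by omega, pow_succ, zero_sub, abs_neg, abs_of_pos hs]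
  ring

/-- An unnormalized bump function on space-time, radial in space. -/
def bmp (q : SpT) : ℝ := Real.smoothTransition (1 - (‖q.1‖ ^ 2 + q.2 ^ 2))

lemma bmp_smooth : Smooth bmp := by
  refine Real.smoothTransition.contDiff.comp (contDiff_const.sub (ContDiff.add ?_ ?_))
  · exact (contDiff_norm_sq ℝ).comp contDiff_fst
  · exact contDiff_snd.pow 2

lemma bmp_support : Function.support bmp ⊆ Metric.closedBall 0 1 := by
  intro q hq
  rw [mem_closedBall_zero_iff]
  by_contra! h
  refine hq (Real.smoothTransition.zero_of_nonpos ?_)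
  rw [Prod.norm_def, lt_max_iff, Real.norm_eq_abs] at h
  rcases h with h | h
  · nlinarith [sq_nonneg q.2]
  · nlinarith [sq_nonneg ‖q.1‖, sq_abs q.2]

lemma bmp_nonneg (q : SpT) : 0 ≤ bmp q := Real.smoothTransition.nonneg _

lemma bmp_ker : Ker bmp :=
  ⟨bmp_smooth, HasCompactSupport.of_support_subset_isCompact (isCompact_closedBall 0 1) bmp_support⟩

lemma integral_bmp_pos : 0 < ∫ q, bmp q := by
  rw [bmp_smooth.continuous.integral_pos_of_hasCompactSupport_nonneg_nonzero bmp_ker.cpt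
    bmp_nonneg (x := 0) ?_ |> iff_true_intro]
  · trivial
  · simp [bmp, Real.smoothTransition.one_of_one_le]

/-- The radius of the support of the `n`-th mollifier. -/
def rad (n : ℕ) : ℝ := 1 / ((n : ℝ) + 1)

lemma rad_pos (n : ℕ) : 0 < rad n := Nat.one_div_pos_of_nat

lemma rad_tendsto : Tendsto rad atTop (𝓝 0) := tendsto_one_div_add_atTop_nhds_zero_nat

/-- A standard mollifying sequence. -/
def mol (n : ℕ) (q : SpT) : ℝ :=
  (((n : ℝ) + 1) ^ Module.finrank ℝ SpT * (∫ q, bmp q)⁻¹) * bmp (((n : ℝ) + 1) • q)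

lemma mol_nonneg (n : ℕ) (q : SpT) : 0 ≤ mol n q :=
  mul_nonneg (mul_nonneg (by positivity) (inv_nonneg.mpr integral_bmp_pos.le)) (bmp_nonneg _)

lemma integral_mol (n : ℕ) : ∫ q, mol n q = 1 := by
  unfold mol
  have h : (0 : ℝ) < (n : ℝ) + 1 := by positivity
  rw [integral_const_mul, Measure.integral_comp_smul, smul_eq_mul, abs_of_pos (by positivity)]
  have := integral_bmp_pos.ne'
  field_simp

lemma mol_support (n : ℕ) : Function.support (mol n) ⊆ Metric.closedBall 0 (rad n) := by
  intro q hq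
  have h : (0 : ℝ) < (n : ℝ) + 1 := by positivity
  have h2 := bmp_support (show ((n : ℝ) + 1) • q ∈ Function.support bmp from
    right_ne_zero_of_mul hq)
  rw [mem_closedBall_zero_iff, norm_smul, Real.norm_of_nonneg h.le] at h2
  rw [mem_closedBall_zero_iff, rad, le_div_iff₀ h, mul_comm]
  exact h2

lemma mol_tsupport (n : ℕ) : tsupport (mol n) ⊆ Metric.closedBall 0 (rad n) :=
  closure_minimal (mol_support n) Metric.isClosed_closedBall

lemma mol_ker (n : ℕ) : Ker (mol n) :=
  ⟨contDiff_const.mul (bmp_smooth.comp (contDiff_const_smul _)),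
    HasCompactSupport.of_support_subset_isCompact (isCompact_closedBall 0 _) (mol_support n)⟩

lemma mol_isometry (n : ℕ) {q q' : SpT} (h1 : ‖q.1‖ = ‖q'.1‖) (h2 : q.2 = q'.2) :
    mol n q = mol n q' := by
  unfold mol bmp
  simp only [Prod.smul_fst, Prod.smul_snd, norm_smul, h1, h2]

lemma integral_abs_mol (n : ℕ) : ∫ q, |mol n q| = 1 := by
  simp_rw [abs_of_nonneg (mol_nonneg n _)]
  exact integral_mol n

lemma J_mol_abs_le {f : SpT → ℝ} {C : ℝ} (hf : ∀ᵐ p, |f p| ≤ C) (n : ℕ) (p : SpT) :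
    |J (mol n) f p| ≤ C := by
  simpa [integral_abs_mol] using J_abs_le (mol_ker n).integrable hf p

lemma J_mol_tendsto {f : SpT → ℝ} (hf : BM f) :
    ∀ᵐ p, Tendsto (fun n => J (mol n) f p) atTop (𝓝 (f p)) := by
  filter_upwards [IsUnifLocDoublingMeasure.ae_tendsto_average_norm_sub (μ := (volume : Measure SpT))
    hf.locallyIntegrable 1] with p hp
  have hr : Tendsto rad atTop (𝓝[>] 0) :=
    tendsto_nhdsWithin_iff.2 ⟨rad_tendsto, Eventually.of_forall rad_pos⟩
  have h0 := hp (fun _ => p) rad hr (Eventually.of_forall fun n => by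
    simpa using (rad_pos n).le)
  have key := tendsto_integral_smul_of_tendsto_average_norm_sub
    (g := fun n y => mol n (p - y))
    ((volume : Measure SpT).real (Metric.ball 0 1) * (∫ q, bmp q)⁻¹) h0
    (Eventually.of_forall fun n => hf.locallyIntegrable.integrableOn_isCompact
      (isCompact_closedBall _ _))
    (tendsto_const_nhds.congr fun n => by
      rw [integral_sub_left_eq_self (mol n) volume p, integral_mol])
    (Eventually.of_forall fun n y hy => by
      have := mol_support n hy
      rw [mem_closedBall_zero_iff] at this
      rwa [Metric.mem_closedBall, dist_comm, dist_eq_norm])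
    (Eventually.of_forall fun n y => by
      rw [abs_of_nonneg (mol_nonneg _ _), Measure.addHaar_real_closedBall _ _ (rad_pos n).le]
      have h1 : bmp (((n : ℝ) + 1) • (p - y)) ≤ 1 := Real.smoothTransition.le_one _
      have h2 : 0 < (volume : Measure SpT).real (Metric.ball 0 1) :=
        ENNReal.toReal_pos (Metric.measure_ball_pos _ _ one_pos).ne' measure_ball_lt_top.ne
      have h3 : 0 < (∫ q, bmp q)⁻¹ := inv_pos.mpr integral_bmp_pos
      unfold mol rad
      calc _ ≤ (((n : ℝ) + 1) ^ Module.finrank ℝ SpT * (∫ q, bmp q)⁻¹) * 1 := by gcongr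
        _ = _ := by
          rw [div_pow, one_pow]; field_simp)
  refine key.congr fun n => ?_
  rw [J_eq]
  rfl

/-- The kernel `k` only looks at times before `0` from the point `p`. -/
def Adm (k : SpT → ℝ) (p : SpT) : Prop := ∀ q ∈ tsupport k, p.2 < q.2

lemma Adm.dd {k : SpT → ℝ} {p : SpT} (h : Adm k p) (v : SpT) : Adm (dd v k) p :=
  fun q hq => h q (tsupport_dd_subset v k hq)

lemma adm_mol {n : ℕ} {p : SpT} (hp : p.2 < -rad n) : Adm (mol n) p := by
  intro q hq
  have h := mol_tsupport n hq
  rw [mem_closedBall_zero_iff] at h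
  have := (abs_le.mp ((norm_snd_le q).trans h)).1
  linarith

/-- Localized, differentiated form of the Stokes system with forcing `div F`. -/
structure Sol (u : Fin 3 → SpT → ℝ) (F : Fin 3 → Fin 3 → SpT → ℝ) : Prop where
  umeas : ∀ i, BM (u i)
  Fmeas : ∀ i j, BM (F i j)
  zero : ∀ i p, 0 ≤ p.2 → u i p = 0
  div : ∀ k, Ker k → ∀ p, Adm k p → ∑ i, J (dd (ex i) k) (u i) p = 0
  eq : ∀ k, Ker k → ∀ p, Adm k p → ∀ i j,
    (J (dd et (dd (ex i) k)) (u j) p - J (dd et (dd (ex j) k)) (u i) p)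
      - ∑ m, (J (dd (ex m) (dd (ex m) (dd (ex i) k))) (u j) p
          - J (dd (ex m) (dd (ex m) (dd (ex j) k))) (u i) p)
    = ∑ l, (J (dd (ex j) (dd (ex l) k)) (F i l) p - J (dd (ex i) (dd (ex l) k)) (F j l) p)

/-- The forcing term in the heat equation for the Laplacian of the velocity. -/
def NF (k : SpT → ℝ) (F : Fin 3 → Fin 3 → SpT → ℝ) (j : Fin 3) (p : SpT) : ℝ :=
  ∑ i, ∑ l, (ddx [j, i, l] (J k (F i l)) p + -1 * ddx [i, i, l] (J k (F j l)) p)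

lemma ddx_J {k f : SpT → ℝ} (hk : Ker k) (hf : BM f) (l : List (Fin 3)) :
    ddx l (J k f) = J (ddx l k) f := by
  have hl : ∀ l, Ker (ddx l k) := by
    intro l
    induction l with
    | nil => exact hk
    | cons i l ih => exact ih.dd _
  induction l with
  | nil => rfl
  | cons i l ih =>
    show dd (ex i) (ddx l (J k f)) = _
    rw [ih, dd_J (hl l) hf]
    rfl

lemma Sol.heat {u : Fin 3 → SpT → ℝ} {F : Fin 3 → Fin 3 → SpT → ℝ} (h : Sol u F) {k : SpT → ℝ}
    (hk : Ker k) {p : SpT} (hp : Adm k p) (j : Fin 3) :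
    dd et (Lap (J k (u j))) p = Lap (Lap (J k (u j))) p + NF k F j p := by
  have hu := h.umeas
  have c := fun v w => dd_comm hk.smooth v w
  have c2 := fun x v w => dd_comm (hk.dd x).smooth v w
  have c3 := fun x y v w => dd_comm ((hk.dd y).dd x).smooth v w
  have e1 : Lap (J k (u j)) = fun p => ∑ i, J (dd (ex i) (dd (ex i) k)) (u j) p := by
    funext q
    unfold Lap
    simp_rw [fun i => dd_J hk (hu j) (ex i), fun i => dd_J (hk.dd (ex i)) (hu j) (ex i)]
  have hs := fun i => J_smooth ((hk.dd (ex i)).dd (ex i)) (hu j)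
  have e2 : dd et (Lap (J k (u j))) p = ∑ i, J (dd et (dd (ex i) (dd (ex i) k))) (u j) p := by
    rw [e1, dd_sum _ fun i => (hs i).differentiable]
    simp_rw [fun i => dd_J ((hk.dd (ex i)).dd (ex i)) (hu j) et]
  have e3 : Lap (Lap (J k (u j))) p =
      ∑ i, ∑ m, J (dd (ex m) (dd (ex m) (dd (ex i) (dd (ex i) k)))) (u j) p := by
    rw [e1]
    unfold Lap
    rw [Finset.sum_comm]
    refine Finset.sum_congr rfl fun m _ => ?_
    rw [dd_sum _ fun i => (hs i).differentiable]
    simp_rw [fun i => dd_J ((hk.dd (ex i)).dd (ex i)) (hu j) (ex m)]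
    rw [dd_sum _ fun i => (J_smooth (((hk.dd (ex i)).dd (ex i)).dd (ex m)) (hu j)).differentiable]
    simp_rw [fun i => dd_J (((hk.dd (ex i)).dd (ex i)).dd (ex m)) (hu j) (ex m)]
  have e4 : NF k F j p = ∑ i, ∑ l, (J (dd (ex j) (dd (ex l) (dd (ex i) k))) (F i l) p
      - J (dd (ex i) (dd (ex l) (dd (ex i) k))) (F j l) p) := by
    unfold NF
    refine Finset.sum_congr rfl fun i _ => Finset.sum_congr rfl fun l _ => ?_
    rw [ddx_J hk (h.Fmeas _ _), ddx_J hk (h.Fmeas _ _)]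
    simp only [ddx, List.foldr_cons, List.foldr_nil]
    rw [c (ex i) (ex l)]
    ring
  have key := Finset.sum_congr (rfl : (Finset.univ : Finset (Fin 3)) = Finset.univ)
    fun i _ => h.eq (dd (ex i) k) (hk.dd _) p (hp.dd _) i j
  have d1 := h.div (dd et (dd (ex j) k)) ((hk.dd _).dd _) p ((hp.dd _).dd _)
  have d2 := fun m => h.div (dd (ex m) (dd (ex m) (dd (ex j) k))) (((hk.dd _).dd _).dd _) p
    (((hp.dd _).dd _).dd _)
  have d1' : ∑ i, J (dd et (dd (ex j) (dd (ex i) k))) (u i) p = 0 := by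
    rw [← d1]
    refine Finset.sum_congr rfl fun i _ => ?_
    rw [c2 _ (ex i) et, c (ex i) (ex j)]
  have d2' : ∑ i, ∑ m, J (dd (ex m) (dd (ex m) (dd (ex j) (dd (ex i) k)))) (u i) p = 0 := by
    rw [Finset.sum_comm, ← Finset.sum_eq_zero (fun m _ => d2 m)]
    refine Finset.sum_congr rfl fun m _ => Finset.sum_congr rfl fun i _ => ?_
    rw [c3 _ _ (ex i) (ex m), c2 _ (ex i) (ex m), c (ex i) (ex j)]
  simp only [Finset.sum_sub_distrib] at key d1' d2' e4
  rw [e2, e3, e4, ← key, d1', d2']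
  ring

lemma NF_SB {k : SpT → ℝ} (hk : Ker k) {F : Fin 3 → Fin 3 → SpT → ℝ} (hF : ∀ i j, BM (F i j))
    (j : Fin 3) : SB (NF k F j) :=
  SB.sum _ fun _ => SB.sum _ fun _ => ((SB_J hk (hF _ _)).ddx _).add
    (((SB_J hk (hF _ _)).ddx _).const_mul (-1))

lemma ddx_add {f g : SpT → ℝ} (hf : SB f) (hg : SB g) (l : List (Fin 3)) :
    ddx l (fun p => f p + g p) = fun p => ddx l f p + ddx l g p := by
  induction l with
  | nil => rfl
  | cons i l ih =>
    show dd (ex i) (ddx l _) = _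
    rw [ih, dd_add (hf.ddx l).smooth.differentiable (hg.ddx l).smooth.differentiable]
    rfl

lemma ddx_const_mul {f : SpT → ℝ} (hf : SB f) (c : ℝ) (l : List (Fin 3)) :
    ddx l (fun p => c * f p) = fun p => c * ddx l f p := by
  induction l with
  | nil => rfl
  | cons i l ih =>
    show dd (ex i) (ddx l _) = _
    rw [ih, dd_const_mul (hf.ddx l).smooth.differentiable]
    rfl

lemma ddx_sum {ι : Type*} (s : Finset ι) {f : ι → SpT → ℝ} (hf : ∀ i, SB (f i))
    (l : List (Fin 3)) :
    ddx l (fun p => ∑ i ∈ s, f i p) = fun p => ∑ i ∈ s, ddx l (f i) p := by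
  induction l with
  | nil => rfl
  | cons i l ih =>
    show dd (ex i) (ddx l _) = _
    rw [ih, dd_sum _ fun i => ((hf i).ddx l).smooth.differentiable]
    rfl

lemma ddx_append (l l' : List (Fin 3)) (f : SpT → ℝ) : ddx (l ++ l') f = ddx l (ddx l' f) := by
  simp [ddx]

/-- Gaussian averages of derivatives of the forcing. -/
lemma Tg_ddx_NF_le {k : SpT → ℝ} (hk : Ker k) {F : Fin 3 → Fin 3 → SpT → ℝ}
    (hF : ∀ i j, BM (F i j)) (l : List (Fin 3)) {s D : ℝ} {p : SpT}
    (hD : ∀ i j a b c, |Tg gau s (ddx (l ++ [a, b, c]) (J k (F i j))) p| ≤ D) (j : Fin 3) :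
    |Tg gau s (ddx l (NF k F j)) p| ≤ 18 * D := by
  have hJ := fun i j => SB_J hk (hF i j)
  have hs : ∀ i m, SB (fun p => ddx [j, i, m] (J k (F i m)) p
      + -1 * ddx [i, i, m] (J k (F j m)) p) := fun i m =>
    ((hJ i m).ddx _).add (((hJ j m).ddx _).const_mul (-1))
  have e : Tg gau s (ddx l (NF k F j)) p = ∑ i, ∑ m,
      (Tg gau s (ddx (l ++ [j, i, m]) (J k (F i m))) p
        + -1 * Tg gau s (ddx (l ++ [i, i, m]) (J k (F j m))) p) := by
    unfold NF
    rw [ddx_sum _ fun i => SB.sum _ fun m => hs i m,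
      Tg_sum _ gau_GS.integrable fun i => (SB.sum _ fun m => hs i m).ddx l]
    refine Finset.sum_congr rfl fun i _ => ?_
    rw [ddx_sum _ fun m => hs i m, Tg_sum _ gau_GS.integrable fun m => (hs i m).ddx l]
    refine Finset.sum_congr rfl fun m _ => ?_
    rw [ddx_add ((hJ i m).ddx _) (((hJ j m).ddx _).const_mul (-1)),
      ddx_const_mul ((hJ j m).ddx _),
      Tg_add gau_GS.integrable (((hJ i m).ddx _).ddx _) ((((hJ j m).ddx _).ddx _).const_mul (-1)),
      Tg_const_mul, ddx_append, ddx_append]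
  rw [e]
  have hb : ∀ i m, |Tg gau s (ddx (l ++ [j, i, m]) (J k (F i m))) p
        + -1 * Tg gau s (ddx (l ++ [i, i, m]) (J k (F j m))) p| ≤ 2 * D := by
    intro i m
    refine (abs_add_le _ _).trans ?_
    rw [abs_mul, abs_neg, abs_one, one_mul, two_mul]
    exact add_le_add (hD _ _ _ _ _) (hD _ _ _ _ _)
  calc _ ≤ ∑ i : Fin 3, ∑ m : Fin 3, 2 * D :=
        (Finset.abs_sum_le_sum_abs _ _).trans (Finset.sum_le_sum fun i _ =>
          (Finset.abs_sum_le_sum_abs _ _).trans (Finset.sum_le_sum fun m _ => hb i m))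
    _ = 18 * D := by simp; ring

lemma dd_space {f : SpT → ℝ} (h : Euc 3) :
    dd ((h, 0) : SpT) f = fun p => ∑ i, h i * dd (ex i) f p := by
  funext p
  have hy : ((h, 0) : SpT) = ∑ i, h i • ex i := by
    refine Prod.ext ?_ ?_
    · rw [Prod.fst_sum]
      simp only [ex, Prod.smul_mk]
      ext j
      simp [Finset.sum_apply, Pi.single_apply]
    · simp [ex, Prod.snd_sum]
  unfold dd
  conv_lhs => rw [hy]
  simp

/-- Spatial difference. -/
def Dh (h : Euc 3) (f : SpT → ℝ) (p : SpT) : ℝ := f (p + ((h, 0) : SpT)) - f p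

lemma abs_Dh_le_of_dd {f : SpT → ℝ} (hf : Differentiable ℝ f) {C : ℝ} {p : SpT}
    (hC : ∀ i, ∀ y : Euc 3, |dd (ex i) f (p + ((y, 0) : SpT))| ≤ C) (h : Euc 3) :
    |Dh h f p| ≤ 3 * C * ‖h‖ := by
  have hC0 : 0 ≤ C := (abs_nonneg _).trans (hC 0 0)
  have h1 : ∀ r ∈ Set.Icc (0 : ℝ) 1, HasDerivWithinAt (fun r : ℝ => f (p + r • ((h, 0) : SpT)))
      (dd ((h, 0) : SpT) f (p + r • ((h, 0) : SpT))) (Set.Icc 0 1) r := by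
    intro r _
    have hc : HasDerivAt (fun r : ℝ => p + r • ((h, 0) : SpT)) ((h, 0) : SpT) r := by
      simpa using ((hasDerivAt_id r).smul_const ((h, 0) : SpT)).const_add p
    exact ((hf _).hasFDerivAt.comp_hasDerivAt r hc).hasDerivWithinAt
  have h2 : ∀ r ∈ Set.Icc (0 : ℝ) 1, ‖dd ((h, 0) : SpT) f (p + r • ((h, 0) : SpT))‖ ≤
      3 * C * ‖h‖ := by
    intro r _
    rw [dd_space, Real.norm_eq_abs]
    calc _ ≤ ∑ i : Fin 3, ‖h‖ * C := by
          refine (Finset.abs_sum_le_sum_abs _ _).trans (Finset.sum_le_sum fun i _ => ?_)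
          rw [abs_mul]
          have := hC i (r • h)
          exact mul_le_mul (PiLp.norm_apply_le h i) (by simpa using this) (abs_nonneg _)
            (norm_nonneg _)
      _ = _ := by simp; ring
  have h3 := (convex_Icc (0 : ℝ) 1).norm_image_sub_le_of_norm_hasDerivWithin_le h1 h2
    (Set.left_mem_Icc.mpr zero_le_one) (Set.right_mem_Icc.mpr zero_le_one)
  simpa [Dh] using h3

lemma abs_Dh_Tg_le {f : SpT → ℝ} (hf : SB f) {A s : ℝ} (hs : 0 < s) (hA : ∀ p, |f p| ≤ A)
    (h : Euc 3) (p : SpT) : |Dh h (Tg gau s f) p| ≤ 3 * (gM * A / s ^ 2) * ‖h‖ := by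
  have h1 : ∀ r ∈ Set.Icc (0 : ℝ) 1,
      HasDerivWithinAt (fun r : ℝ => Tg gau s f (p + r • ((h, 0) : SpT)))
      (∑ i, h i * Tg gau s (dd (ex i) f) (p + r • ((h, 0) : SpT))) (Set.Icc 0 1) r := by
    intro r _
    have hc : HasDerivAt (fun r : ℝ => p + r • ((h, 0) : SpT)) ((h, 0) : SpT) r := by
      simpa using ((hasDerivAt_id r).smul_const ((h, 0) : SpT)).const_add p
    have h1 := Tg_hasDerivAt gau_GS hf (hasDerivAt_const r s) hc
    refine (h1.congr_deriv ?_).hasDerivWithinAt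
    rw [dd_space, Tg_sum _ gau_GS.integrable fun i => (hf.dd (ex i)).const_mul (h i)]
    simp_rw [Tg_const_mul]
    ring
  have h2 : ∀ r ∈ Set.Icc (0 : ℝ) 1, ‖∑ i, h i * Tg gau s (dd (ex i) f)
      (p + r • ((h, 0) : SpT))‖ ≤ 3 * (gM * A / s ^ 2) * ‖h‖ := by
    intro r _
    rw [Real.norm_eq_abs]
    calc _ ≤ ∑ i : Fin 3, ‖h‖ * (gM * A / s ^ 2) := by
          refine (Finset.abs_sum_le_sum_abs _ _).trans (Finset.sum_le_sum fun i _ => ?_)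
          rw [abs_mul]
          have := Tg_gau_ddx_le (l := [i]) (by simp) hf hs (p := p + r • ((h, 0) : SpT))
            (fun y => hA _)
          exact mul_le_mul (PiLp.norm_apply_le h i) this (abs_nonneg _) (norm_nonneg _)
      _ = _ := by simp; ring
  have h3 := (convex_Icc (0 : ℝ) 1).norm_image_sub_le_of_norm_hasDerivWithin_le h1 h2
    (Set.left_mem_Icc.mpr zero_le_one) (Set.right_mem_Icc.mpr zero_le_one)
  simpa [Dh] using h3

lemma exists_Tg_Lap_le {f : SpT → ℝ} (hf : SB f) :
    ∃ A, ∀ s > 0, ∀ p : SpT, |Tg gau s (Lap f) p| ≤ A / s ^ 2 := by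
  choose C hC using fun i => (hf.dd (ex i)).BM.bdd
  refine ⟨∑ i, gM * C i, fun s hs p => ?_⟩
  unfold Lap
  rw [Tg_sum _ gau_GS.integrable fun i => (hf.dd (ex i)).dd (ex i), Finset.sum_div]
  exact (Finset.abs_sum_le_sum_abs _ _).trans (Finset.sum_le_sum fun i _ =>
    Tg_gau_ddx_le (l := [i]) (by simp) (hf.dd (ex i)) hs (fun y => hC i _))

lemma Sol.kernel_holder {u : Fin 3 → SpT → ℝ} {F : Fin 3 → Fin 3 → SpT → ℝ} (h : Sol u F)
    {k : SpT → ℝ} (hk : Ker k) (hk1 : (∫ q, |k q|) ≤ 1) {t₀ A B : ℝ} (hA0 : 0 ≤ A) (hB0 : 0 ≤ B)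
    (hadm : ∀ p : SpT, p.2 < t₀ → Adm k p) (hA : ∀ i, ∀ᵐ p, |u i p| ≤ A)
    (hB : ∀ i j, ∀ᵐ p, |F i j p| ≤ B) (j : Fin 3) {s : ℝ} (hs : 0 < s) {p : SpT} (hp : p.2 < t₀)
    (y : Euc 3) :
    |J k (u j) p - Tg gau s (J k (u j)) p| ≤ 288 * gM * B * s ^ 2 ∧
    |Dh y (J k (u j)) p| ≤ 576 * gM * B * s ^ 2 + 3 * (gM * A / s ^ 2) * ‖y‖ := by
  have hU := SB_J hk (h.umeas j)
  have hUA : ∀ p, |J k (u j) p| ≤ A := fun p =>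
    (J_abs_le hk.integrable (hA j) p).trans (mul_le_of_le_one_left hA0 hk1)
  have hFB : ∀ i j p, |J k (F i j) p| ≤ B := fun i j p =>
    (J_abs_le hk.integrable (hB i j) p).trans (mul_le_of_le_one_left hB0 hk1)
  have hg := one_le_gM
  obtain ⟨A', hA'⟩ := exists_Tg_Lap_le hU
  have hdec : ∀ s > 0, ∀ p : SpT, p.2 < t₀ →
      |Tg gau s (Lap (J k (u j))) p| ≤ 72 * gM * B / s ^ 2 := by
    intro s hs p hp
    have := heat_decay (n := 2) (b := 18 * gM * B) hU.Lap (NF_SB hk h.Fmeas j) (by norm_num)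
      (by positivity) (fun p hp => h.heat hk (hadm p hp) j)
      (fun s hs p _ => by
        have := Tg_ddx_NF_le hk h.Fmeas [] (s := s) (p := p) (D := gM * B / s ^ 6)
          (fun i j a b c => Tg_gau_ddx_le (l := [a, b, c]) (by simp) (SB_J hk (h.Fmeas i j)) hs
            fun y => hFB _ _ _) j
        refine this.trans (le_of_eq ?_)
        ring) hA' hs hp
    refine this.trans (le_of_eq ?_)
    ring
  have hdiff : ∀ p : SpT, p.2 < t₀ →
      |J k (u j) p - Tg gau s (J k (u j)) p| ≤ 288 * gM * B * s ^ 2 := by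
    intro p hp
    refine (heat_diff hU (n := 2) (by norm_num) (by positivity) hdec hs hp).trans (le_of_eq ?_)
    ring
  refine ⟨hdiff p hp, ?_⟩
  have h1 := hdiff p hp
  have h2 := hdiff (p + ((y, 0) : SpT)) (by simpa using hp)
  have h3 := abs_Dh_Tg_le hU hs hUA y p
  unfold Dh at h3 ⊢
  rw [abs_le] at *
  constructor <;> linarith [h1.1, h1.2, h2.1, h2.2, h3.1, h3.2]

lemma ae_shift {P : SpT → Prop} (hP : ∀ᵐ p, P p) (v : SpT) : ∀ᵐ p, P (p + v) :=
  (quasiMeasurePreserving_add_right volume v).ae hP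

lemma Sol.ae_Dh_le {u : Fin 3 → SpT → ℝ} {F : Fin 3 → Fin 3 → SpT → ℝ} (h : Sol u F) (j : Fin 3)
    (y : Euc 3) {C : ℝ} (hC0 : 0 ≤ C)
    (hC : ∀ n, ∀ p : SpT, p.2 < -rad n → |Dh y (J (mol n) (u j)) p| ≤ C) :
    ∀ᵐ p, |Dh y (u j) p| ≤ C := by
  have h1 := J_mol_tendsto (h.umeas j)
  filter_upwards [h1, ae_shift h1 ((y, 0) : SpT)] with p hp1 hp2
  rcases lt_or_ge p.2 0 with hp | hp
  · refine le_of_tendsto (hp2.sub hp1).abs ?_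
    have : ∀ᶠ n in atTop, rad n < -p.2 := rad_tendsto.eventually_lt_const (by linarith)
    filter_upwards [this] with n hn
    exact hC n p (by linarith)
  · unfold Dh
    rw [h.zero j p hp, h.zero j _ (by simpa using hp)]
    simpa using hC0

lemma Sol.holder {u : Fin 3 → SpT → ℝ} {F : Fin 3 → Fin 3 → SpT → ℝ} (h : Sol u F)
    {C : ℝ} (hC0 : 0 ≤ C) (hA : ∀ i, ∀ᵐ p, |u i p| ≤ C)
    (hB : ∀ i j, ∀ᵐ p, |F i j p| ≤ C) (j : Fin 3) (y : Euc 3) :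
    ∀ᵐ p, |Dh y (u j) p| ≤ 600 * gM * C * √‖y‖ := by
  have hg := one_le_gM
  rcases eq_or_ne y 0 with rfl | hy
  · exact Eventually.of_forall fun p => by
      have e : (((0 : Euc 3), (0 : ℝ)) : SpT) = 0 := rfl
      simp [Dh, e]
  have hy0 : 0 < ‖y‖ := norm_pos_iff.mpr hy
  refine h.ae_Dh_le j y (by positivity) fun n p hp => ?_
  have hs : 0 < √√‖y‖ := Real.sqrt_pos.mpr (Real.sqrt_pos.mpr hy0)
  have := (h.kernel_holder (mol_ker n) (integral_abs_mol n).le hC0 hC0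
    (fun p hp => adm_mol hp) hA hB j hs hp y).2
  rw [Real.sq_sqrt (Real.sqrt_nonneg _)] at this
  refine this.trans ?_
  have e : ‖y‖ = √‖y‖ * √‖y‖ := (Real.mul_self_sqrt hy0.le).symm
  have h1 : 3 * (gM * C / √‖y‖) * ‖y‖ = 3 * gM * C * √‖y‖ := by
    have : 0 < √‖y‖ := Real.sqrt_pos.mpr hy0
    nth_rewrite 2 [e]
    field_simp
  rw [h1]
  have : 0 ≤ gM * C * √‖y‖ := by positivity
  nlinarith

lemma dd_Lap {f : SpT → ℝ} (hf : SB f) (v : SpT) : dd v (Lap f) = Lap (dd v f) := by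
  have h : Lap f = fun p => ∑ i, dd (ex i) (dd (ex i) f) p := rfl
  rw [h, dd_sum _ fun i => ((hf.dd _).dd _).smooth.differentiable]
  funext p
  refine Finset.sum_congr rfl fun i _ => ?_
  rw [dd_comm (hf.dd _).smooth, dd_comm hf.smooth]

/-- If two smooth functions agree on a time half-space, so do their derivatives. -/
lemma dd_congr_half {f g : SpT → ℝ} {t₀ : ℝ} (h : ∀ p : SpT, p.2 < t₀ → f p = g p) (v : SpT)
    {p : SpT} (hp : p.2 < t₀) : dd v f p = dd v g p := by
  have : f =ᶠ[𝓝 p] g := by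
    filter_upwards [(isOpen_lt continuous_snd continuous_const).mem_nhds hp] with q hq using h q hq
  unfold dd
  rw [this.fderiv_eq]

lemma Sol.kernel_lipschitz {u : Fin 3 → SpT → ℝ} {F : Fin 3 → Fin 3 → SpT → ℝ} (h : Sol u F)
    {k : SpT → ℝ} (hk : Ker k) (hk1 : (∫ q, |k q|) = 1) {t₀ A B : ℝ}
    (hA0 : 0 ≤ A) (hB0 : 0 ≤ B)
    (hadm : ∀ p : SpT, p.2 < t₀ → Adm k p) (hA : ∀ i, ∀ᵐ p, |u i p| ≤ A)
    (hB : ∀ i j, ∀ y, ∀ᵐ p, |Dh y (F i j) p| ≤ B * √‖y‖) (e j : Fin 3) {p : SpT} (hp : p.2 < t₀) :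
    |dd (ex e) (J k (u j)) p| ≤ 288 * gM * B + gM * A := by
  have hU := SB_J hk (h.umeas j)
  have hUA : ∀ p, |J k (u j) p| ≤ A := fun p =>
    (J_abs_le hk.integrable (hA j) p).trans (mul_le_of_le_one_left hA0 hk1.le)
  have hFB : ∀ i j p y, |Dh y (J k (F i j)) p| ≤ B * √‖y‖ := by
    intro i j p y
    have h1 := J_abs_le hk.integrable (hB i j y) p
    have h2 : J k (Dh y (F i j)) p = Dh y (J k (F i j)) p := by
      have := congrFun (J_sub hk.integrable ((h.Fmeas i j).comp_add ((y, 0) : SpT))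
        (h.Fmeas i j)) p
      rw [J_shift] at this
      exact this
    rwa [h2, hk1, one_mul] at h1
  have hg := one_le_gM
  obtain ⟨A', hA'⟩ := exists_Tg_Lap_le (hU.dd (ex e))
  have hdec : ∀ s > 0, ∀ p : SpT, p.2 < t₀ →
      |Tg gau s (Lap (dd (ex e) (J k (u j)))) p| ≤ 72 * gM * B / s ^ 3 := by
    intro s hs p hp
    have := heat_decay (n := 3) (b := 18 * gM * B) (hU.dd (ex e)).Lap
      ((NF_SB hk h.Fmeas j).dd (ex e)) (t₀ := t₀) (by norm_num)
      (by positivity) (fun p hp => by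
        have h1 := dd_congr_half (fun p hp => h.heat hk (hadm p hp) j) (ex e) hp
        rw [dd_add hU.Lap.Lap.smooth.differentiable (NF_SB hk h.Fmeas j).smooth.differentiable,
          dd_comm hU.Lap.smooth, dd_Lap hU.Lap, dd_Lap hU] at h1
        exact h1)
      (fun s hs p _ => by
        have := Tg_ddx_NF_le hk h.Fmeas [e] (s := s) (p := p) (D := gM * B * s / s ^ 8)
          (fun i j a b c => Tg_gau_ddx_le_holder (l := [e, a, b, c]) (by simp) (by simp)
            (SB_J hk (h.Fmeas i j)) hs hB0 fun y => hFB _ _ _ _) j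
        refine this.trans (le_of_eq ?_)
        field_simp) hA' hs hp
    refine this.trans (le_of_eq ?_)
    ring
  have h1 := heat_diff (hU.dd (ex e)) (n := 3) (by norm_num) (by positivity) hdec one_pos hp
  have h2 := Tg_gau_ddx_le (l := [e]) (by simp) hU one_pos (p := p) (fun y => hUA _)
  simp only [ddx, List.foldr_cons, List.foldr_nil, one_pow, div_one, mul_one] at h1 h2
  rw [abs_le] at *
  constructor <;> linarith [h1.1, h1.2, h2.1, h2.2]

lemma Sol.lipschitz {u : Fin 3 → SpT → ℝ} {F : Fin 3 → Fin 3 → SpT → ℝ} (h : Sol u F)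
    {A B : ℝ} (hA0 : 0 ≤ A) (hB0 : 0 ≤ B) (hA : ∀ i, ∀ᵐ p, |u i p| ≤ A)
    (hB : ∀ i j, ∀ y, ∀ᵐ p, |Dh y (F i j) p| ≤ B * √‖y‖) (j : Fin 3) (y : Euc 3) :
    ∀ᵐ p, |Dh y (u j) p| ≤ 3 * (288 * gM * B + gM * A) * ‖y‖ := by
  have hg := one_le_gM
  refine h.ae_Dh_le j y (by positivity) fun n p hp => ?_
  refine abs_Dh_le_of_dd (J_smooth (mol_ker n) (h.umeas j)).differentiable (fun i z => ?_) y
  exact h.kernel_lipschitz (mol_ker n) (integral_abs_mol n) hA0 hB0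
    (fun p hp => adm_mol hp) hA hB i j (by simpa using hp)

lemma BM.Dh {f : SpT → ℝ} (hf : BM f) (c : ℝ) (h : Euc 3) : BM (fun p => c * Dh h f p) :=
  ((hf.comp_add _).sub hf).const_mul c

lemma J_Dh {k f : SpT → ℝ} (hk : Ker k) (hf : BM f) (c : ℝ) (h : Euc 3) (p : SpT) :
    J k (fun p => c * Dh h f p) p = c * (J k f (p + ((h, 0) : SpT)) - J k f p) := by
  rw [J_const_mul]
  have := congrFun (J_sub hk.integrable (hf.comp_add ((h, 0) : SpT)) hf) p
  rw [J_shift] at this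
  rw [← this]
  rfl

lemma Sol.difference {u : Fin 3 → SpT → ℝ} {F : Fin 3 → Fin 3 → SpT → ℝ} (H : Sol u F) (c : ℝ)
    (h : Euc 3) : Sol (fun i p => c * Dh h (u i) p) (fun i j p => c * Dh h (F i j) p) := by
  have ha : ∀ {k : SpT → ℝ} {p : SpT}, Adm k p → Adm k (p + ((h, 0) : SpT)) := by
    intro k p hp q hq
    simpa using hp q hq
  refine ⟨fun i => (H.umeas i).Dh c h, fun i j => (H.Fmeas i j).Dh c h, fun i p hp => ?_,
    fun k hk p hp => ?_, fun k hk p hp i j => ?_⟩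
  · unfold Dh
    rw [H.zero i p hp, H.zero i _ (by simpa using hp)]
    simp
  · simp_rw [fun i => J_Dh (hk.dd (ex i)) (H.umeas i) c h p]
    rw [← Finset.mul_sum, Finset.sum_sub_distrib, H.div k hk p hp, H.div k hk _ (ha hp)]
    simp
  · have e1 := H.eq k hk p hp i j
    have e2 := H.eq k hk _ (ha hp) i j
    simp_rw [fun v w i => J_Dh ((hk.dd v).dd w) (H.umeas i) c h p,
      fun v w x i => J_Dh (((hk.dd v).dd w).dd x) (H.umeas i) c h p,
      fun v w i j => J_Dh ((hk.dd v).dd w) (H.Fmeas i j) c h p]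
    simp only [Fin.sum_univ_three] at e1 e2 ⊢
    linear_combination c * e2 - c * e1

/-- Boundedness together with a modulus of continuity in space. -/
def HasMod (ω : ℝ → ℝ) (C : ℝ) (f : SpT → ℝ) : Prop :=
  (∀ᵐ p, |f p| ≤ C) ∧ ∀ y, ∀ᵐ p, |Dh y f p| ≤ C * ω ‖y‖

/-- Uniform bounds on iterated spatial difference quotients. -/
def Reg (ω : ℝ → ℝ) (C : ℝ) : ℕ → (SpT → ℝ) → Prop
  | 0, f => HasMod ω C f
  | m + 1, f => HasMod ω C f ∧ ∀ h : Euc 3, h ≠ 0 → Reg ω C m (fun p => ‖h‖⁻¹ * Dh h f p)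

lemma Reg.mod {ω : ℝ → ℝ} {C : ℝ} {m : ℕ} {f : SpT → ℝ} (h : Reg ω C m f) : HasMod ω C f := by
  cases m with
  | zero => exact h
  | succ m => exact h.1

lemma Reg.imp {ω ω' : ℝ → ℝ} {C D : ℝ} (hP : ∀ f, HasMod ω C f → HasMod ω' D f) {m : ℕ} {f : SpT → ℝ}
    (h : Reg ω C m f) : Reg ω' D m f := by
  induction m generalizing f with
  | zero => exact hP _ h
  | succ m ih => exact ⟨hP _ h.1, fun y hy => ih (h.2 y hy)⟩

lemma Reg.mono {ω : ℝ → ℝ} {C D : ℝ} (hω : ∀ r, 0 ≤ ω r) (hCD : C ≤ D) {m : ℕ} {f : SpT → ℝ}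
    (h : Reg ω C m f) : Reg ω D m f := by
  refine h.imp fun f hf => ⟨hf.1.mono fun p hp => hp.trans hCD, fun y => (hf.2 y).mono fun p hp =>
    hp.trans (mul_le_mul_of_nonneg_right hCD (hω _))⟩

lemma Reg.shift {ω : ℝ → ℝ} {C : ℝ} {m : ℕ} {f : SpT → ℝ} (h : Reg ω C m f) (v : Euc 3) :
    Reg ω C m (fun p => f (p + ((v, 0) : SpT))) := by
  have hM : ∀ f, HasMod ω C f → HasMod ω C (fun p => f (p + ((v, 0) : SpT))) := by
    refine fun f hf => ⟨ae_shift hf.1 _, fun y => ?_⟩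
    filter_upwards [ae_shift (hf.2 y) ((v, 0) : SpT)] with p hp
    unfold Dh at *
    simpa only [add_right_comm] using hp
  induction m generalizing f with
  | zero => exact hM _ h
  | succ m ih =>
    refine ⟨hM _ h.1, fun y hy => ?_⟩
    have := ih (h.2 y hy)
    unfold Dh at *
    simpa only [add_right_comm] using this

lemma Reg.add {ω : ℝ → ℝ} {C D : ℝ} {m : ℕ} {f g : SpT → ℝ} (h : Reg ω C m f) (h' : Reg ω D m g) :
    Reg ω (C + D) m (fun p => f p + g p) := by
  have hM : ∀ f g, HasMod ω C f → HasMod ω D g → HasMod ω (C + D) (fun p => f p + g p) := by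
    refine fun f g hf hg => ⟨?_, fun y => ?_⟩
    · filter_upwards [hf.1, hg.1] with p h1 h2 using (abs_add_le _ _).trans (add_le_add h1 h2)
    · filter_upwards [hf.2 y, hg.2 y] with p h1 h2
      have e : Dh y (fun p => f p + g p) p = Dh y f p + Dh y g p := by unfold Dh; ring
      rw [e, add_mul]
      exact (abs_add_le _ _).trans (add_le_add h1 h2)
  induction m generalizing f g with
  | zero => exact hM _ _ h h'
  | succ m ih =>
    refine ⟨hM _ _ h.1 h'.1, fun y hy => ?_⟩
    have := ih (h.2 y hy) (h'.2 y hy)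
    convert this using 2 with p
    unfold Dh; ring

lemma HasMod.mul {ω : ℝ → ℝ} {C : ℝ} {f g : SpT → ℝ} (hf : HasMod ω C f) (hg : HasMod ω C g)
    (hω : ∀ r, 0 ≤ ω r) (hC : 0 ≤ C) : HasMod ω (2 * (C * C)) (fun p => f p * g p) := by
  refine ⟨?_, fun y => ?_⟩
  · filter_upwards [hf.1, hg.1] with p h1 h2
    rw [abs_mul]
    have := mul_le_mul h1 h2 (abs_nonneg _) hC
    nlinarith
  · filter_upwards [hf.1, ae_shift hg.1 ((y, 0) : SpT), hf.2 y, hg.2 y] with p h1 h2 h3 h4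
    have e : Dh y (fun p => f p * g p) p = Dh y f p * g (p + ((y, 0) : SpT)) + f p * Dh y g p := by
      unfold Dh; ring
    rw [e]
    refine (abs_add_le _ _).trans ?_
    rw [abs_mul, abs_mul]
    have hw := hω ‖y‖
    calc _ ≤ C * ω ‖y‖ * C + C * (C * ω ‖y‖) := by gcongr
      _ = _ := by ring

lemma Reg.exists_mul {ω : ℝ → ℝ} (hω : ∀ r, 0 ≤ ω r) {C : ℝ} (hC : 0 ≤ C) (m : ℕ) : ∃ K,
    ∀ f g, Reg ω C m f → Reg ω C m g → Reg ω K m (fun p => f p * g p) := by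
  induction m with
  | zero => exact ⟨_, fun f g hf hg => HasMod.mul hf hg hω hC⟩
  | succ m ih =>
    obtain ⟨K, hK⟩ := ih
    have hM : ∀ {f}, Reg ω C (m + 1) f → Reg ω C m f := fun {f} hf => by
      clear hK
      induction m generalizing f with
      | zero => exact hf.1
      | succ m ih => exact ⟨hf.1, fun y hy => ih (hf.2 y hy)⟩
    refine ⟨max (2 * (C * C)) (K + K), fun f g hf hg => ⟨?_, fun y hy => ?_⟩⟩
    · exact Reg.mono (m := 0) hω (le_max_left _ _) (hf.1.mul hg.1 hω hC)
    · have h1 := (hK _ _ (hf.2 y hy) ((hM hg).shift y)).add (hK _ _ (hM hf) (hg.2 y hy))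
      refine Reg.mono hω (le_max_right _ _) ?_
      convert h1 using 2 with p
      unfold Dh; ring

lemma HasMod.of_bdd {C : ℝ} {f : SpT → ℝ} (hf : ∀ᵐ p, |f p| ≤ C) : HasMod (fun _ => 2) C f := by
  refine ⟨hf, fun y => ?_⟩
  filter_upwards [hf, ae_shift hf ((y, 0) : SpT)] with p h1 h2
  refine (abs_sub _ _).trans ?_
  linarith

lemma Reg.of_lipschitz {C : ℝ} {m : ℕ} {f : SpT → ℝ} (h : Reg (fun r => |r|) C m f) :
    Reg (fun _ => 2) C (m + 1) f := by
  have hM : ∀ f, HasMod (fun r => |r|) C f → ∀ y : Euc 3, y ≠ 0 →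
      HasMod (fun _ => 2) C (fun p => ‖y‖⁻¹ * Dh y f p) := by
    intro f hf y hy
    have hy0 : 0 < ‖y‖ := norm_pos_iff.mpr hy
    refine .of_bdd ?_
    filter_upwards [hf.2 y] with p hp
    rw [abs_mul, abs_of_pos (inv_pos.mpr hy0), inv_mul_le_iff₀ hy0]
    rw [abs_of_pos hy0] at hp
    linarith
  induction m generalizing f with
  | zero => exact ⟨.of_bdd h.1, fun y hy => hM f h y hy⟩
  | succ m ih => exact ⟨.of_bdd h.1.1, fun y hy => ih (h.2 y hy)⟩

lemma Sol.reg_holder {u : Fin 3 → SpT → ℝ} {F : Fin 3 → Fin 3 → SpT → ℝ} (H : Sol u F) {C : ℝ}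
    (hC : 0 ≤ C) {m : ℕ} (hu : ∀ i, Reg (fun _ => 2) C m (u i))
    (hF : ∀ i j, Reg (fun _ => 2) C m (F i j)) (j : Fin 3) :
    Reg (fun r => √r) (600 * gM * C) m (u j) := by
  have hg := one_le_gM
  have hM : ∀ u F, Sol u F → (∀ i, HasMod (fun _ => 2) C (u i)) →
      (∀ i j, HasMod (fun _ => 2) C (F i j)) → HasMod (fun r => √r) (600 * gM * C) (u j) := by
    refine fun u F H hu hF => ⟨(hu j).1.mono fun p hp => hp.trans ?_,
      H.holder hC (fun i => (hu i).1) (fun i j => (hF i j).1) j⟩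
    nlinarith
  induction m generalizing u F with
  | zero => exact hM _ _ H hu hF
  | succ m ih => exact ⟨hM _ _ H (fun i => (hu i).1) fun i j => (hF i j).1, fun y hy =>
      ih (H.difference _ _) (fun i => (hu i).2 y hy) fun i j => (hF i j).2 y hy⟩

lemma Sol.reg_lipschitz {u : Fin 3 → SpT → ℝ} {F : Fin 3 → Fin 3 → SpT → ℝ} (H : Sol u F) {C : ℝ}
    (hC : 0 ≤ C) {m : ℕ} (hu : ∀ i, Reg (fun _ => 2) C m (u i))
    (hF : ∀ i j, Reg (fun r => √r) C m (F i j)) (j : Fin 3) :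
    Reg (fun r => |r|) (3 * (288 * gM * C + gM * C)) m (u j) := by
  have hg := one_le_gM
  have hM : ∀ u F, Sol u F → (∀ i, HasMod (fun _ => 2) C (u i)) →
      (∀ i j, HasMod (fun r => √r) C (F i j)) →
      HasMod (fun r => |r|) (3 * (288 * gM * C + gM * C)) (u j) := by
    refine fun u F H hu hF => ⟨(hu j).1.mono fun p hp => hp.trans ?_, fun y => ?_⟩
    · nlinarith
    · simpa using H.lipschitz hC hC (fun i => (hu i).1) (fun i j => (hF i j).2) j y
  induction m generalizing u F with
  | zero => exact hM _ _ H hu hF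
  | succ m ih => exact ⟨hM _ _ H (fun i => (hu i).1) fun i j => (hF i j).1, fun y hy =>
      ih (H.difference _ _) (fun i => (hu i).2 y hy) fun i j => (hF i j).2 y hy⟩

/-- Bounded solutions have bounded iterated spatial difference quotients of every order. -/
lemma Sol.exists_reg {u : Fin 3 → SpT → ℝ} (H : Sol u (fun i j p => u i p * u j p)) (m : ℕ) :
    ∃ C, 0 ≤ C ∧ ∀ i, Reg (fun _ => 2) C m (u i) := by
  have hg := one_le_gM
  induction m with
  | zero =>
    choose C hC using fun i => (H.umeas i).bdd
    refine ⟨∑ i, |C i|, by positivity, fun i => .of_bdd (Eventually.of_forall fun p => ?_)⟩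
    exact (hC i p).trans ((le_abs_self _).trans
      (Finset.single_le_sum (f := fun i => |C i|) (fun i _ => abs_nonneg _) (Finset.mem_univ i)))
  | succ m ih =>
    obtain ⟨C, hC, hu⟩ := ih
    obtain ⟨K, hK⟩ := Reg.exists_mul (fun _ => zero_le_two) hC m
    have h2 : ∀ r : ℝ, (0 : ℝ) ≤ (fun _ => 2) r := fun _ => zero_le_two
    have hD : 0 ≤ max C K := hC.trans (le_max_left _ _)
    have h1 := H.reg_holder hD (fun i => (hu i).mono h2 (le_max_left _ K))
      (fun i j => (hK _ _ (hu i) (hu j)).mono h2 (le_max_right C _))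
    obtain ⟨L, hL⟩ := Reg.exists_mul (ω := fun r => √r) (C := 600 * gM * max C K)
      (fun r => Real.sqrt_nonneg r) (by positivity) m
    have hE : 0 ≤ max C L := hC.trans (le_max_left _ _)
    have h3 := H.reg_lipschitz hE (fun i => (hu i).mono h2 (le_max_left _ L))
      (fun i j => (hL _ _ (h1 i) (h1 j)).mono (fun r => Real.sqrt_nonneg r) (le_max_right C _))
    exact ⟨_, by positivity, fun i => (h3 i).of_lipschitz⟩

lemma Ker.ddx {k : SpT → ℝ} (hk : Ker k) (l : List (Fin 3)) : Ker (ddx l k) := by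
  induction l with
  | nil => exact hk
  | cons i l ih => exact ih.dd _

lemma Reg.ddx_J_le {k : SpT → ℝ} (hk : Ker k) (hk1 : (∫ q, |k q|) ≤ 1) {C : ℝ} (hC : 0 ≤ C)
    {l : List (Fin 3)} {f : SpT → ℝ} (hf : BM f) (h : Reg (fun _ => 2) C l.length f) (p : SpT) :
    |_root_.ddx l (J k f) p| ≤ C := by
  induction l generalizing f p with
  | nil => exact (J_abs_le hk.integrable h.mod.1 p).trans (mul_le_of_le_one_left hC hk1)
  | cons i l ih =>
    have key : ∀ t : ℝ, |ddx l (J k f) (p + t • ex i) - ddx l (J k f) p| ≤ C * |t| := by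
      intro t
      rcases eq_or_ne t 0 with rfl | ht
      · simp
      have e : t • ex i = ((t • EuclideanSpace.single i 1, 0) : SpT) := by simp [ex]
      have hn : ‖t • (EuclideanSpace.single i 1 : Euc 3)‖ = |t| := by simp [norm_smul]
      have ht0 : 0 < |t| := abs_pos.mpr ht
      have h1 := ih (hf.Dh _ _) (h.2 (t • EuclideanSpace.single i 1)
        (norm_pos_iff.mp (by rw [hn]; exact ht0))) p
      rw [hn, ddx_J hk (hf.Dh _ _), J_Dh (hk.ddx l) hf, ← ddx_J hk hf, ← e, abs_mul,
        abs_of_pos (inv_pos.mpr ht0), inv_mul_le_iff₀ ht0] at h1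
      linarith
    have hd : HasDerivAt (fun t : ℝ => ddx l (J k f) (p + t • ex i))
        (ddx (i :: l) (J k f) p) 0 := by
      have h1 : HasFDerivAt (ddx l (J k f)) (fderiv ℝ (ddx l (J k f)) (p + (0 : ℝ) • ex i))
          (p + (0 : ℝ) • ex i) :=
        (((SB_J hk hf).ddx l).smooth.differentiable _).hasFDerivAt
      have h2 : HasDerivAt (fun t : ℝ => p + t • ex i) (ex i) 0 := by
        simpa using ((hasDerivAt_id (0 : ℝ)).smul_const (ex i)).const_add p
      have h3 := h1.comp_hasDerivAt (0 : ℝ) h2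
      simp only [zero_smul, add_zero] at h3
      exact h3
    rw [← Real.norm_eq_abs]
    refine hd.le_of_lip' hC (Eventually.of_forall fun t => ?_)
    simpa using key t

lemma Sol.exists_ddx_bound {u : Fin 3 → SpT → ℝ} (H : Sol u (fun i j p => u i p * u j p))
    (m : ℕ) : ∃ C, 0 ≤ C ∧ ∀ l : List (Fin 3), l.length = m → ∀ n p,
      (∀ i, |ddx l (J (mol n) (u i)) p| ≤ C) ∧
      ∀ i j, |ddx l (J (mol n) (fun p => u i p * u j p)) p| ≤ C := by
  obtain ⟨C, hC, hu⟩ := H.exists_reg m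
  obtain ⟨K, hK⟩ := Reg.exists_mul (fun _ => zero_le_two) hC m
  have h2 : ∀ r : ℝ, (0 : ℝ) ≤ (fun _ => 2) r := fun _ => zero_le_two
  have hD : 0 ≤ max C K := hC.trans (le_max_left _ _)
  refine ⟨max C K, hD, ?_⟩
  rintro l rfl n p
  exact ⟨fun i => Reg.ddx_J_le (mol_ker n) (integral_abs_mol n).le hD (H.umeas i)
      ((hu i).mono h2 (le_max_left _ _)) p,
    fun i j => Reg.ddx_J_le (mol_ker n) (integral_abs_mol n).le hD (H.Fmeas i j)
      ((hK _ _ (hu i) (hu j)).mono h2 (le_max_right _ _)) p⟩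

/-- Components of a velocity field, extended by zero to nonnegative times. -/
def cut (u : Euc 3 → ℝ → Euc 3) (i : Fin 3) (p : SpT) : ℝ := if p.2 < 0 then u p.1 p.2 i else 0

lemma dd_reflect {k : SpT → ℝ} (hk : Smooth k) (p v : SpT) :
    dd v (fun q => k (p - q)) = fun q => -dd v k (p - q) := by
  funext q
  have h1 : HasFDerivAt (fun q : SpT => p - q) (-(ContinuousLinearMap.id ℝ SpT)) q := by
    simpa using (hasFDerivAt_id q).const_sub p
  have h2 := ((hk.differentiable (p - q)).hasFDerivAt).comp q h1
  have h3 : (k ∘ fun q => p - q) = fun q => k (p - q) := rfl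
  rw [h3] at h2
  unfold dd
  rw [h2.fderiv]; simp

lemma dd_neg (f : SpT → ℝ) (v : SpT) : dd v (fun q => -f q) = fun q => -dd v f q := by
  funext q
  unfold dd
  rw [fderiv_fun_neg]; rfl

lemma Ker.reflect {k : SpT → ℝ} (hk : Ker k) (p : SpT) : Ker (fun q => k (p - q)) :=
  ⟨hk.smooth.comp (contDiff_const.sub contDiff_id),
    hk.cpt.comp_homeomorph (Homeomorph.subLeft p)⟩

lemma Adm.tsupport_reflect {k : SpT → ℝ} {p : SpT} (hp : Adm k p) :
    tsupport (fun q => k (p - q)) ⊆ Set.univ ×ˢ Set.Iio 0 := by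
  intro q hq
  have h : p - q ∈ tsupport k := by
    have := tsupport_comp_subset_preimage k (continuous_const.sub continuous_id :
      Continuous fun q : SpT => p - q) hq
    exact this
  have := sub_pos.mpr (hp _ h)
  simp only [Set.mem_prod, Set.mem_univ, Set.mem_Iio, true_and]
  simpa using this

lemma J_eq_integrable {k f : SpT → ℝ} (hk : Integrable k) (hf : BM f) (p : SpT) :
    Integrable (fun q => k (p - q) * f q) := by
  have := (J_integrable hk hf p).comp_sub_left p
  simpa using this

/-- `g` is integrable with integral `I`. -/
def HasInt (g : SpT → ℝ) (I : ℝ) : Prop := Integrable g ∧ ∫ q, g q = I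

lemma HasInt.sub {f g : SpT → ℝ} {a b : ℝ} (hf : HasInt f a) (hg : HasInt g b) :
    HasInt (fun q => f q - g q) (a - b) :=
  ⟨hf.1.sub hg.1, by rw [integral_sub hf.1 hg.1, hf.2, hg.2]⟩

lemma HasInt.sum {f : Fin 3 → SpT → ℝ} {a : Fin 3 → ℝ} (hf : ∀ i, HasInt (f i) (a i)) :
    HasInt (fun q => ∑ i, f i q) (∑ i, a i) :=
  ⟨integrable_finsetSum _ fun i _ => (hf i).1, by
    rw [integral_finsetSum _ fun i _ => (hf i).1]
    exact Finset.sum_congr rfl fun i _ => (hf i).2⟩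

lemma hasInt_J {k f : SpT → ℝ} (hk : Ker k) (hf : BM f) (p : SpT) :
    HasInt (fun q => k (p - q) * f q) (J k f p) :=
  ⟨J_eq_integrable hk.integrable hf p, (J_eq k f p).symm⟩

lemma setIntegral_past (g : SpT → ℝ) :
    (∫ q in (Set.univ ×ˢ Set.Iio 0 : Set SpT), g q) = ∫ q : SpT, if q.2 < 0 then g q else 0 := by
  have hm : MeasurableSet (Set.univ ×ˢ Set.Iio 0 : Set SpT) :=
    MeasurableSet.univ.prod measurableSet_Iio
  rw [← integral_indicator hm]
  congr 1
  funext q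
  simp [Set.indicator]

lemma IsWeakNS.sol {u : Euc 3 → ℝ → Euc 3} {M : ℝ}
    (hmeas : Measurable (fun q : Euc 3 × ℝ => u q.1 q.2))
    (hbd : ∀ x : Euc 3, ∀ t < (0 : ℝ), ‖u x t‖ ≤ M) (h : IsWeakNS 3 (Set.Iio 0) u) :
    Sol (cut u) (fun i j p => cut u i p * cut u j p) := by
  have hM : 0 ≤ M := (norm_nonneg _).trans (hbd 0 (-1) (by norm_num))
  have hu : ∀ i, BM (cut u i) := by
    refine fun i => ⟨Measurable.ite (measurableSet_lt measurable_snd measurable_const)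
      ((EuclideanSpace.proj i : Euc 3 →L[ℝ] ℝ).measurable.comp hmeas) measurable_const, M, ?_⟩
    intro p
    unfold cut
    split_ifs with hp
    · exact (PiLp.norm_apply_le (u p.1 p.2) i).trans (hbd _ _ hp)
    · simpa using hM
  have hF : ∀ i j, BM (fun p => cut u i p * cut u j p) := fun i j => (hu i).mul (hu j)
  refine ⟨hu, hF, fun i p hp => if_neg (not_lt.mpr hp), fun k hk p hp => ?_,
    fun k hk p hp i j => ?_⟩
  · have h1 := h.1 _ (hk.reflect p).smooth (hk.reflect p).cpt hp.tsupport_reflect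
    have hd : ∀ i, pdx 3 i (fun q => k (p - q)) = fun q => -dd (ex i) k (p - q) :=
      fun i => dd_reflect hk.smooth p (ex i)
    simp_rw [hd] at h1
    rw [setIntegral_past] at h1
    simp_rw [J_eq]
    rw [← integral_finsetSum _ fun i _ => J_eq_integrable (hk.dd (ex i)).integrable (hu i) p,
      ← neg_eq_zero, ← integral_neg, ← h1]
    congr 1
    funext q
    unfold cut
    split_ifs with hq
    · rw [← Finset.sum_neg_distrib]
      exact Finset.sum_congr rfl fun i _ => by ring
    · simp
  · have hψ := hk.reflect p
    set ψ : SpT → ℝ := fun q => k (p - q) with hψd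
    let c : Fin 3 → SpT → ℝ := fun m q =>
      (if m = j then 1 else 0) * dd (ex i) ψ q - (if m = i then 1 else 0) * dd (ex j) ψ q
    have hs := fun v => hψ.smooth.dd v
    have hss := fun v w => (hs w).dd v
    have hcs : ∀ m, Smooth (c m) := fun m =>
      (contDiff_const.mul (hs _)).sub (contDiff_const.mul (hs _))
    let φ : SpT → Euc 3 := fun q => WithLp.toLp 2 fun m => c m q
    have hφ : ContDiff ℝ (⊤ : ℕ∞) φ := contDiff_euclidean.mpr hcs
    have hsupp : tsupport φ ⊆ tsupport ψ := by
      refine closure_minimal (fun q hq => ?_) (isClosed_tsupport _)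
      by_contra hn
      have hz : ∀ v, dd v ψ q = 0 := fun v => by
        by_contra h0
        exact hn (tsupport_dd_subset v ψ (subset_tsupport _ h0))
      refine hq ?_
      ext m
      simp [φ, c, hz]
    have hdc : ∀ v m, dd v (c m) = fun q => (if m = j then 1 else 0) * dd v (dd (ex i) ψ) q
        - (if m = i then 1 else 0) * dd v (dd (ex j) ψ) q := by
      intro v m
      rw [dd_sub ((hs _).differentiable.const_mul _) ((hs _).differentiable.const_mul _),
        dd_const_mul (hs _).differentiable, dd_const_mul (hs _).differentiable]
    have hddc : ∀ v w m, dd v (dd w (c m)) = fun q =>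
        (if m = j then 1 else 0) * dd v (dd w (dd (ex i) ψ)) q
        - (if m = i then 1 else 0) * dd v (dd w (dd (ex j) ψ)) q := by
      intro v w m
      rw [hdc, dd_sub ((hss _ _).differentiable.const_mul _) ((hss _ _).differentiable.const_mul _),
        dd_const_mul (hss _ _).differentiable, dd_const_mul (hss _ _).differentiable]
    have h1 := h.2 φ hφ (hψ.cpt.of_isClosed_subset (isClosed_tsupport _) hsupp)
      (hsupp.trans hp.tsupport_reflect) (fun q => by
        show ∑ m, dd (ex m) (c m) q = 0
        simp_rw [hdc]
        rw [Finset.sum_sub_distrib]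
        simp only [ite_mul, one_mul, zero_mul, Finset.sum_ite_eq', Finset.mem_univ, if_true]
        rw [dd_comm hψ.smooth, sub_self])
    have e1 : ∀ m v, pdx 3 m (fun q => φ q v) = dd (ex m) (c v) := fun _ _ => rfl
    have e2 : ∀ v, pdt 3 (fun q => φ q v) = dd et (c v) := fun _ => rfl
    have e3 : ∀ v q, lapx 3 (fun q => φ q v) q = ∑ m, dd (ex m) (dd (ex m) (c v)) q :=
      fun _ _ => rfl
    simp_rw [e1, e2, e3, hddc, hdc] at h1
    have d1 : ∀ w, dd w ψ = fun q => -dd w k (p - q) := fun w => dd_reflect hk.smooth p w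
    have d2 : ∀ v w, dd v (dd w ψ) = fun q => dd v (dd w k) (p - q) := fun v w => by
      rw [d1, dd_neg, dd_reflect (hk.dd w).smooth]; simp
    have d3 : ∀ x v w, dd x (dd v (dd w ψ)) = fun q => -dd x (dd v (dd w k)) (p - q) :=
      fun x v w => by rw [d2, dd_reflect ((hk.dd w).dd v).smooth]
    simp_rw [d3, d2] at h1
    rw [setIntegral_past, setIntegral_past, ← integral_neg] at h1
    have K2 := fun v w i => hasInt_J ((hk.dd v).dd w) (hu i) p
    have K3 := fun v w x i => hasInt_J (((hk.dd v).dd w).dd x) (hu i) p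
    have KF := fun v w i j => hasInt_J ((hk.dd v).dd w) (hF i j) p
    have i1 := (((K2 (ex i) et j).sub (K2 (ex j) et i)).sub (.sum fun m =>
      (K3 (ex i) (ex m) (ex m) j).sub (K3 (ex j) (ex m) (ex m) i)))
    have i2 := HasInt.sum fun l => (KF (ex l) (ex j) i l).sub (KF (ex l) (ex i) j l)
    rw [← i1.2, ← i2.2]
    refine (integral_congr_ae (Eventually.of_forall fun q => ?_)).trans
      (h1.trans (integral_congr_ae (Eventually.of_forall fun q => ?_)))
    · simp only [cut]
      split_ifs with hq
      · fin_cases i <;> fin_cases j <;> simp [Fin.sum_univ_three] <;> ring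
      · simp
    · simp only [cut, fun l => dd_comm hk.smooth (ex j) (ex l),
        fun l => dd_comm hk.smooth (ex i) (ex l)]
      split_ifs with hq
      · fin_cases i <;> fin_cases j <;> simp [Fin.sum_univ_three] <;> ring
      · simp

@[simp] lemma rotZ_zero (α : ℝ) (x : Euc 3) : rotZ α x 0 = cos α * x 0 - sin α * x 1 := rfl
@[simp] lemma rotZ_one (α : ℝ) (x : Euc 3) : rotZ α x 1 = sin α * x 0 + cos α * x 1 := rfl
@[simp] lemma rotZ_two (α : ℝ) (x : Euc 3) : rotZ α x 2 = x 2 := rfl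

/-- The reflection in the plane `x₂ = 0`. -/
def reflZ (x : Euc 3) : Euc 3 := WithLp.toLp 2 ![x 0, -x 1, x 2]

@[simp] lemma reflZ_zero (x : Euc 3) : reflZ x 0 = x 0 := rfl
@[simp] lemma reflZ_one (x : Euc 3) : reflZ x 1 = -x 1 := rfl
@[simp] lemma reflZ_two (x : Euc 3) : reflZ x 2 = x 2 := rfl

lemma euc_ext {x y : Euc 3} (h0 : x 0 = y 0) (h1 : x 1 = y 1) (h2 : x 2 = y 2) : x = y := by
  ext i
  fin_cases i
  · exact h0
  · exact h1
  · exact h2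

lemma exists_isometry {T : Euc 3 → Euc 3} (hadd : ∀ x y, T (x + y) = T x + T y)
    (hsmul : ∀ (c : ℝ) x, T (c • x) = c • T x) (hn : ∀ x, ‖T x‖ = ‖x‖) :
    ∃ L : Euc 3 ≃ₗᵢ[ℝ] Euc 3, ∀ x, L x = T x :=
  ⟨LinearIsometry.toLinearIsometryEquiv ⟨⟨⟨T, hadd⟩, hsmul⟩, hn⟩ rfl, fun _ => rfl⟩

lemma exists_isometry_rotZ (α : ℝ) : ∃ L : Euc 3 ≃ₗᵢ[ℝ] Euc 3, ∀ x, L x = rotZ α x := by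
  refine exists_isometry (fun x y => ?_) (fun c x => ?_) fun x => ?_
  · apply euc_ext <;> simp <;> ring
  · apply euc_ext <;> simp <;> ring
  · rw [EuclideanSpace.norm_eq, EuclideanSpace.norm_eq]
    congr 1
    simp only [Fin.sum_univ_three, Real.norm_eq_abs, sq_abs, rotZ_zero, rotZ_one, rotZ_two]
    linear_combination (x 0 ^ 2 + x 1 ^ 2) * sin_sq_add_cos_sq α

lemma exists_isometry_reflZ : ∃ L : Euc 3 ≃ₗᵢ[ℝ] Euc 3, ∀ x, L x = reflZ x := by
  refine exists_isometry (fun x y => ?_) (fun c x => ?_) fun x => ?_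
  · exact euc_ext (by simp) (by simp [add_comm]) (by simp)
  · apply euc_ext <;> simp
  · rw [EuclideanSpace.norm_eq, EuclideanSpace.norm_eq]
    congr 1
    simp [Fin.sum_univ_three]

lemma J_mol_isometry (L : Euc 3 ≃ₗᵢ[ℝ] Euc 3) (n : ℕ) (f : SpT → ℝ) (p : SpT) :
    J (mol n) f (L p.1, p.2) = J (mol n) (fun q => f (L q.1, q.2)) p := by
  have hm : MeasurePreserving (fun q : SpT => ((L q.1, q.2) : SpT)) volume volume :=
    L.measurePreserving.prod (MeasurePreserving.id volume)
  have he : MeasurableEmbedding (fun q : SpT => ((L q.1, q.2) : SpT)) :=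
    (L.toMeasurableEquiv.prodCongr (MeasurableEquiv.refl ℝ)).measurableEmbedding
  unfold J
  rw [← hm.integral_comp he]
  congr 1
  funext q
  have e : mol n ((L q.1, q.2) : SpT) = mol n q := mol_isometry n (by simp) rfl
  rw [e]
  simp

/-- Rotations of space-time about the vertical axis. -/
def rotP (α : ℝ) (p : SpT) : SpT := (rotZ α p.1, p.2)

/-- Equivariance of a family of components under rotations and the reflection, holding at
every point. -/
structure AxiSym (v : Fin 3 → SpT → ℝ) : Prop where
  smooth : ∀ i, Smooth (v i)
  rot0 : ∀ α p, v 0 (rotP α p) = cos α * v 0 p - sin α * v 1 p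
  rot1 : ∀ α p, v 1 (rotP α p) = sin α * v 0 p + cos α * v 1 p
  rot2 : ∀ α p, v 2 (rotP α p) = v 2 p
  plane : ∀ p : SpT, p.1 1 = 0 → v 1 p = 0

lemma cut_reflZ {u : Euc 3 → ℝ → Euc 3}
    (haxi : ∀ α : ℝ, ∀ x : Euc 3, ∀ t < (0 : ℝ), u (rotZ α x) t = rotZ α (u x t))
    {x : Euc 3} {t : ℝ} (ht : t < 0) (h : -(x 1) * u x t 0 + x 0 * u x t 1 = 0) :
    u (reflZ x) t 1 = -u x t 1 := by
  rcases eq_or_ne (x 0 ^ 2 + x 1 ^ 2) 0 with h0 | h0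
  · have hx1 : x 1 = 0 := by nlinarith [sq_nonneg (x 0), sq_nonneg (x 1)]
    have hx0 : x 0 = 0 := by nlinarith [sq_nonneg (x 0), sq_nonneg (x 1)]
    have e1 : reflZ x = x := by apply euc_ext <;> simp [hx1]
    have e2 : rotZ π x = x := by apply euc_ext <;> simp [hx1, hx0]
    have := congrFun (congrArg WithLp.ofLp (haxi π x t ht)) 1
    rw [e2] at this
    simp at this
    rw [e1]
    linarith
  · set z : ℂ := ⟨x 0, x 1⟩ with hz
    have hzn : ‖z‖ ^ 2 = x 0 ^ 2 + x 1 ^ 2 := by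
      rw [← Complex.normSq_eq_norm_sq, Complex.normSq_apply, hz]; ring
    have hz0 : ‖z‖ ≠ 0 := by
      intro h; rw [h] at hzn; exact h0 (by rw [← hzn]; simp)
    have hc : ‖z‖ * cos z.arg = x 0 := Complex.norm_mul_cos_arg z
    have hs : ‖z‖ * sin z.arg = x 1 := Complex.norm_mul_sin_arg z
    have e1 : rotZ (-(2 * z.arg)) x = reflZ x := by
      have := sin_sq_add_cos_sq z.arg
      apply euc_ext
      · simp only [rotZ_zero, reflZ_zero, cos_neg, sin_neg, cos_two_mul, sin_two_mul, ← hc, ← hs]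
        linear_combination (2 * ‖z‖ * cos z.arg) * this
      · simp only [rotZ_one, reflZ_one, cos_neg, sin_neg, cos_two_mul, sin_two_mul, ← hc, ← hs]
        ring
      · rfl
    have := congrFun (congrArg WithLp.ofLp (haxi (-(2 * z.arg)) x t ht)) 1
    rw [e1] at this
    rw [this]
    rw [← hc, ← hs] at h
    have h2 : cos z.arg * u x t 1 = sin z.arg * u x t 0 := by
      apply mul_left_cancel₀ hz0
      linarith
    simp only [rotZ_one, cos_neg, sin_neg, cos_two_mul, sin_two_mul]
    linear_combination (2 * cos z.arg) * h2

lemma sym_mol {u : Euc 3 → ℝ → Euc 3} (hu : ∀ i, BM (cut u i))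
    (haxi : ∀ α : ℝ, ∀ x : Euc 3, ∀ t < (0 : ℝ), u (rotZ α x) t = rotZ α (u x t))
    (hns : ∀ᵐ q ∂(volume.restrict (Set.univ ×ˢ Set.Iio 0 : Set (Euc 3 × ℝ))),
      -(q.1 1) * u q.1 q.2 0 + q.1 0 * u q.1 q.2 1 = 0) (n : ℕ) :
    AxiSym (fun i => J (mol n) (cut u i)) := by
  have hrot : ∀ α i p, J (mol n) (cut u i) (rotP α p)
      = J (mol n) (fun q => if q.2 < 0 then rotZ α (u q.1 q.2) i else 0) p := by
    intro α i p
    obtain ⟨L, hL⟩ := exists_isometry_rotZ α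
    have := J_mol_isometry L n (cut u i) p
    simp only [hL] at this
    unfold rotP
    rw [this]
    congr 1
    funext q
    unfold cut
    split_ifs with hq
    · simp only [haxi α q.1 q.2 hq]
    · rfl
  have hi := (mol_ker n).integrable
  have ec := fun c i p => congrFun (J_const_mul (mol n) (cut u i) c) p
  refine ⟨fun i => J_smooth (mol_ker n) (hu i), fun α p => ?_, fun α p => ?_, fun α p => ?_,
    fun p hp => ?_⟩
  · rw [hrot, ← ec, ← ec, ← congrFun (J_sub hi ((hu 0).const_mul _)
      ((hu 1).const_mul _)) p]
    congr 1; funext q; unfold cut; split_ifs <;> simp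
  · rw [hrot, ← ec, ← ec, ← congrFun (J_add hi ((hu 0).const_mul _)
      ((hu 1).const_mul _)) p]
    congr 1; funext q; unfold cut; split_ifs <;> simp
  · rw [hrot]; rfl
  · obtain ⟨L, hL⟩ := exists_isometry_reflZ
    have h1 := J_mol_isometry L n (cut u 1) p
    simp only [hL] at h1
    have e : ((reflZ p.1, p.2) : SpT) = p := by
      refine Prod.ext (euc_ext rfl ?_ rfl) rfl
      simp [hp]
    have hm : MeasurableSet (Set.univ ×ˢ Set.Iio 0 : Set SpT) :=
      MeasurableSet.univ.prod measurableSet_Iio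
    rw [ae_restrict_iff' hm] at hns
    have h2 : J (mol n) (fun q => cut u 1 (reflZ q.1, q.2)) p
        = J (mol n) (fun q => (-1) * cut u 1 q) p := by
      unfold J
      refine integral_congr_ae ?_
      filter_upwards [(quasiMeasurePreserving_sub_left volume p).ae hns] with q hq
      congr 1
      unfold cut
      simp only
      split_ifs with hq0
      · rw [cut_reflZ haxi hq0 (hq ⟨trivial, hq0⟩)]; ring
      · simp
    rw [e, h2, J_const_mul] at h1
    linarith

/-- The derivative along rotations about the vertical axis. -/
def Lr (f : SpT → ℝ) (p : SpT) : ℝ := p.1 0 * dd (ex 1) f p - p.1 1 * dd (ex 0) f p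

lemma rotP_hasDerivAt {f : SpT → ℝ} (hf : Smooth f) (p : SpT) (α : ℝ) :
    HasDerivAt (fun α => f (rotP α p)) (Lr f (rotP α p)) α := by
  let A : SpT := p.1 0 • ex 0 + p.1 1 • ex 1
  let B : SpT := p.1 0 • ex 1 - p.1 1 • ex 0
  let D : SpT := p - A
  have hc : (fun α => rotP α p) = fun α => cos α • A + sin α • B + D := by
    funext α
    refine Prod.ext (euc_ext ?_ ?_ ?_) ?_ <;> simp [rotP, A, B, D, ex] <;> ring
  have h1 : HasDerivAt (fun α => rotP α p) (-sin α • A + cos α • B) α := by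
    rw [hc]
    exact (((hasDerivAt_cos α).smul_const A).add ((hasDerivAt_sin α).smul_const B)).add_const D
  have h2 := (hf.differentiable (rotP α p)).hasFDerivAt.comp_hasDerivAt α h1
  have e : -sin α • A + cos α • B
      = (rotP α p).1 0 • ex 1 - (rotP α p).1 1 • ex 0 := by
    refine Prod.ext (euc_ext ?_ ?_ ?_) ?_ <;> simp [rotP, A, B, ex] <;> ring
  refine h2.congr_deriv ?_
  rw [e, map_sub, map_smul, map_smul]
  rfl

lemma Lr_eq_zero_const {f : SpT → ℝ} (hf : Smooth f) (h : ∀ p, Lr f p = 0) (α : ℝ) (p : SpT) :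
    f (rotP α p) = f p := by
  have h1 := is_const_of_deriv_eq_zero (f := fun α => f (rotP α p))
    (fun α => (rotP_hasDerivAt hf p α).differentiableAt)
    (fun α => by rw [(rotP_hasDerivAt hf p α).deriv, h]) α 0
  rw [h1]
  congr 1
  refine Prod.ext (euc_ext ?_ ?_ ?_) ?_ <;> simp [rotP]

lemma Lr_of_rot {f g : SpT → ℝ} (hf : Smooth f) (a b : ℝ)
    (h : ∀ α p, f (rotP α p) = a * (cos α * f p) + b * (sin α * g p)) (p : SpT) :
    Lr f p = b * g p := by
  have h1 := rotP_hasDerivAt hf p 0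
  have e : rotP 0 p = p := by refine Prod.ext (euc_ext ?_ ?_ ?_) ?_ <;> simp [rotP]
  rw [e] at h1
  simp_rw [h _ p] at h1
  have h2 := (((hasDerivAt_cos 0).mul_const (f p)).const_mul a).add
    (((hasDerivAt_sin 0).mul_const (g p)).const_mul b)
  have := h1.unique h2
  simpa using this

lemma smooth_coord (i : Fin 3) : Smooth (fun p : SpT => p.1 i) :=
  (EuclideanSpace.proj i : Euc 3 →L[ℝ] ℝ).contDiff.comp contDiff_fst

lemma dd_coord (i j : Fin 3) : dd (ex j) (fun p : SpT => p.1 i) = fun _ => if i = j then 1 else 0 := by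
  funext p
  have h : HasFDerivAt (fun p : SpT => p.1 i)
      ((EuclideanSpace.proj i : Euc 3 →L[ℝ] ℝ).comp (ContinuousLinearMap.fst ℝ (Euc 3) ℝ)) p :=
    ((EuclideanSpace.proj i : Euc 3 →L[ℝ] ℝ).comp
      (ContinuousLinearMap.fst ℝ (Euc 3) ℝ)).hasFDerivAt
  unfold dd
  rw [h.fderiv]
  simp [ex]

lemma dd_Lr {f : SpT → ℝ} (hf : Smooth f) (j : Fin 3) (p : SpT) :
    dd (ex j) (Lr f) p = (if 0 = j then 1 else 0) * dd (ex 1) f p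
      - (if 1 = j then 1 else 0) * dd (ex 0) f p + Lr (dd (ex j) f) p := by
  have h : Lr f = fun p => p.1 0 * dd (ex 1) f p - p.1 1 * dd (ex 0) f p := rfl
  have c := fun i => (smooth_coord i).differentiable
  have d := fun i => (hf.dd (ex i)).differentiable
  rw [h, dd_sub (f := fun p => p.1 0 * dd (ex 1) f p) (g := fun p => p.1 1 * dd (ex 0) f p)
    ((c 0).mul (d 1)) ((c 1).mul (d 0)), dd_mul (c 0) (d 1), dd_mul (c 1) (d 0),
    dd_coord, dd_coord, dd_comm hf, dd_comm hf (ex j) (ex 0)]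
  unfold Lr
  ring

/-- Components of the antisymmetric part of the gradient. -/
def Wc (v : Fin 3 → SpT → ℝ) (i j : Fin 3) (p : SpT) : ℝ := dd (ex i) (v j) p - dd (ex j) (v i) p

section
variable {v : Fin 3 → SpT → ℝ}

lemma AxiSym.Lr0 (h : AxiSym v) (p : SpT) : Lr (v 0) p = -v 1 p := by
  have := Lr_of_rot (h.smooth 0) (g := v 1) 1 (-1) (fun α p => by rw [h.rot0]; ring) p
  linarith

lemma AxiSym.Lr1 (h : AxiSym v) (p : SpT) : Lr (v 1) p = v 0 p := by
  have := Lr_of_rot (h.smooth 1) (g := v 0) 1 1 (fun α p => by rw [h.rot1]; ring) p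
  linarith

lemma AxiSym.Lr2 (h : AxiSym v) (p : SpT) : Lr (v 2) p = 0 := by
  have h1 := rotP_hasDerivAt (h.smooth 2) p 0
  have e : rotP 0 p = p := by refine Prod.ext (euc_ext ?_ ?_ ?_) ?_ <;> simp [rotP]
  rw [e] at h1
  simp_rw [h.rot2 _ p] at h1
  exact h1.unique (hasDerivAt_const _ _)

lemma smooth_Wc (h : ∀ i, Smooth (v i)) (i j : Fin 3) : Smooth (Wc v i j) :=
  ((h j).dd _).sub ((h i).dd _)

lemma Lr_sub {f g : SpT → ℝ} (hf : Smooth f) (hg : Smooth g) (p : SpT) :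
    Lr (fun p => f p - g p) p = Lr f p - Lr g p := by
  unfold Lr
  rw [dd_sub hf.differentiable hg.differentiable, dd_sub hf.differentiable hg.differentiable]
  ring

lemma Lr_Wc (h : ∀ i, Smooth (v i)) (i j : Fin 3) (p : SpT) : Lr (Wc v i j) p
    = dd (ex i) (Lr (v j)) p - dd (ex j) (Lr (v i)) p
      - ((if 0 = i then 1 else 0) * dd (ex 1) (v j) p - (if 1 = i then 1 else 0) * dd (ex 0) (v j) p)
      + ((if 0 = j then 1 else 0) * dd (ex 1) (v i) p
        - (if 1 = j then 1 else 0) * dd (ex 0) (v i) p) := by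
  rw [dd_Lr (h j), dd_Lr (h i)]
  have := Lr_sub ((h j).dd (ex i)) ((h i).dd (ex j)) p
  unfold Wc
  rw [this]
  ring

lemma AxiSym.Lr_fun (h : AxiSym v) : Lr (v 0) = (fun p => -v 1 p) ∧ Lr (v 1) = v 0 ∧
    Lr (v 2) = fun _ => 0 :=
  ⟨funext h.Lr0, funext h.Lr1, funext h.Lr2⟩

lemma dd_const (v : SpT) (c : ℝ) : dd v (fun _ => c) = fun _ => 0 := by
  funext p; simp [dd]

lemma AxiSym.Lr_W02 (h : AxiSym v) (p : SpT) : Lr (Wc v 0 2) p = -Wc v 1 2 p := by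
  obtain ⟨h0, h1, h2⟩ := h.Lr_fun
  rw [Lr_Wc h.smooth, h0, h2, dd_const, dd_neg]
  simp [Wc]

lemma AxiSym.Lr_W12 (h : AxiSym v) (p : SpT) : Lr (Wc v 1 2) p = Wc v 0 2 p := by
  obtain ⟨h0, h1, h2⟩ := h.Lr_fun
  rw [Lr_Wc h.smooth, h1, h2, dd_const]
  simp [Wc]
  ring

lemma AxiSym.Lr_W01 (h : AxiSym v) (p : SpT) : Lr (Wc v 0 1) p = 0 := by
  obtain ⟨h0, h1, h2⟩ := h.Lr_fun
  rw [Lr_Wc h.smooth, h0, h1, dd_neg]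
  simp

lemma AxiSym.axis (h : AxiSym v) {p : SpT} (h0 : p.1 0 = 0) (h1 : p.1 1 = 0) : Wc v 0 2 p = 0 := by
  rw [← h.Lr_W12, Lr, h0, h1]; simp

lemma dd_zero_of_plane {f : SpT → ℝ} (hf : Smooth f) (hp : ∀ p : SpT, p.1 1 = 0 → f p = 0)
    {p : SpT} (h1 : p.1 1 = 0) {i : Fin 3} (hi : i ≠ 1) : dd (ex i) f p = 0 := by
  have hc : HasDerivAt (fun r : ℝ => p + r • ex i) (ex i) 0 := by
    simpa using ((hasDerivAt_id (0 : ℝ)).smul_const (ex i)).const_add p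
  have h2 := (hf.differentiable (p + (0 : ℝ) • ex i)).hasFDerivAt.comp_hasDerivAt (0 : ℝ) hc
  have h3 : (f ∘ fun r : ℝ => p + r • ex i) = fun _ => 0 := by
    funext r
    refine hp _ ?_
    fin_cases i <;> simp_all [ex]
  rw [h3] at h2
  have := h2.unique (hasDerivAt_const _ _)
  simpa [dd] using this

lemma AxiSym.plane_facts (h : AxiSym v) {p : SpT} (h0 : 0 < p.1 0) (h1 : p.1 1 = 0) :
    v 1 p = 0 ∧ dd (ex 1) (v 1) p = v 0 p / p.1 0 ∧ Wc v 0 1 p = 0 ∧ Wc v 1 2 p = 0 ∧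
    p.1 0 ^ 2 * dd (ex 1) (dd (ex 1) (Wc v 0 2)) p = p.1 0 * dd (ex 0) (Wc v 0 2) p - Wc v 0 2 p := by
  have hv1 := h.plane p h1
  have a0 := h.Lr0 p
  have a1 := h.Lr1 p
  have a2 := h.Lr2 p
  simp only [Lr, h1, zero_mul, sub_zero, hv1, neg_zero] at a0 a1 a2
  have b0 : dd (ex 1) (v 0) p = 0 := by simpa [h0.ne'] using a0
  have b2 : dd (ex 1) (v 2) p = 0 := by simpa [h0.ne'] using a2
  have c0 := dd_zero_of_plane (h.smooth 1) h.plane h1 (i := 0) (by decide)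
  have c2 := dd_zero_of_plane (h.smooth 1) h.plane h1 (i := 2) (by decide)
  refine ⟨hv1, ?_, by simp [Wc, b0, c0], by simp [Wc, b2, c2], ?_⟩
  · rw [← a1]; field_simp
  · have hW := smooth_Wc h.smooth 0 2
    have e1 : Lr (Wc v 0 2) = fun p => -Wc v 1 2 p := funext h.Lr_W02
    have e2 := dd_Lr hW 1 p
    have e3 := h.Lr_W12 p
    rw [e1, dd_neg] at e2
    simp only [Lr, h1, zero_mul, sub_zero] at e2 e3
    simp at e2
    linear_combination -e3 - p.1 0 * e2

lemma AxiSym.rot_invariant (h : AxiSym v) (α : ℝ) (p : SpT) :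
    Wc v 0 1 (rotP α p) = Wc v 0 1 p ∧
    Wc v 0 2 (rotP α p) ^ 2 + Wc v 1 2 (rotP α p) ^ 2 = Wc v 0 2 p ^ 2 + Wc v 1 2 p ^ 2 := by
  refine ⟨Lr_eq_zero_const (smooth_Wc h.smooth 0 1) h.Lr_W01 α p, ?_⟩
  have h1 := smooth_Wc h.smooth 0 2
  have h2 := smooth_Wc h.smooth 1 2
  refine Lr_eq_zero_const (f := fun p => Wc v 0 2 p ^ 2 + Wc v 1 2 p ^ 2)
    ((h1.pow 2).add (h2.pow 2)) (fun p => ?_) α p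
  have e1 := h.Lr_W02 p
  have e2 := h.Lr_W12 p
  have d := fun w => congrFun (dd_add (f := fun p => Wc v 0 2 p * Wc v 0 2 p)
    (g := fun p => Wc v 1 2 p * Wc v 1 2 p) (Smooth.differentiable (h1.mul h1))
    (Smooth.differentiable (h2.mul h2)) w) p
  have d1 := fun w => congrFun (dd_mul h1.differentiable h1.differentiable w) p
  have d2 := fun w => congrFun (dd_mul h2.differentiable h2.differentiable w) p
  simp only [pow_two]
  unfold Lr at *
  simp only [d, d1, d2]
  linear_combination (2 * Wc v 0 2 p) * e1 + (2 * Wc v 1 2 p) * e2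

end

lemma exists_rotP {p : SpT} : ∃ α, (rotP α p).1 1 = 0 ∧
    (rotP α p).1 0 = √(p.1 0 ^ 2 + p.1 1 ^ 2) := by
  set z : ℂ := ⟨p.1 0, p.1 1⟩ with hz
  have hzn : √(p.1 0 ^ 2 + p.1 1 ^ 2) = ‖z‖ := by
    rw [Complex.norm_def, Complex.normSq_apply, hz]; simp only [pow_two]
  have hc : ‖z‖ * cos z.arg = p.1 0 := Complex.norm_mul_cos_arg z
  have hs : ‖z‖ * sin z.arg = p.1 1 := Complex.norm_mul_sin_arg z
  refine ⟨-z.arg, ?_, ?_⟩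
  · simp only [rotP, rotZ_one, cos_neg, sin_neg]
    linear_combination sin z.arg * hc - cos z.arg * hs
  · rw [hzn]
    simp only [rotP, rotZ_zero, cos_neg, sin_neg]
    linear_combination -cos z.arg * hc - sin z.arg * hs + ‖z‖ * sin_sq_add_cos_sq z.arg

lemma rad_anti {n a : ℕ} (h : n ≤ a) : rad a ≤ rad n := by
  unfold rad
  gcongr

lemma dd_eq_sum (f : SpT → ℝ) (v : SpT) (p : SpT) :
    dd v f p = ∑ i, v.1 i * dd (ex i) f p + v.2 * dd et f p := by
  have h1 : v = ((v.1, 0) : SpT) + v.2 • et := by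
    refine Prod.ext ?_ ?_ <;> simp [et]
  have h2 := congrFun (dd_space (f := f) v.1) p
  rw [← h2]
  unfold dd
  conv_lhs => rw [h1]
  rw [map_add, map_smul, smul_eq_mul]

lemma lipschitz_half {f : SpT → ℝ} (hf : Differentiable ℝ f) {C τ : ℝ}
    (hx : ∀ p : SpT, p.2 < τ → ∀ i, |dd (ex i) f p| ≤ C)
    (ht : ∀ p : SpT, p.2 < τ → |dd et f p| ≤ C) {p q : SpT} (hp : p.2 < τ) (hq : q.2 < τ) :
    |f p - f q| ≤ 4 * C * ‖p - q‖ := by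
  have hconv : Convex ℝ {p : SpT | p.2 < τ} :=
    convex_halfSpace_lt (f := Prod.snd) ⟨fun _ _ => rfl, fun _ _ => rfl⟩ τ
  refine hconv.norm_image_sub_le_of_norm_fderiv_le (𝕜 := ℝ) (fun x _ => hf x) (fun x hx' => ?_)
    hq hp
  have hC : 0 ≤ C := (abs_nonneg _).trans (ht x hx')
  refine ContinuousLinearMap.opNorm_le_bound _ (by positivity) fun v => ?_
  change |dd v f x| ≤ _
  rw [dd_eq_sum, Fin.sum_univ_three]
  have h1 : ∀ i, |v.1 i * dd (ex i) f x| ≤ ‖v‖ * C := fun i => by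
    rw [abs_mul]
    exact mul_le_mul ((PiLp.norm_apply_le v.1 i).trans (norm_fst_le v)) (hx x hx' i)
      (abs_nonneg _) (norm_nonneg _)
  have h2 : |v.2 * dd et f x| ≤ ‖v‖ * C := by
    rw [abs_mul]
    exact mul_le_mul (norm_snd_le v) (ht x hx') (abs_nonneg _) (norm_nonneg _)
  have a := h1 0
  have b := h1 1
  have c := h1 2
  rw [abs_le] at *
  constructor <;> linarith [a.1, a.2, b.1, b.2, c.1, c.2, h2.1, h2.2]

/-- Derivatives of the mollified vorticity. -/
def Wl (u : Fin 3 → SpT → ℝ) (n : ℕ) (l : List (Fin 3)) (i j : Fin 3) (p : SpT) : ℝ :=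
  ddx (i :: l) (J (mol n) (u j)) p - ddx (j :: l) (J (mol n) (u i)) p

lemma Adm.ddx {k : SpT → ℝ} {p : SpT} (h : Adm k p) (l : List (Fin 3)) :
    Adm (_root_.ddx l k) p := by
  induction l with
  | nil => exact h
  | cons i l ih => exact ih.dd _

section
variable {u : Fin 3 → SpT → ℝ}

lemma SB_mol (hu : ∀ i, BM (u i)) (n : ℕ) (i : Fin 3) : SB (J (mol n) (u i)) :=
  SB_J (mol_ker n) (hu i)

lemma smooth_Wl (hu : ∀ i, BM (u i)) (n : ℕ) (l : List (Fin 3)) (i j : Fin 3) :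
    Smooth (Wl u n l i j) :=
  ((SB_mol hu n j).ddx _).smooth.sub ((SB_mol hu n i).ddx _).smooth

lemma BM_Wl (hu : ∀ i, BM (u i)) (n : ℕ) (l : List (Fin 3)) (i j : Fin 3) :
    BM (Wl u n l i j) :=
  ((SB_mol hu n j).ddx _).BM.sub ((SB_mol hu n i).ddx _).BM

lemma dd_Wl (hu : ∀ i, BM (u i)) (n : ℕ) (l : List (Fin 3)) (i j : Fin 3) (v : SpT) (p : SpT) :
    dd v (Wl u n l i j) p
      = dd v (ddx (i :: l) (J (mol n) (u j))) p - dd v (ddx (j :: l) (J (mol n) (u i))) p :=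
  congrFun (dd_sub ((SB_mol hu n j).ddx _).smooth.differentiable
    ((SB_mol hu n i).ddx _).smooth.differentiable v) p

lemma abs_sum_three_le {f : Fin 3 → ℝ} {C : ℝ} (h : ∀ i, |f i| ≤ C) : |∑ i, f i| ≤ 3 * C := by
  refine (Finset.abs_sum_le_sum_abs _ _).trans ?_
  rw [Fin.sum_univ_three]
  linarith [h 0, h 1, h 2]

lemma Sol.exists_lip_Wl (H : Sol u (fun i j p => u i p * u j p)) (l : List (Fin 3)) :
    ∃ C, 0 ≤ C ∧ ∀ n i j (p q : SpT), p.2 < -rad n → q.2 < -rad n →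
      |Wl u n l i j p - Wl u n l i j q| ≤ C * ‖p - q‖ := by
  obtain ⟨A, hA0, hA⟩ := H.exists_ddx_bound (l.length + 2)
  obtain ⟨B, hB0, hB⟩ := H.exists_ddx_bound (l.length + 3)
  have hu := H.umeas
  refine ⟨4 * (6 * A + 6 * B), by positivity, fun n i j p q hp hq =>
    lipschitz_half (smooth_Wl hu n l i j).differentiable (τ := -rad n) (fun p _ a => ?_)
      (fun p hp => ?_) hp hq⟩
  · rw [dd_Wl hu]
    refine (abs_sub _ _).trans ?_
    have h1 := (hA (a :: i :: l) rfl n p).1 j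
    have h2 := (hA (a :: j :: l) rfl n p).1 i
    change |ddx (a :: i :: l) _ p| + |ddx (a :: j :: l) _ p| ≤ _
    linarith
  · have hk := (mol_ker n).ddx l
    have e := H.eq _ hk p ((adm_mol hp).ddx l) i j
    rw [← dd_J (hk.dd _) (hu j), ← dd_J (hk.dd _) (hu i)] at e
    rw [dd_Wl hu, ddx_J (mol_ker n) (hu j), ddx_J (mol_ker n) (hu i)]
    have b1 : ∀ i j m, |J (dd (ex m) (dd (ex m) (dd (ex i) (ddx l (mol n))))) (u j) p| ≤ B := by
      intro i j m
      have := (hB (m :: m :: i :: l) rfl n p).1 j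
      rwa [ddx_J (mol_ker n) (hu j)] at this
    have b2 : ∀ i j m a, |J (dd (ex i) (dd (ex m) (ddx l (mol n)))) (fun p => u j p * u a p) p|
        ≤ A := by
      intro i j m a
      have := (hA (i :: m :: l) rfl n p).2 j a
      rwa [ddx_J (mol_ker n) ((hu j).mul (hu a))] at this
    have s1 := abs_sum_three_le fun m => (abs_sub _ _).trans (add_le_add (b1 i j m) (b1 j i m))
    have s2 := abs_sum_three_le fun m => (abs_sub _ _).trans
      (add_le_add (b2 j i m m) (b2 i j m m))
    change |dd et (J (dd (ex i) (ddx l (mol n))) (u j)) p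
      - dd et (J (dd (ex j) (ddx l (mol n))) (u i)) p| ≤ _
    rw [sub_eq_iff_eq_add.mp e]
    refine (abs_add_le _ _).trans ?_
    linarith

lemma J_ddx_mol (hu : ∀ i, BM (u i)) {k : SpT → ℝ} (hk : Ker k) (a : ℕ) (l : List (Fin 3))
    (i : Fin 3) : J k (ddx l (J (mol a) (u i))) = J (ddx l k) (J (mol a) (u i)) := by
  have h := (SB_mol hu a i).BM
  rw [ddx_J (mol_ker a) (hu i), J_comm hk ((mol_ker a).ddx l) (hu i),
    ← ddx_J (mol_ker a) (SB_J hk (hu i)).BM, J_comm (mol_ker a) hk (hu i), ddx_J hk h]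

lemma J_ddx_mol_comm (hu : ∀ i, BM (u i)) (n a : ℕ) (l : List (Fin 3)) (i : Fin 3) :
    J (mol n) (ddx l (J (mol a) (u i))) = J (mol a) (ddx l (J (mol n) (u i))) := by
  rw [J_ddx_mol hu (mol_ker n), J_comm ((mol_ker n).ddx l) (mol_ker a) (hu i),
    ddx_J (mol_ker n) (hu i)]

lemma J_Wl (hu : ∀ i, BM (u i)) (n a : ℕ) (l : List (Fin 3)) (i j : Fin 3) :
    J (mol n) (Wl u a l i j) = J (mol a) (Wl u n l i j) := by
  unfold Wl
  have h := fun n l i => ((SB_mol hu n i).ddx l).BM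
  rw [J_sub (mol_ker n).integrable (h _ _ _) (h _ _ _),
    J_sub (mol_ker a).integrable (h _ _ _) (h _ _ _), J_ddx_mol_comm hu n a (i :: l),
    J_ddx_mol_comm hu n a (j :: l)]

lemma J_mol_abs_le_local {n : ℕ} {g : SpT → ℝ} {p : SpT} {B : ℝ}
    (h : ∀ q, ‖q‖ ≤ rad n → |g (p - q)| ≤ B) : |J (mol n) g p| ≤ B := by
  have h1 : ‖∫ q, mol n q * g (p - q)‖ ≤ ∫ q, mol n q * B := by
    refine norm_integral_le_of_norm_le ((mol_ker n).integrable.mul_const B)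
      (Eventually.of_forall fun q => ?_)
    rw [norm_mul, Real.norm_of_nonneg (mol_nonneg n q)]
    by_cases hq : mol n q = 0
    · simp [hq]
    · exact mul_le_mul_of_nonneg_left (h q (by simpa using mol_support n hq)) (mol_nonneg n q)
  rw [integral_mul_const, integral_mol, one_mul] at h1
  exact h1

lemma J_mol_const (n : ℕ) (c : ℝ) (p : SpT) : J (mol n) (fun _ => c) p = c := by
  unfold J
  rw [integral_mul_const, integral_mol, one_mul]

lemma BM_const (c : ℝ) : BM (fun _ => c) := ⟨measurable_const, |c|, fun _ => le_rfl⟩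

lemma J_mol_sub_le {n : ℕ} {g : SpT → ℝ} (hg : BM g) {p : SpT} {c B : ℝ}
    (h : ∀ q, ‖q‖ ≤ rad n → |g (p - q) - c| ≤ B) : |J (mol n) g p - c| ≤ B := by
  have := J_mol_abs_le_local (g := fun p => g p - c) h
  rw [J_sub (mol_ker n).integrable hg (BM_const c)] at this
  simpa only [J_mol_const] using this

lemma J_mol_mul_sub_le {n : ℕ} {c w : SpT → ℝ} (hc : BM c) (hw : BM w) {p : SpT} {w₀ K B : ℝ}
    (hK : ∀ q, |c q| ≤ K) (h : ∀ q, ‖q‖ ≤ rad n → |w (p - q) - w₀| ≤ B) :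
    |J (mol n) (fun p => c p * w p) p - J (mol n) c p * w₀| ≤ K * B := by
  have := J_mol_abs_le_local (g := fun p => c p * w p - w₀ * c p) (n := n) (p := p) (B := K * B)
    fun q hq => by
      have e : c (p - q) * w (p - q) - w₀ * c (p - q) = c (p - q) * (w (p - q) - w₀) := by ring
      rw [e, abs_mul]
      exact mul_le_mul (hK _) (h q hq) (abs_nonneg _) ((abs_nonneg _).trans (hK 0))
  rw [J_sub (mol_ker n).integrable (hc.mul hw) (hc.const_mul w₀), J_const_mul] at this
  rwa [mul_comm _ w₀]

lemma Sol.exists_compare_Wl (H : Sol u (fun i j p => u i p * u j p)) (l : List (Fin 3)) :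
    ∃ C, 0 ≤ C ∧ ∀ n a, n ≤ a → ∀ i j (p q : SpT), p.2 < -(3 * rad n) → ‖q‖ ≤ rad n →
      |Wl u a l i j (p - q) - Wl u n l i j p| ≤ C * rad n := by
  obtain ⟨C, hC, h⟩ := H.exists_lip_Wl l
  have hu := H.umeas
  have hn : ∀ {p q : SpT} {r : ℝ}, ‖q‖ ≤ r → (p - q).2 ≤ p.2 + r := by
    intro p q r hq
    have := (abs_le.mp ((norm_snd_le q).trans hq)).1
    rw [Prod.snd_sub]
    linarith
  refine ⟨3 * C, by positivity, fun n a hna i j p q hp hq => ?_⟩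
  have hr := rad_anti hna
  have hn0 := rad_pos n
  have hpq := hn (p := p) hq
  have h1 : |J (mol n) (Wl u a l i j) (p - q) - Wl u a l i j (p - q)| ≤ C * rad n := by
    refine J_mol_sub_le (BM_Wl hu a l i j) fun s hs => ?_
    have := hn (p := p - q) hs
    refine (h a i j _ _ (by linarith) (by linarith)).trans ?_
    rw [sub_sub_cancel_left, norm_neg]
    exact mul_le_mul_of_nonneg_left hs hC
  have h2 : |J (mol a) (Wl u n l i j) (p - q) - Wl u n l i j (p - q)| ≤ C * rad n := by
    refine J_mol_sub_le (BM_Wl hu n l i j) fun s hs => ?_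
    have := hn (p := p - q) (hs.trans hr)
    refine (h n i j _ _ (by linarith) (by linarith)).trans ?_
    rw [sub_sub_cancel_left, norm_neg]
    exact mul_le_mul_of_nonneg_left (hs.trans hr) hC
  have h3 := h n i j (p - q) p (by linarith) (by linarith)
  rw [sub_sub_cancel_left, norm_neg] at h3
  have h4 := mul_le_mul_of_nonneg_left hq hC
  rw [J_Wl hu] at h1
  rw [abs_le] at *
  constructor <;> linarith [h1.1, h1.2, h2.1, h2.2, h3.1, h3.2]

end

lemma J_tendsto {k f : SpT → ℝ} {g : ℕ → SpT → ℝ} (hk : Integrable k) {C : ℝ}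
    (hm : ∀ a, Measurable (g a)) (hb : ∀ a p, |g a p| ≤ C)
    (h : ∀ᵐ p, Tendsto (fun a => g a p) atTop (𝓝 (f p))) (p : SpT) :
    Tendsto (fun a => J k (g a) p) atTop (𝓝 (J k f p)) := by
  unfold J
  refine tendsto_integral_of_dominated_convergence (fun q => |k q| * C) (fun a => ?_)
    (hk.abs.mul_const C) (fun a => Eventually.of_forall fun q => ?_) ?_
  · exact hk.aestronglyMeasurable.mul
      ((hm a).comp (measurable_const.sub measurable_id)).aestronglyMeasurable
  · rw [norm_mul]
    exact mul_le_mul_of_nonneg_left (hb a _) (norm_nonneg _)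
  · filter_upwards [(quasiMeasurePreserving_sub_left volume p).ae h] with q hq
    exact hq.const_mul _

lemma SB.mul {f g : SpT → ℝ} (hf : SB f) (hg : SB g) : SB (fun p => f p * g p) := by
  refine ⟨hf.smooth.mul hg.smooth, fun l => ?_⟩
  suffices ∀ f g : SpT → ℝ, SB f → SB g →
      ∃ C, ∀ p, |l.foldr _root_.dd (fun p => f p * g p) p| ≤ C from this f g hf hg
  clear hf hg f g
  induction l using List.reverseRecOn with
  | nil => exact fun f g hf hg => (hf.BM.mul hg.BM).bdd
  | append_singleton l v ih =>
    intro f g hf hg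
    obtain ⟨A, hA⟩ := ih _ _ (hf.dd v) hg
    obtain ⟨B, hB⟩ := ih _ _ hf (hg.dd v)
    have hs : ∀ {f g : SpT → ℝ}, Smooth f → Smooth g →
        l.foldr _root_.dd (fun p => f p + g p)
          = fun p => l.foldr _root_.dd f p + l.foldr _root_.dd g p := by
      intro f g hf hg
      have hl : ∀ {f : SpT → ℝ} (l : List SpT), Smooth f → Smooth (l.foldr _root_.dd f) := by
        intro f l hf
        induction l with
        | nil => exact hf
        | cons v l ih => exact ih.dd v
      clear ih hA hB
      induction l with
      | nil => rfl
      | cons v l ih =>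
        rw [List.foldr_cons, ih, dd_add (hl l hf).differentiable (hl l hg).differentiable]
        rfl
    refine ⟨A + B, fun p => ?_⟩
    rw [List.foldr_append, List.foldr_cons, List.foldr_nil,
      dd_mul hf.smooth.differentiable hg.smooth.differentiable,
      hs ((hf.dd v).smooth.mul hg.smooth) (hf.smooth.mul (hg.dd v).smooth)]
    exact (abs_add_le _ _).trans (add_le_add (hA p) (hB p))

/-- Pointwise identity for the curl of the convective term of a divergence-free field. -/
lemma curl_convection {V : Fin 3 → SpT → ℝ} (hV : ∀ i, Smooth (V i)) {τ : ℝ}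
    (hdiv : ∀ p : SpT, p.2 < τ → ∑ i, dd (ex i) (V i) p = 0) {p : SpT} (hp : p.2 < τ) :
    ∑ l, (dd (ex l) (dd (ex 0) (fun p => V 2 p * V l p)) p
      - dd (ex l) (dd (ex 2) (fun p => V 0 p * V l p)) p)
    = ∑ l, V l p * dd (ex l) (Wc V 0 2) p - dd (ex 1) (V 1) p * Wc V 0 2 p
      + dd (ex 1) (V 0) p * Wc V 1 2 p + dd (ex 1) (V 2) p * Wc V 0 1 p := by
  have hd := fun i => (hV i).differentiable
  have hdd := fun v i => ((hV i).dd v).differentiable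
  have key : ∀ (j l i : Fin 3), dd (ex l) (dd (ex j) (fun p => V i p * V l p)) p
      = dd (ex j) (dd (ex l) (V i)) p * V l p + dd (ex l) (V i) p * dd (ex j) (V l) p
        + (dd (ex j) (V i) p * dd (ex l) (V l) p + V i p * dd (ex j) (dd (ex l) (V l)) p) := by
    intro j l i
    have h1 : Smooth (fun p => V i p * V l p) := (hV i).mul (hV l)
    rw [dd_comm h1, dd_mul (hd i) (hd l),
      dd_add (f := fun p => dd (ex l) (V i) p * V l p) (g := fun p => V i p * dd (ex l) (V l) p)
        ((hdd _ _).mul (hd _)) ((hd _).mul (hdd _ _)),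
      dd_mul (hdd _ _) (hd _), dd_mul (hd _) (hdd _ _)]
  have hdiv2 : ∀ j, ∑ l, dd (ex j) (dd (ex l) (V l)) p = 0 := by
    intro j
    have h := dd_congr_half hdiv (ex j) hp
    rwa [dd_sum _ fun l => hdd (ex l) l, dd_const] at h
  have hW : ∀ l, dd (ex l) (Wc V 0 2) p
      = dd (ex 0) (dd (ex l) (V 2)) p - dd (ex 2) (dd (ex l) (V 0)) p := by
    intro l
    unfold Wc
    rw [dd_sub (hdd _ _) (hdd _ _), dd_comm (hV 2), dd_comm (hV 0)]
  simp only [key, hW]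
  have d1 := hdiv p hp
  have d2 := hdiv2 0
  have d3 := hdiv2 2
  simp only [Fin.sum_univ_three] at d1 d2 d3 ⊢
  unfold Wc
  linear_combination (dd (ex 0) (V 2) p - dd (ex 2) (V 0) p) * 2 * d1 + V 2 p * d2 - V 0 p * d3

section
variable {u : Fin 3 → SpT → ℝ}

/-- The forcing in the equation of the mollified vorticity. -/
def NW (u : Fin 3 → SpT → ℝ) (n : ℕ) (p : SpT) : ℝ :=
  ∑ l, (J (dd (ex 0) (dd (ex l) (mol n))) (fun p => u 2 p * u l p) p
    - J (dd (ex 2) (dd (ex l) (mol n))) (fun p => u 0 p * u l p) p)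

/-- The limiting form of the forcing in the equation of the mollified vorticity. -/
def drift (u : Fin 3 → SpT → ℝ) (n : ℕ) (p : SpT) : ℝ :=
  ∑ l, J (mol n) (u l) p * Wl u n [l] 0 2 p - dd (ex 1) (J (mol n) (u 1)) p * Wl u n [] 0 2 p
    + dd (ex 1) (J (mol n) (u 0)) p * Wl u n [] 1 2 p
    + dd (ex 1) (J (mol n) (u 2)) p * Wl u n [] 0 1 p

lemma Sol.dt_W (H : Sol u (fun i j p => u i p * u j p)) {n : ℕ} {p : SpT} (hp : p.2 < -rad n) :
    dd et (Wl u n [] 0 2) p = Lap (Wl u n [] 0 2) p - NW u n p := by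
  have hu := H.umeas
  have hk := mol_ker n
  have e := H.eq _ hk p (adm_mol hp) 0 2
  have h1 : ∀ v, dd v (Wl u n [] 0 2)
      = fun p => J (dd v (dd (ex 0) (mol n))) (u 2) p - J (dd v (dd (ex 2) (mol n))) (u 0) p := by
    intro v
    funext p
    rw [dd_Wl hu, ddx_J hk (hu 2), ddx_J hk (hu 0), dd_J (hk.ddx _) (hu 2),
      dd_J (hk.ddx _) (hu 0)]
    rfl
  have h2 : Lap (Wl u n [] 0 2) p = ∑ m, (J (dd (ex m) (dd (ex m) (dd (ex 0) (mol n)))) (u 2) p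
      - J (dd (ex m) (dd (ex m) (dd (ex 2) (mol n)))) (u 0) p) := by
    unfold Lap
    refine Finset.sum_congr rfl fun m _ => ?_
    rw [h1, dd_sub (J_smooth ((hk.dd _).dd _) (hu 2)).differentiable
      (J_smooth ((hk.dd _).dd _) (hu 0)).differentiable, dd_J ((hk.dd _).dd _) (hu 2),
      dd_J ((hk.dd _).dd _) (hu 0)]
  rw [h1, h2]
  unfold NW
  simp only [Fin.sum_univ_three] at e ⊢
  linear_combination e

lemma Sol.exists_term_bound (H : Sol u (fun i j p => u i p * u j p)) (l l' : List (Fin 3)) :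
    ∃ C, 0 ≤ C ∧ ∀ n (p : SpT), p.2 < -(3 * rad n) → ∀ m i j, ∀ᶠ a in atTop,
      |J (mol n) (fun p => ddx l (J (mol a) (u m)) p * Wl u a l' i j p) p
        - ddx l (J (mol n) (u m)) p * Wl u n l' i j p| ≤ C * rad n := by
  obtain ⟨K, hK0, hK⟩ := H.exists_ddx_bound l.length
  obtain ⟨C, hC0, hC⟩ := H.exists_compare_Wl l'
  have hu := H.umeas
  refine ⟨K * C + 1, by positivity, fun n p hp m i j => ?_⟩
  have h1 : Tendsto (fun a => J (mol n) (ddx l (J (mol a) (u m))) p) atTop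
      (𝓝 (ddx l (J (mol n) (u m)) p)) := by
    rw [ddx_J (mol_ker n) (hu m)]
    simp_rw [J_ddx_mol hu (mol_ker n)]
    obtain ⟨B, hB⟩ := (hu m).bdd
    exact J_tendsto ((mol_ker n).ddx l).integrable (fun a => (SB_mol hu a m).BM.meas)
      (fun a p => J_mol_abs_le (Eventually.of_forall hB) a p) (J_mol_tendsto (hu m)) p
  have h2 := ((h1.mul_const (Wl u n l' i j p)).sub_const
    (ddx l (J (mol n) (u m)) p * Wl u n l' i j p)).abs
  rw [sub_self, abs_zero] at h2
  filter_upwards [h2.eventually_lt_const (rad_pos n), eventually_ge_atTop n] with a ha hna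
  have h3 := J_mol_mul_sub_le (n := n) (p := p) ((SB_mol hu a m).ddx l).BM (BM_Wl hu a l' i j)
    (fun q => (hK l rfl a q).1 m) (fun q hq => hC n a hna i j p q hp hq)
  rw [abs_le] at *
  rw [abs_lt] at ha
  constructor <;> linarith [h3.1, h3.2, ha.1, ha.2]

lemma Sol.J_NW (H : Sol u (fun i j p => u i p * u j p)) {n a : ℕ} (hna : n ≤ a) {p : SpT}
    (hp : p.2 < -(3 * rad n)) :
    ∑ l, (J (dd (ex 0) (dd (ex l) (mol n))) (fun p => J (mol a) (u 2) p * J (mol a) (u l) p) p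
      - J (dd (ex 2) (dd (ex l) (mol n))) (fun p => J (mol a) (u 0) p * J (mol a) (u l) p) p)
    = J (mol n) (fun p => ∑ l, J (mol a) (u l) p * Wl u a [l] 0 2 p
      - dd (ex 1) (J (mol a) (u 1)) p * Wl u a [] 0 2 p
      + dd (ex 1) (J (mol a) (u 0)) p * Wl u a [] 1 2 p
      + dd (ex 1) (J (mol a) (u 2)) p * Wl u a [] 0 1 p) p := by
  have hu := H.umeas
  have hk := mol_ker n
  have hV := fun i => SB_mol hu a i
  have hs : ∀ i l, SB (fun p => J (mol a) (u i) p * J (mol a) (u l) p) := fun i l =>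
    (hV i).mul (hV l)
  have e : ∀ j l i, J (dd (ex j) (dd (ex l) (mol n)))
      (fun p => J (mol a) (u i) p * J (mol a) (u l) p) p
      = ∫ q, mol n q *
        dd (ex l) (dd (ex j) (fun p => J (mol a) (u i) p * J (mol a) (u l) p)) (p - q) := by
    intro j l i
    rw [J_dd (hk.dd _) (hs i l).smooth, J_dd hk ((hs i l).smooth.dd _)]
    rfl
  have hJ : ∀ j l i, Integrable fun q => mol n q *
      dd (ex l) (dd (ex j) (fun p => J (mol a) (u i) p * J (mol a) (u l) p)) (p - q) :=
    fun j l i => J_integrable hk.integrable (((hs i l).dd _).dd _).BM p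
  simp only [e]
  simp_rw [← integral_sub (hJ _ _ _) (hJ _ _ _)]
  rw [← integral_finsetSum _ fun l _ => (hJ 0 l 2).sub' (hJ 2 l 0)]
  unfold J
  congr 1
  funext q
  by_cases hq : mol n q = 0
  · simp [hq]
  · have hq' := mol_support n hq
    rw [mem_closedBall_zero_iff] at hq'
    have h1 := (abs_le.mp ((norm_snd_le q).trans hq')).1
    have h2 := rad_anti hna
    have hpq : (p - q).2 < -rad a := by
      rw [Prod.snd_sub]
      linarith [rad_pos n]
    have h3 := curl_convection (V := fun i => J (mol a) (u i)) (τ := -rad a)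
      (fun i => (hV i).smooth) (fun p hp => by
        have := H.div _ (mol_ker a) p (adm_mol hp)
        simpa only [dd_J (mol_ker a) (hu _)] using this) hpq
    simp only [← mul_sub, ← Finset.mul_sum]
    congr 1
    refine h3.trans ?_
    congr 3
    refine Finset.sum_congr rfl fun l _ => ?_
    congr 1
    rw [show Wc (fun i => J (mol a) (u i)) 0 2 = fun p => dd (ex 0) (J (mol a) (u 2)) p
      - dd (ex 2) (J (mol a) (u 0)) p from rfl, dd_sub ((hV 2).dd _).smooth.differentiable
      ((hV 0).dd _).smooth.differentiable, dd_comm (hV 2).smooth, dd_comm (hV 0).smooth]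
    rfl

/-- The mollified forcing agrees with the drift up to an error of the size of the mollification. -/
lemma Sol.exists_drift_bound (H : Sol u (fun i j p => u i p * u j p)) :
    ∃ C, 0 ≤ C ∧ ∀ n (p : SpT), p.2 < -(3 * rad n) →
      |NW u n p - drift u n p| ≤ C * rad n := by
  have hu := H.umeas
  choose C1 hC1 h1 using fun l : Fin 3 => H.exists_term_bound [] [l]
  obtain ⟨C2, hC2, h2⟩ := H.exists_term_bound [1] []
  refine ⟨C1 0 + C1 1 + C1 2 + 3 * C2 + 1, by have := hC1 0; have := hC1 1; have := hC1 2; positivity,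
    fun n p hp => ?_⟩
  have hk := mol_ker n
  have hlim : Tendsto (fun a => ∑ l, (J (dd (ex 0) (dd (ex l) (mol n)))
        (fun p => J (mol a) (u 2) p * J (mol a) (u l) p) p
      - J (dd (ex 2) (dd (ex l) (mol n))) (fun p => J (mol a) (u 0) p * J (mol a) (u l) p) p))
      atTop (𝓝 (NW u n p)) := by
    have key : ∀ {k : SpT → ℝ}, Ker k → ∀ i l,
        Tendsto (fun a => J k (fun p => J (mol a) (u i) p * J (mol a) (u l) p) p) atTop
          (𝓝 (J k (fun p => u i p * u l p) p)) := by
      intro k hk i l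
      obtain ⟨B, hB⟩ := (hu i).bdd
      obtain ⟨D, hD⟩ := (hu l).bdd
      refine J_tendsto hk.integrable (C := B * D)
        (fun a => (SB_mol hu a i).BM.meas.mul (SB_mol hu a l).BM.meas) (fun a p => ?_) ?_ p
      · rw [Pi.mul_apply, abs_mul]
        exact mul_le_mul (J_mol_abs_le (Eventually.of_forall hB) a p)
          (J_mol_abs_le (Eventually.of_forall hD) a p) (abs_nonneg _)
          ((abs_nonneg _).trans (hB 0))
      · filter_upwards [J_mol_tendsto (hu i), J_mol_tendsto (hu l)] with p h1 h2
        exact h1.mul h2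
    exact tendsto_finsetSum _ fun l _ =>
      (key ((hk.dd _).dd _) 2 l).sub (key ((hk.dd _).dd _) 0 l)
  have hlim2 := (hlim.sub_const (NW u n p)).abs
  rw [sub_self, abs_zero] at hlim2
  have ev := (hlim2.eventually_lt_const (rad_pos n)).and <| (eventually_ge_atTop n).and <|
    (h1 0 n p hp 0 0 2).and <| (h1 1 n p hp 1 0 2).and <| (h1 2 n p hp 2 0 2).and <|
    (h2 n p hp 1 0 2).and <| (h2 n p hp 0 1 2).and (h2 n p hp 2 0 1)
  obtain ⟨a, e0, hna, e1, e2, e3, e4, e5, e6⟩ := ev.exists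
  rw [H.J_NW hna hp] at e0
  have hb : ∀ l m l' i j, BM (fun p => ddx l (J (mol a) (u m)) p * Wl u a l' i j p) :=
    fun l m l' i j => ((SB_mol hu a m).ddx l).BM.mul (BM_Wl hu a l' i j)
  have hi := hk.integrable
  have b1 := (hb [] 0 [0] 0 2).add (hb [] 1 [1] 0 2)
  have b2 := b1.add (hb [] 2 [2] 0 2)
  have b3 := b2.sub (hb [1] 1 [] 0 2)
  have b4 := b3.add (hb [1] 0 [] 1 2)
  have es := congrFun (J_add hi b4 (hb [1] 2 [] 0 1)) p
  rw [J_add hi b3 (hb [1] 0 [] 1 2), J_sub hi b2 (hb [1] 1 [] 0 2), J_add hi b1 (hb [] 2 [2] 0 2),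
    J_add hi (hb [] 0 [0] 0 2) (hb [] 1 [1] 0 2)] at es
  simp only [Fin.sum_univ_three] at e0
  unfold drift
  simp only [Fin.sum_univ_three]
  have es' := es
  simp only [ddx, List.foldr_cons, List.foldr_nil] at es' e1 e2 e3 e4 e5 e6
  rw [es'] at e0
  rw [abs_le] at e1 e2 e3 e4 e5 e6 ⊢
  rw [abs_lt] at e0
  constructor <;> linarith [e0.1, e0.2, e1.1, e1.2, e2.1, e2.2, e3.1, e3.2, e4.1, e4.2, e5.1,
    e5.2, e6.1, e6.2]

end

lemma second_deriv_nonpos_of_isLocalMax {f f' : ℝ → ℝ} {x d : ℝ}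
    (hf : ∀ᶠ y in 𝓝 x, HasDerivAt f (f' y) y) (hf' : HasDerivAt f' d x) (hmax : IsLocalMax f x) :
    f' x = 0 ∧ d ≤ 0 := by
  have h0 := hmax.hasDerivAt_eq_zero hf.self_of_nhds
  refine ⟨h0, not_lt.mp fun hd => ?_⟩
  have he : deriv f =ᶠ[𝓝 x] f' := hf.mono fun y hy => hy.deriv
  have hdd : deriv (deriv f) x = d := by rw [he.deriv_eq, hf'.deriv]
  have hmin := isLocalMin_of_deriv_deriv_pos (by rwa [hdd]) (by rw [he.self_of_nhds, h0])
    hf.self_of_nhds.continuousAt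
  have hc : f =ᶠ[𝓝 x] fun _ => f x := by
    filter_upwards [hmin, hmax] with y h1 h2 using le_antisymm h2 h1
  have hc2 : deriv f =ᶠ[𝓝 x] fun _ => 0 := hc.deriv.trans (by simp)
  rw [hc2.deriv_eq, deriv_const] at hdd
  exact hd.ne hdd

lemma deriv_nonneg_of_left_max {f : ℝ → ℝ} {x d a : ℝ} (hf : HasDerivAt f d x) (ha : a < x)
    (hmax : ∀ y ∈ Set.Ioo a x, f y ≤ f x) : 0 ≤ d := by
  have h1 : Tendsto (slope f x) (𝓝[<] x) (𝓝 d) :=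
    (hasDerivAt_iff_tendsto_slope.mp hf).mono_left (nhdsWithin_mono _ fun y hy => ne_of_lt hy)
  refine ge_of_tendsto h1 ?_
  filter_upwards [Ioo_mem_nhdsLT ha] with y hy
  rw [slope_def_field]
  exact div_nonneg_of_nonpos (by linarith [hmax y hy]) (by linarith [hy.2])

/-- The logarithmic barrier. -/
def barrier (M r : ℝ) : ℝ := log r + exp (2 * M * r)

lemma barrier_hasDerivAt (M : ℝ) {r : ℝ} (hr : 0 < r) :
    HasDerivAt (barrier M) (1 / r + 2 * M * exp (2 * M * r)) r := by
  have h1 : HasDerivAt (fun r => exp (2 * M * r)) (exp (2 * M * r) * (2 * M * 1)) r :=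
    ((hasDerivAt_id r).const_mul (2 * M)).exp
  refine ((hasDerivAt_log hr.ne').add h1).congr_deriv ?_
  rw [one_div]; ring

lemma barrier_deriv_hasDerivAt (M : ℝ) {r : ℝ} (hr : 0 < r) :
    HasDerivAt (fun r => 1 / r + 2 * M * exp (2 * M * r))
      (-1 / r ^ 2 + 4 * M ^ 2 * exp (2 * M * r)) r := by
  have h1 : HasDerivAt (fun r => exp (2 * M * r)) (exp (2 * M * r) * (2 * M * 1)) r :=
    ((hasDerivAt_id r).const_mul (2 * M)).exp
  have h2 := (hasDerivAt_inv hr.ne').add (h1.const_mul (2 * M))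
  simp only [one_div]
  refine h2.congr_deriv ?_
  rw [neg_div, one_div]; ring

lemma barrier_mono {M : ℝ} (hM : 0 ≤ M) {r s : ℝ} (hr : 0 < r) (h : r ≤ s) :
    barrier M r ≤ barrier M s := by
  unfold barrier
  gcongr

lemma barrier_ineq {M r : ℝ} (hM : 0 ≤ M) (hr : 0 < r) :
    2 / r ^ 2 ≤ (-1 / r ^ 2 + 4 * M ^ 2 * exp (2 * M * r))
      + (3 / r - M) * (1 / r + 2 * M * exp (2 * M * r)) := by
  have he : 1 ≤ exp (2 * M * r) := one_le_exp (by positivity)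
  have e : (-1 / r ^ 2 + 4 * M ^ 2 * exp (2 * M * r))
      + (3 / r - M) * (1 / r + 2 * M * exp (2 * M * r))
      = 2 / r ^ 2 + (M / r) * (6 * exp (2 * M * r) - 1) + 2 * M ^ 2 * exp (2 * M * r) := by
    field_simp
    ring
  rw [e]
  have h1 : 0 ≤ (M / r) * (6 * exp (2 * M * r) - 1) :=
    mul_nonneg (by positivity) (by linarith)
  have h2 : 0 ≤ 2 * M ^ 2 * exp (2 * M * r) := by positivity
  linarith

lemma exists_barrier_lt (M K : ℝ) {δ s : ℝ} (hδ : 0 < δ) (hs : 0 < s) :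
    ∃ r, 0 < r ∧ r < s ∧ δ * barrier M r < K := by
  have h1 : Tendsto (fun r => exp (2 * M * r)) (𝓝[>] 0) (𝓝 1) := by
    have : Continuous fun r => exp (2 * M * r) := by fun_prop
    simpa using (this.tendsto 0).mono_left nhdsWithin_le_nhds
  have h2 := (tendsto_log_nhdsGT_zero.atBot_add h1).const_mul_atBot hδ
  have h3 := (h2.eventually_lt_atBot K).and (Ioo_mem_nhdsGT hs)
  obtain ⟨r, hr1, hr2⟩ := h3.exists
  exact ⟨r, hr2.1, hr2.2, hr1⟩

lemma exists_barrier_scale {M R δ B : ℝ} (hM : 0 ≤ M) (hB : 0 ≤ B) (hR : 0 < R) (hδ : 0 < δ) :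
    ∃ Z κ, 0 < Z ∧ 0 ≤ κ ∧ κ * Z ^ 2 = B ∧ 3 * κ + 2 * M * κ * Z < δ / R ^ 2 := by
  obtain ⟨K, hK⟩ : ∃ K, K = (3 + 2 * M) * B * R ^ 2 := ⟨_, rfl⟩
  have hK0 : 0 ≤ K := by rw [hK]; positivity
  have hZ1 : 1 ≤ K / δ + 1 := le_add_of_nonneg_left (by positivity)
  have hZ2 : δ * (K / δ + 1) = K + δ := by field_simp
  generalize K / δ + 1 = Z at hZ1 hZ2
  have hZ0 : 0 < Z := by linarith
  have hκ0 : 0 ≤ B / Z ^ 2 := by positivity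
  refine ⟨Z, B / Z ^ 2, hZ0, hκ0, by field_simp, ?_⟩
  have h1 : B / Z ^ 2 * Z = B / Z := by field_simp
  have h2 : B / Z ^ 2 ≤ B / Z ^ 2 * Z := le_mul_of_one_le_right hκ0 hZ1
  have h3 : (3 + 2 * M) * (B / Z) < δ / R ^ 2 := by
    rw [← mul_div_assoc, div_lt_div_iff₀ hZ0 (by positivity), hZ2, ← hK]
    linarith
  rw [h1] at h2
  rw [mul_assoc, h1]
  linarith

lemma no_interior_max {M R δ κ r1 r z zs t ts t₀ Z wrr wzz wt a b : ℝ}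
    {w : ℝ → ℝ → ℝ → ℝ} {wr wz : ℝ → ℝ} (hM : 0 ≤ M) (hδ0 : 0 < δ) (hr1 : 0 < r1)
    (hra : r1 ≤ r) (hrb : r ≤ R) (hκ0 : 0 ≤ κ) (hzin : |z - zs| ≤ Z)
    (hsmall : 3 * κ + 2 * M * κ * Z < δ / R ^ 2)
    (dr : ∀ y, HasDerivAt (fun r => w r z t) (wr y) y) (drr : HasDerivAt wr wrr r)
    (dz : ∀ y, HasDerivAt (fun z => w r z t) (wz y) y) (dzz : HasDerivAt wz wzz z)
    (dt : HasDerivAt (fun t => w r z t) wt t) (ha : |a| ≤ M) (hb : |b| ≤ M)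
    (hineq : wt ≤ wrr + wzz + wr r / r - w r z t / r ^ 2
      - a * (wr r - w r z t / r) - b * wz z + r1 * (δ / R ^ 2))
    (hmr : IsLocalMax (fun r =>
      w r z t / r + δ * barrier M r - κ * (z - zs) ^ 2 - κ * (ts - t)) r)
    (hmz : IsLocalMax (fun z =>
      w r z t / r + δ * barrier M r - κ * (z - zs) ^ 2 - κ * (ts - t)) z)
    (htin : t₀ < t)
    (hmt : ∀ y ∈ Set.Ioo t₀ t,
      w r z y / r + δ * barrier M r - κ * (z - zs) ^ 2 - κ * (ts - y) ≤
      w r z t / r + δ * barrier M r - κ * (z - zs) ^ 2 - κ * (ts - t)) : False := by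
  have hr0 : 0 < r := hr1.trans_le hra
  have hR0 : 0 < R := hr0.trans_le hrb
  obtain ⟨er, err⟩ := second_deriv_nonpos_of_isLocalMax
    (f' := fun r => (wr r * r - w r z t) / r ^ 2
      + δ * (1 / r + 2 * M * exp (2 * M * r)))
    (d := ((wrr * r) * r ^ 2 - (wr r * r - w r z t) * (2 * r)) / (r ^ 2) ^ 2
      + δ * (-1 / r ^ 2 + 4 * M ^ 2 * exp (2 * M * r)))
    (by
      filter_upwards [lt_mem_nhds hr0] with y hy
      have h1 := (dr y).div (hasDerivAt_id y) hy.ne'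
      have h2 := ((h1.add ((barrier_hasDerivAt M hy).const_mul δ)).sub_const
        (κ * (z - zs) ^ 2)).sub_const (κ * (ts - t))
      refine h2.congr_deriv ?_
      simp)
    (by
      have h1 := ((drr.mul (hasDerivAt_id r)).sub (dr r)).div
        (hasDerivAt_pow 2 r) (pow_ne_zero 2 hr0.ne')
      refine (h1.add ((barrier_deriv_hasDerivAt M hr0).const_mul δ)).congr_deriv ?_
      simp)
    hmr
  obtain ⟨ez, ezz⟩ := second_deriv_nonpos_of_isLocalMax
    (f' := fun z => wz z / r - κ * (2 * (z - zs)))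
    (d := wzz / r - κ * 2)
    (by
      refine Eventually.of_forall fun y => ?_
      have h0 := (((hasDerivAt_id y).sub_const zs).pow 2).const_mul κ
      have h2 := ((((dz y).div_const r).add_const (δ * barrier M r)).sub h0).sub_const
        (κ * (ts - t))
      refine h2.congr_deriv ?_
      simp)
    (by
      have h0 := (((hasDerivAt_id z).sub_const zs).const_mul 2).const_mul κ
      refine ((dzz.div_const r).sub h0).congr_deriv ?_
      simp)
    hmz
  have et : 0 ≤ wt / r + κ := by
    refine deriv_nonneg_of_left_max ?_ htin hmt
    have h0 := ((hasDerivAt_id t).const_sub ts).const_mul κ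
    have h2 := (((dt.div_const r).add_const (δ * barrier M r)).sub_const
      (κ * (z - zs) ^ 2)).sub h0
    refine h2.congr_deriv ?_
    simp
  have hbar := barrier_ineq hM hr0
  have hs0 : 0 ≤ 1 / r + 2 * M * exp (2 * M * r) := by positivity
  generalize 1 / r + 2 * M * exp (2 * M * r) = s at *
  generalize -1 / r ^ 2 + 4 * M ^ 2 * exp (2 * M * r) = s' at *
  obtain ⟨Φ, hΦ⟩ : ∃ Φ, Φ = (wr r * r - w r z t) / r ^ 2 := ⟨_, rfl⟩
  have e1 : ((wrr * r) * r ^ 2 - (wr r * r - w r z t) * (2 * r)) / (r ^ 2) ^ 2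
      = (wrr + wr r / r - w r z t / r ^ 2) / r - 3 / r * Φ := by
    rw [hΦ]; field_simp; ring
  have e2 : (wr r - w r z t / r) / r = Φ := by
    rw [hΦ]; field_simp
  have hdiv := div_le_div_of_nonneg_right hineq hr0.le
  have e3 : (wrr + wzz + wr r / r - w r z t / r ^ 2
          - a * (wr r - w r z t / r) - b * wz z + r1 * (δ / R ^ 2)) / r
      = (wrr + wr r / r - w r z t / r ^ 2) / r + wzz / r
        - a * ((wr r - w r z t / r) / r) - b * (wz z / r)
        + r1 / r * (δ / R ^ 2) := by ring
  rw [e3, e2] at hdiv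
  rw [e1] at err
  have f1 : Φ = -(δ * s) := by linarith
  have f2 : wz z / r = κ * (2 * (z - zs)) := by linarith
  rw [f1] at hdiv err
  rw [f2] at hdiv
  have g1 : a * s ≤ M * s := mul_le_mul_of_nonneg_right (abs_le.mp ha).2 hs0
  have g2 : -(b * (z - zs)) ≤ M * Z := by
    refine (neg_le_abs _).trans ?_
    rw [abs_mul]
    exact mul_le_mul hb hzin (abs_nonneg _) hM
  have g3 : r1 / r * (δ / R ^ 2) ≤ δ / R ^ 2 :=
    mul_le_of_le_one_left (by positivity) ((div_le_one hr0).mpr hra)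
  have g4 : 2 / R ^ 2 ≤ 2 / r ^ 2 := by gcongr
  have g5 := mul_le_mul_of_nonneg_left g1 hδ0.le
  have g6 := mul_le_mul_of_nonneg_left g2 (mul_nonneg zero_le_two hκ0)
  have g7 := mul_le_mul_of_nonneg_left (g4.trans hbar) hδ0.le
  have g8 : δ * (2 / R ^ 2) = 2 * (δ / R ^ 2) := by ring
  have k1 : 3 / r * -(δ * s) = - (δ * (3 / r * s)) := by ring
  have k2 : δ * (s' + (3 / r - M) * s) = δ * s' + δ * (3 / r * s) - δ * (M * s) := by ring
  have k3 : a * -(δ * s) = - (δ * (a * s)) := by ring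
  have k4 : b * (κ * (2 * (z - zs))) = - (2 * κ * -(b * (z - zs))) := by ring
  have k5 : 2 * κ * (M * Z) = 2 * M * κ * Z := by ring
  rw [k3, k4] at hdiv
  rw [k1] at err
  rw [k2, g8] at g7
  rw [k5] at g6
  linarith

/-- A quantitative maximum principle for the vorticity of axi-symmetric flows without swirl. -/
lemma axisym_max_principle {M B c rs : ℝ} (hM : 0 ≤ M) (hB : 0 ≤ B) (hrs : 0 < rs) (hc : 0 < c) :
    ∃ ε, 0 < ε ∧ ∀ (w wr wrr wz wzz wt a b : ℝ → ℝ → ℝ → ℝ) (zs ts : ℝ),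
      Continuous (fun q : ℝ × ℝ × ℝ => w q.1 q.2.1 q.2.2) →
      (∀ r z t, HasDerivAt (fun r => w r z t) (wr r z t) r) →
      (∀ r z t, HasDerivAt (fun r => wr r z t) (wrr r z t) r) →
      (∀ r z t, HasDerivAt (fun z => w r z t) (wz r z t) z) →
      (∀ r z t, HasDerivAt (fun z => wz r z t) (wzz r z t) z) →
      (∀ r z t, HasDerivAt (fun t => w r z t) (wt r z t) t) →
      (∀ r z t, 0 < r → t ≤ ts → w r z t ≤ B ∧ w r z t ≤ B * r) →
      (∀ r z t, 0 < r → t ≤ ts → |a r z t| ≤ M ∧ |b r z t| ≤ M ∧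
        wt r z t ≤ wrr r z t + wzz r z t + wr r z t / r - w r z t / r ^ 2
          - a r z t * (wr r z t - w r z t / r) - b r z t * wz r z t + ε) →
      w rs zs ts < c * rs := by
  set R := max (rs + 1) (4 * B / c) with hR
  have hR1 : rs < R := lt_of_lt_of_le (by linarith) (le_max_left _ _)
  have hR0 : 0 < R := hrs.trans hR1
  have hBR : B / R ≤ c / 4 := by
    rw [div_le_div_iff₀ hR0 (by norm_num)]
    have : 4 * B / c ≤ R := le_max_right _ _
    rw [div_le_iff₀ hc] at this
    linarith
  set G := barrier M R - barrier M rs with hG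
  have hG0 : 0 ≤ G := sub_nonneg.mpr (barrier_mono hM hrs hR1.le)
  set δ := c / (4 * (G + 1)) with hδ
  have hδ0 : 0 < δ := by positivity
  have hδG : δ * G ≤ c / 4 := by
    rw [hδ, div_mul_eq_mul_div, div_le_div_iff₀ (by positivity) (by norm_num)]
    nlinarith
  obtain ⟨r1, hr1, hr1s, hr1b⟩ := exists_barrier_lt M (c + δ * barrier M rs - B) hδ0 hrs
  set B2 := B + δ * G with hB2
  have hB20 : 0 ≤ B2 := by positivity
  obtain ⟨Z, κ, hZ0, hκ0, hκZ, hsmall⟩ := exists_barrier_scale hM hB20 hR0 hδ0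
  refine ⟨r1 * (δ / R ^ 2), by positivity, ?_⟩
  intro w wr wrr wz wzz wt a b zs ts hcont dr drr dz dzz dt hbd heq
  by_contra! hcon
  let P : ℝ → ℝ → ℝ → ℝ := fun r z t =>
    w r z t / r + δ * barrier M r - κ * (z - zs) ^ 2 - κ * (ts - t)
  have hK : IsCompact (Set.Icc r1 R ×ˢ Set.Icc (zs - Z) (zs + Z) ×ˢ Set.Icc (ts - Z ^ 2) ts) :=
    isCompact_Icc.prod (isCompact_Icc.prod isCompact_Icc)
  have hPc : ContinuousOn (fun q : ℝ × ℝ × ℝ => P q.1 q.2.1 q.2.2)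
      (Set.Icc r1 R ×ˢ Set.Icc (zs - Z) (zs + Z) ×ˢ Set.Icc (ts - Z ^ 2) ts) := by
    have hne : ∀ q ∈ Set.Icc r1 R ×ˢ Set.Icc (zs - Z) (zs + Z) ×ˢ Set.Icc (ts - Z ^ 2) ts,
        q.1 ≠ 0 := fun q hq => (hr1.trans_le hq.1.1).ne'
    have h1 : ContinuousOn (fun q : ℝ × ℝ × ℝ => log q.1)
      (Set.Icc r1 R ×ˢ Set.Icc (zs - Z) (zs + Z) ×ˢ Set.Icc (ts - Z ^ 2) ts) :=
      continuous_fst.continuousOn.log hne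
    have h2 := hcont.continuousOn.div continuous_fst.continuousOn hne
    have h3 : Continuous fun q : ℝ × ℝ × ℝ => exp (2 * M * q.1) := by fun_prop
    have h4 : Continuous fun q : ℝ × ℝ × ℝ => κ * (q.2.1 - zs) ^ 2 := by fun_prop
    have h5 : Continuous fun q : ℝ × ℝ × ℝ => κ * (ts - q.2.2) := by fun_prop
    exact ((h2.add ((h1.add h3.continuousOn).const_mul δ)).sub h4.continuousOn).sub
      h5.continuousOn
  have hZsq : 0 ≤ Z ^ 2 := by positivity
  have hmem : (rs, zs, ts) ∈ Set.Icc r1 R ×ˢ Set.Icc (zs - Z) (zs + Z) ×ˢ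
      Set.Icc (ts - Z ^ 2) ts :=
    ⟨⟨hr1s.le, hR1.le⟩, ⟨by linarith, by linarith⟩, ⟨by linarith, le_rfl⟩⟩
  obtain ⟨⟨r, z, t⟩, ⟨⟨hra, hrb⟩, ⟨hza, hzb⟩, ⟨hta, htb⟩⟩, hmax⟩ :=
    hK.exists_isMaxOn ⟨_, hmem⟩ hPc
  dsimp only at hra hrb hza hzb hta htb
  have hr0 : 0 < r := hr1.trans_le hra
  have hval : c + δ * barrier M rs ≤ P r z t := by
    have h1 : P rs zs ts ≤ P r z t := hmax hmem
    have h2 : c ≤ w rs zs ts / rs := by rwa [le_div_iff₀ hrs]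
    simp only [P, sub_self] at h1 ⊢
    linarith
  have hz2 : 0 ≤ κ * (z - zs) ^ 2 := by positivity
  have ht2 : 0 ≤ κ * (ts - t) := mul_nonneg hκ0 (by linarith)
  have hP : P r z t = w r z t / r + δ * barrier M r - κ * (z - zs) ^ 2 - κ * (ts - t) := rfl
  obtain ⟨hw1, hw2⟩ := hbd r z t hr0 htb
  have hΦ : w r z t / r ≤ B := by rwa [div_le_iff₀ hr0]
  have hδR : δ * barrier M r ≤ δ * barrier M R :=
    mul_le_mul_of_nonneg_left (barrier_mono hM hr0 hrb) hδ0.le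
  have hδG2 : δ * G = δ * barrier M R - δ * barrier M rs := by rw [hG]; ring
  have hr1' : r1 < r := by
    refine lt_of_le_of_ne hra fun h => ?_
    rw [← h] at hP hΦ
    rw [h] at hr1b hP hΦ
    linarith
  have hr2' : r < R := by
    refine lt_of_le_of_ne hrb fun h => ?_
    have h1 : w r z t / r ≤ B / r := div_le_div_of_nonneg_right hw1 hr0.le
    have h2 : B / r ≤ c / 4 := by rw [h]; exact hBR
    linarith
  have hzin : |z - zs| < Z := by
    refine lt_of_le_of_ne (abs_le.mpr ⟨by linarith, by linarith⟩) fun h => ?_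
    have : κ * (z - zs) ^ 2 = B2 := by rw [← sq_abs, h, hκZ]
    linarith
  have htin : ts - Z ^ 2 < t := by
    refine lt_of_le_of_ne hta fun h => ?_
    have : κ * (ts - t) = B2 := by rw [← h, ← hκZ]; ring
    linarith
  obtain ⟨hz1, hz3⟩ := abs_lt.mp hzin
  refine no_interior_max hM hδ0 hr1 hra hrb hκ0 hzin.le hsmall (dr · z t) (drr r z t) (dz r · t)
    (dzz r z t) (dt r z t) (heq r z t hr0 htb).1 (heq r z t hr0 htb).2.1
    (heq r z t hr0 htb).2.2 (zs := zs) (ts := ts) (t₀ := ts - Z ^ 2) ?_ ?_ htin ?_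
  · filter_upwards [Ioo_mem_nhds hr1' hr2'] with y hy
    exact hmax (a := (y, z, t)) ⟨⟨hy.1.le, hy.2.le⟩, ⟨hza, hzb⟩, hta, htb⟩
  · filter_upwards [Ioo_mem_nhds (a := zs - Z) (b := zs + Z) (by linarith) (by linarith)]
      with y hy
    exact hmax (a := (r, y, t)) ⟨⟨hra, hrb⟩, ⟨hy.1.le, hy.2.le⟩, hta, htb⟩
  · intro y hy
    exact hmax (a := (r, z, y)) ⟨⟨hra, hrb⟩, ⟨hza, hzb⟩, hy.1.le, hy.2.le.trans htb⟩

lemma hasDerivAt_line {f : SpT → ℝ} (hf : Smooth f) (q v : SpT) (s : ℝ) :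
    HasDerivAt (fun s : ℝ => f (s • v + q)) (dd v f (s • v + q)) s := by
  have hc : HasDerivAt (fun s : ℝ => s • v + q) v s := by
    simpa using ((hasDerivAt_id s).smul_const v).add_const q
  exact (hf.differentiable _).hasFDerivAt.comp_hasDerivAt s hc

/-- Points of the meridian half-plane. -/
def mer (r z t : ℝ) : SpT := r • ex 0 + (z • ex 2 + t • et)

@[simp] lemma mer_zero (r z t : ℝ) : (mer r z t).1 0 = r := by simp [mer, ex, et]
@[simp] lemma mer_one (r z t : ℝ) : (mer r z t).1 1 = 0 := by simp [mer, ex, et]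
@[simp] lemma mer_two (r z t : ℝ) : (mer r z t).1 2 = z := by simp [mer, ex, et]
@[simp] lemma mer_snd (r z t : ℝ) : (mer r z t).2 = t := by simp [mer, ex, et]

lemma mer_eq {p : SpT} (h : p.1 1 = 0) : mer (p.1 0) (p.1 2) p.2 = p :=
  Prod.ext (euc_ext (by simp) (by simp [h]) (by simp)) (by simp)

lemma ae_coord_ne : ∀ᵐ p : SpT, p.1 0 ≠ 0 := by
  let L : SpT →ₗ[ℝ] ℝ :=
    ((EuclideanSpace.proj 0 : Euc 3 →L[ℝ] ℝ).comp (ContinuousLinearMap.fst ℝ (Euc 3) ℝ)).toLinearMap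
  have h : LinearMap.ker L ≠ ⊤ := by
    intro h
    have : ex 0 ∈ LinearMap.ker L := by rw [h]; trivial
    simp [L, ex] at this
  have := Measure.addHaar_submodule (volume : Measure SpT) _ h
  have hs : {p : SpT | ¬p.1 0 ≠ 0} = (LinearMap.ker L : Set SpT) := by
    ext p
    simp [L]
  rw [ae_iff, hs]
  exact this

lemma J_mol_tendsto_of_continuous {f : SpT → ℝ} (hf : BM f) (hc : Continuous f) (p : SpT) :
    Tendsto (fun a => J (mol a) f p) atTop (𝓝 (f p)) := by
  rw [Metric.tendsto_nhds]
  intro η hη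
  obtain ⟨δ, hδ, h⟩ := Metric.continuousAt_iff.mp hc.continuousAt (η / 2) (half_pos hη)
  filter_upwards [rad_tendsto.eventually_lt_const hδ] with a ha
  refine (J_mol_sub_le hf (B := η / 2) fun q hq => ?_).trans_lt (half_lt_self hη)
  refine (h ?_).le
  rw [dist_eq_norm, sub_sub_cancel_left, norm_neg]
  exact hq.trans_lt ha

section
variable {u : Fin 3 → SpT → ℝ}

lemma Sol.exists_Wl_bound (H : Sol u (fun i j p => u i p * u j p)) :
    ∃ B, 0 ≤ B ∧ ∀ n i j p, |Wl u n [] i j p| ≤ B := by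
  obtain ⟨A, hA0, hA⟩ := H.exists_ddx_bound 1
  refine ⟨2 * A, by positivity, fun n i j p => (abs_sub _ _).trans ?_⟩
  have h1 := (hA [i] rfl n p).1 j
  have h2 := (hA [j] rfl n p).1 i
  linarith

lemma Sol.mer_equation (H : Sol u (fun i j p => u i p * u j p)) {n : ℕ}
    (hs : AxiSym (fun i => J (mol n) (u i))) {r z t : ℝ} (hr : 0 < r) (ht : t < -rad n) :
    dd et (Wl u n [] 0 2) (mer r z t)
      = dd (ex 0) (dd (ex 0) (Wl u n [] 0 2)) (mer r z t)
        + dd (ex 2) (dd (ex 2) (Wl u n [] 0 2)) (mer r z t)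
        + dd (ex 0) (Wl u n [] 0 2) (mer r z t) / r - Wl u n [] 0 2 (mer r z t) / r ^ 2
        - J (mol n) (u 0) (mer r z t)
          * (dd (ex 0) (Wl u n [] 0 2) (mer r z t) - Wl u n [] 0 2 (mer r z t) / r)
        - J (mol n) (u 2) (mer r z t) * dd (ex 2) (Wl u n [] 0 2) (mer r z t)
        - (NW u n (mer r z t) - drift u n (mer r z t)) := by
  have hu := H.umeas
  have e1 := H.dt_W (n := n) (p := mer r z t) (by simpa using ht)
  obtain ⟨f1, f2, f3, f4, f5⟩ := hs.plane_facts (p := mer r z t) (by simpa using hr) (by simp)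
  have hW : ∀ i j, Wc (fun i => J (mol n) (u i)) i j = Wl u n [] i j := fun i j => rfl
  rw [hW] at f3 f4 f5
  rw [mer_zero] at f2 f5
  have hl : ∀ l, Wl u n [l] 0 2 (mer r z t) = dd (ex l) (Wl u n [] 0 2) (mer r z t) := by
    intro l
    rw [dd_Wl hu]
    have hV := fun i => (SB_mol hu n i).smooth
    change dd (ex 0) (dd (ex l) (J (mol n) (u 2))) _ - dd (ex 2) (dd (ex l) (J (mol n) (u 0))) _ = _
    rw [dd_comm (hV 2), dd_comm (hV 0)]
    rfl
  have f6 : dd (ex 1) (dd (ex 1) (Wl u n [] 0 2)) (mer r z t)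
      = dd (ex 0) (Wl u n [] 0 2) (mer r z t) / r - Wl u n [] 0 2 (mer r z t) / r ^ 2 := by
    field_simp
    linarith
  have e2 : drift u n (mer r z t) = J (mol n) (u 0) (mer r z t)
      * (dd (ex 0) (Wl u n [] 0 2) (mer r z t) - Wl u n [] 0 2 (mer r z t) / r)
      + J (mol n) (u 2) (mer r z t) * dd (ex 2) (Wl u n [] 0 2) (mer r z t) := by
    unfold drift
    simp only [Fin.sum_univ_three, hl]
    rw [f1, f2, f3, f4]
    ring
  rw [e1, e2, Lap, Fin.sum_univ_three, f6]
  ring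

lemma Sol.exists_meridian_lt (H : Sol u (fun i j p => u i p * u j p))
    (hs : ∀ n, AxiSym (fun i => J (mol n) (u i))) {σ : ℝ} (hσ : |σ| = 1) {p : SpT}
    (h0 : 0 < p.1 0) (h1 : p.1 1 = 0) (ht : p.2 < 0) {c : ℝ} (hc : 0 < c) :
    ∀ᶠ n in atTop, σ * Wl u n [] 0 2 p < c * p.1 0 := by
  obtain ⟨M, hM, hMb⟩ := H.exists_ddx_bound 0
  obtain ⟨B1, hB1, hB1b⟩ := H.exists_Wl_bound
  obtain ⟨B2, hB2, hB2b⟩ := H.exists_lip_Wl []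
  obtain ⟨C, hC, hCb⟩ := H.exists_drift_bound
  have hu := H.umeas
  obtain ⟨ε, hε, hmain⟩ := axisym_max_principle (B := B1 + B2) (rs := p.1 0) hM (by positivity) h0 hc
  have hr0 : Tendsto (fun n => C * rad n) atTop (𝓝 0) := by
    simpa using rad_tendsto.const_mul C
  have hr1 : Tendsto (fun n => 3 * rad n) atTop (𝓝 0) := by
    simpa using rad_tendsto.const_mul 3
  filter_upwards [hr0.eventually_lt_const hε, hr1.eventually_lt_const (neg_pos.mpr ht)]
    with n hn1 hn2
  have hrn := rad_pos n
  have habs : ∀ x : ℝ, σ * x ≤ |x| := fun x => (le_abs_self _).trans (by rw [abs_mul, hσ, one_mul])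
  have hW := smooth_Wl hu n [] 0 2
  have hd : ∀ {f : SpT → ℝ}, Smooth f →
      (∀ r z t, HasDerivAt (fun r => σ * f (mer r z t)) (σ * dd (ex 0) f (mer r z t)) r) ∧
      (∀ r z t, HasDerivAt (fun z => σ * f (mer r z t)) (σ * dd (ex 2) f (mer r z t)) z) ∧
      (∀ r z t, HasDerivAt (fun t => σ * f (mer r z t)) (σ * dd et f (mer r z t)) t) := by
    intro f hf
    refine ⟨fun r z t => (hasDerivAt_line hf _ _ _).const_mul σ, fun r z t => ?_, fun r z t => ?_⟩
    · have e : ∀ z, mer r z t = z • ex 2 + (r • ex 0 + t • et) := fun z => by unfold mer; abel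
      simp only [e]
      exact (hasDerivAt_line hf _ _ _).const_mul σ
    · have e : ∀ t, mer r z t = t • et + (r • ex 0 + z • ex 2) := fun t => by unfold mer; abel
      simp only [e]
      exact (hasDerivAt_line hf _ _ _).const_mul σ
  have key := hmain (fun r z t => σ * Wl u n [] 0 2 (mer r z t))
    (fun r z t => σ * dd (ex 0) (Wl u n [] 0 2) (mer r z t))
    (fun r z t => σ * dd (ex 0) (dd (ex 0) (Wl u n [] 0 2)) (mer r z t))
    (fun r z t => σ * dd (ex 2) (Wl u n [] 0 2) (mer r z t))
    (fun r z t => σ * dd (ex 2) (dd (ex 2) (Wl u n [] 0 2)) (mer r z t))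
    (fun r z t => σ * dd et (Wl u n [] 0 2) (mer r z t))
    (fun r z t => J (mol n) (u 0) (mer r z t)) (fun r z t => J (mol n) (u 2) (mer r z t))
    (p.1 2) p.2 ?_ (hd hW).1 (hd (hW.dd _)).1 (hd hW).2.1 (hd (hW.dd _)).2.1 (hd hW).2.2 ?_ ?_
  · simpa only [mer_eq h1] using key
  · refine continuous_const.mul (hW.continuous.comp ?_)
    unfold mer
    fun_prop
  · intro r z t hr htp
    refine ⟨?_, ?_⟩
    · exact (habs _).trans ((hB1b n 0 2 _).trans (by linarith))
    · have ha : Wl u n [] 0 2 (mer 0 z t) = 0 := (hs n).axis (by simp) (by simp)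
      have := hB2b n 0 2 (mer r z t) (mer 0 z t) (by rw [mer_snd]; linarith)
        (by rw [mer_snd]; linarith)
      rw [ha, sub_zero] at this
      have e : ‖mer r z t - mer 0 z t‖ = r := by
        have : mer r z t - mer 0 z t = r • ex 0 := by unfold mer; module
        rw [this, norm_smul, Real.norm_of_nonneg hr.le]
        simp [ex, Prod.norm_def]
      rw [e] at this
      refine (habs _).trans (this.trans ?_)
      have := mul_nonneg hB1 hr.le
      linarith
  · intro r z t hr htp
    have hM' := fun i => (hMb [] rfl n (mer r z t)).1 i
    refine ⟨hM' 0, hM' 2, ?_⟩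
    rw [H.mer_equation (hs n) hr (by linarith)]
    have hD := hCb n (mer r z t) (by rw [mer_snd]; linarith)
    have hD2 := habs (-(NW u n (mer r z t) - drift u n (mer r z t)))
    rw [abs_neg] at hD2
    refine le_of_eq_of_le ?_ (add_le_add_right (hD2.trans (hD.trans hn1.le)) _)
    ring

lemma Sol.meridian_tendsto (H : Sol u (fun i j p => u i p * u j p))
    (hs : ∀ n, AxiSym (fun i => J (mol n) (u i))) {p : SpT}
    (h0 : 0 < p.1 0) (h1 : p.1 1 = 0) (ht : p.2 < 0) :
    Tendsto (fun n => Wl u n [] 0 2 p) atTop (𝓝 0) := by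
  rw [Metric.tendsto_nhds]
  intro η hη
  filter_upwards [H.exists_meridian_lt hs (σ := 1) (by simp) h0 h1 ht (div_pos hη h0),
    H.exists_meridian_lt hs (σ := -1) (by simp) h0 h1 ht (div_pos hη h0)] with n e1 e2
  rw [div_mul_cancel₀ _ h0.ne'] at e1 e2
  rw [Real.dist_eq, sub_zero, abs_lt]
  constructor <;> linarith

lemma Sol.Wl_tendsto (H : Sol u (fun i j p => u i p * u j p))
    (hs : ∀ n, AxiSym (fun i => J (mol n) (u i))) {p : SpT}
    (h0 : p.1 0 ≠ 0) (ht : p.2 < 0) (i j : Fin 3) :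
    Tendsto (fun n => Wl u n [] i j p) atTop (𝓝 0) := by
  obtain ⟨α, hα1, hα0⟩ := exists_rotP (p := p)
  have hr : 0 < (rotP α p).1 0 := by rw [hα0]; positivity
  have h02 := H.meridian_tendsto hs hr hα1 ht
  have h12 : ∀ n, Wl u n [] 1 2 (rotP α p) = 0 := fun n => ((hs n).plane_facts hr hα1).2.2.2.1
  have h01 : ∀ n, Wl u n [] 0 1 p = 0 := fun n => by
    rw [← ((hs n).plane_facts hr hα1).2.2.1]
    exact (((hs n).rot_invariant α p).1).symm
  have hsq : ∀ n, Wl u n [] 0 2 p ^ 2 + Wl u n [] 1 2 p ^ 2 = Wl u n [] 0 2 (rotP α p) ^ 2 := by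
    intro n
    have := ((hs n).rot_invariant α p).2
    have e := h12 n
    change Wc (fun i => J (mol n) (u i)) 1 2 _ = 0 at e
    rw [e, zero_pow two_ne_zero, add_zero] at this
    exact this.symm
  have hz : ∀ f : ℕ → ℝ, (∀ n, f n ^ 2 ≤ Wl u n [] 0 2 (rotP α p) ^ 2) →
      Tendsto f atTop (𝓝 0) := fun f hf =>
    squeeze_zero_norm (fun n => by simpa using sq_le_sq.mp (hf n))
      (by simpa using h02.abs)
  have t02 := hz (fun n => Wl u n [] 0 2 p) fun n => by
    rw [← hsq n]; linarith [sq_nonneg (Wl u n [] 1 2 p)]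
  have t12 := hz (fun n => Wl u n [] 1 2 p) fun n => by
    rw [← hsq n]; linarith [sq_nonneg (Wl u n [] 0 2 p)]
  have t01 : Tendsto (fun n => Wl u n [] 0 1 p) atTop (𝓝 0) := by simp [h01]
  have hsw : ∀ i j, Tendsto (fun n => Wl u n [] i j p) atTop (𝓝 0) →
      Tendsto (fun n => Wl u n [] j i p) atTop (𝓝 0) := by
    intro i j h
    have : ∀ n, Wl u n [] j i p = -Wl u n [] i j p := fun n => (neg_sub _ _).symm
    simpa only [this, neg_zero] using h.neg
  have hd : ∀ i, Tendsto (fun n => Wl u n [] i i p) atTop (𝓝 0) := by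
    intro i
    have : ∀ n, Wl u n [] i i p = 0 := fun n => sub_self _
    simp [this]
  fin_cases i <;> fin_cases j
  · exact hd 0
  · exact t01
  · exact t02
  · exact hsw _ _ t01
  · exact hd 1
  · exact t12
  · exact hsw _ _ t02
  · exact hsw _ _ t12
  · exact hd 2

lemma Sol.Wl_eq_zero (H : Sol u (fun i j p => u i p * u j p))
    (hs : ∀ n, AxiSym (fun i => J (mol n) (u i))) {m : ℕ} {p : SpT} (hp : p.2 < -rad m)
    (i j : Fin 3) : Wl u m [] i j p = 0 := by
  have hu := H.umeas
  obtain ⟨B, hB, hBb⟩ := H.exists_Wl_bound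
  have h1 := J_mol_tendsto_of_continuous (BM_Wl hu m [] i j) (smooth_Wl hu m [] i j).continuous p
  simp_rw [← J_Wl hu m] at h1
  have h2 : Tendsto (fun a => J (mol m)
      (fun q => if q.2 < 0 then Wl u a [] i j q else 0) p) atTop (𝓝 (J (mol m) (fun _ => 0) p)) := by
    refine J_tendsto (mol_ker m).integrable (C := B) (fun a => ?_) (fun a q => ?_) ?_ p
    · exact Measurable.ite (measurableSet_lt measurable_snd measurable_const)
        (BM_Wl hu a [] i j).meas measurable_const
    · split_ifs
      · exact hBb a i j q
      · simpa using hB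
    · filter_upwards [ae_coord_ne] with q hq
      split_ifs with h
      · exact H.Wl_tendsto hs hq h i j
      · exact tendsto_const_nhds
  rw [J_mol_const] at h2
  refine tendsto_nhds_unique h1 (h2.congr fun a => ?_)
  unfold J
  congr 1
  funext q
  by_cases hq : mol m q = 0
  · simp [hq]
  · have hq' := mol_support m hq
    rw [mem_closedBall_zero_iff] at hq'
    have h3 := (abs_le.mp ((norm_snd_le q).trans hq')).1
    have h4 : (p - q).2 < 0 := by
      rw [Prod.snd_sub]
      linarith
    simp only [h4, if_true]

end

section
variable {u : Fin 3 → SpT → ℝ}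

lemma Sol.Lap_mol_eq_zero (H : Sol u (fun i j p => u i p * u j p))
    (hs : ∀ n, AxiSym (fun i => J (mol n) (u i))) {n : ℕ} {p : SpT} (hp : p.2 < -rad n)
    (j : Fin 3) : Lap (J (mol n) (u j)) p = 0 := by
  have hu := H.umeas
  have hV := fun i => SB_mol hu n i
  have h1 : ∀ i, dd (ex i) (dd (ex i) (J (mol n) (u j))) p
      = dd (ex j) (dd (ex i) (J (mol n) (u i))) p := by
    intro i
    rw [dd_congr_half (f := dd (ex i) (J (mol n) (u j))) (g := dd (ex j) (J (mol n) (u i)))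
      (fun q hq => sub_eq_zero.mp (H.Wl_eq_zero hs hq i j)) (ex i) hp, dd_comm (hV i).smooth]
  have h2 := congrFun (dd_sum Finset.univ (f := fun i : Fin 3 => dd (ex i) (J (mol n) (u i)))
    (fun i => ((hV i).dd _).smooth.differentiable) (ex j)) p
  unfold Lap
  simp only [h1]
  rw [← h2, dd_congr_half (g := fun _ => 0) (fun q hq => ?_) (ex j) hp, dd_const]
  have := H.div _ (mol_ker n) q (adm_mol hq)
  simpa only [dd_J (mol_ker n) (hu _)] using this

lemma Sol.mol_space_const (H : Sol u (fun i j p => u i p * u j p))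
    (hs : ∀ n, AxiSym (fun i => J (mol n) (u i))) {n : ℕ} {t : ℝ} (ht : t < -rad n)
    (j : Fin 3) (x y : Euc 3) : J (mol n) (u j) (x, t) = J (mol n) (u j) (y, t) := by
  have hU := SB_mol H.umeas n j
  obtain ⟨A, hA⟩ := hU.bdd []
  have h0 : ∀ s > 0, ∀ p : SpT, p.2 < -rad n →
      |Tg gau s (Lap (J (mol n) (u j))) p| ≤ 0 / s ^ 0 := by
    intro s _ p hp
    have : Tg gau s (Lap (J (mol n) (u j))) p = 0 := by
      unfold Tg
      refine integral_eq_zero_of_ae (Eventually.of_forall fun z => ?_)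
      change gau z * Lap (J (mol n) (u j)) _ = 0
      rw [H.Lap_mol_eq_zero hs (by simpa using hp), mul_zero]
    simp [this]
  have h1 : ∀ s > 0, ∀ x : Euc 3, J (mol n) (u j) (x, t) = Tg gau s (J (mol n) (u j)) (x, t) := by
    intro s hs x
    have := heat_diff hU (n := 0) (by norm_num) le_rfl h0 hs (p := (x, t)) ht
    rw [mul_zero, zero_mul] at this
    exact sub_eq_zero.mp (abs_eq_zero.mp (this.antisymm (abs_nonneg _)))
  have h2 : ∀ s > 0, |J (mol n) (u j) (x, t) - J (mol n) (u j) (y, t)|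
      ≤ 3 * (gM * A / s ^ 2) * ‖x - y‖ := by
    intro s hs
    have := abs_Dh_Tg_le hU hs hA (x - y) (y, t)
    unfold Dh at this
    rw [← h1 s hs y, Prod.mk_add_mk, add_zero, add_sub_cancel, ← h1 s hs x] at this
    exact this
  have h3 : Tendsto (fun s : ℝ => 3 * (gM * A / s ^ 2) * ‖x - y‖) atTop (𝓝 0) := by
    have := (tendsto_const_nhds (x := gM * A)).div_atTop (tendsto_pow_atTop (α := ℝ) two_ne_zero)
    simpa using (this.const_mul 3).mul_const ‖x - y‖
  have h4 := ge_of_tendsto h3 ((eventually_gt_atTop 0).mono h2)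
  exact sub_eq_zero.mp (abs_eq_zero.mp (h4.antisymm (abs_nonneg _)))

lemma Sol.mol_horizontal_zero (H : Sol u (fun i j p => u i p * u j p))
    (hs : ∀ n, AxiSym (fun i => J (mol n) (u i))) {n : ℕ} {p : SpT} (hp : p.2 < -rad n) :
    J (mol n) (u 0) p = 0 ∧ J (mol n) (u 1) p = 0 := by
  have h0 := (hs n).rot0 π p
  have h1 := (hs n).rot1 π p
  have e : ∀ j, J (mol n) (u j) (rotP π p) = J (mol n) (u j) p := fun j =>
    H.mol_space_const hs hp j _ _
  rw [e] at h0 h1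
  simp only [cos_pi, sin_pi] at h0 h1
  constructor <;> linarith

lemma Sol.exists_vertical (H : Sol u (fun i j p => u i p * u j p))
    (hs : ∀ n, AxiSym (fun i => J (mol n) (u i))) {M : ℝ} (hM : 0 ≤ M)
    (hb : ∀ p, |u 2 p| ≤ M) :
    ∃ b : ℝ → ℝ, Measurable b ∧ (∀ t, |b t| ≤ M) ∧
      ∀ᵐ p : SpT, p.2 < 0 → u 0 p = 0 ∧ u 1 p = 0 ∧ u 2 p = b p.2 := by
  have hu := H.umeas
  refine ⟨fun t => max (min (limsup (fun n => J (mol n) (u 2) (0, t)) atTop) M) (-M), ?_, ?_, ?_⟩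
  · refine ((Measurable.limsup fun n => ?_).min measurable_const).max measurable_const
    exact (SB_mol hu n 2).BM.meas.comp measurable_prodMk_left
  · intro t
    rw [abs_le]
    exact ⟨le_max_right _ _, max_le (min_le_right _ _) (by linarith)⟩
  · filter_upwards [J_mol_tendsto (hu 0), J_mol_tendsto (hu 1), J_mol_tendsto (hu 2)]
      with p h0 h1 h2 hp
    have hev : ∀ᶠ n in atTop, p.2 < -rad n := by
      filter_upwards [rad_tendsto.eventually_lt_const (neg_pos.mpr hp)] with n hn
      linarith
    have z0 : Tendsto (fun n => J (mol n) (u 0) p) atTop (𝓝 0) :=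
      tendsto_const_nhds.congr' (hev.mono fun n hn => (H.mol_horizontal_zero hs hn).1.symm)
    have z1 : Tendsto (fun n => J (mol n) (u 1) p) atTop (𝓝 0) :=
      tendsto_const_nhds.congr' (hev.mono fun n hn => (H.mol_horizontal_zero hs hn).2.symm)
    have z2 : Tendsto (fun n => J (mol n) (u 2) (0, p.2)) atTop (𝓝 (u 2 p)) :=
      h2.congr' (hev.mono fun n hn => H.mol_space_const hs hn 2 p.1 0)
    refine ⟨tendsto_nhds_unique h0 z0, tendsto_nhds_unique h1 z1, ?_⟩
    have := abs_le.mp (hb p)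
    rw [z2.limsup_eq, min_eq_left this.2, max_eq_left this.1]

end

/-- Theorem 5.2 (Liouville theorem, axi-symmetric without swirl): every bounded weak
solution of the Navier–Stokes equations in ℝ³ × (-∞,0) that is axi-symmetric with no
swirl is of the form u(x,t) = (0,0,b₃(t)). -/
theorem liouville_axisym_noswirl (u : Euc 3 → ℝ → Euc 3) (M : ℝ)
    (hmeas : Measurable (fun q : Euc 3 × ℝ => u q.1 q.2))
    (hbd : ∀ x : Euc 3, ∀ t < (0:ℝ), ‖u x t‖ ≤ M)
    (hweak : IsWeakNS 3 (Set.Iio 0) u)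
    -- u is axi-symmetric: u(Rx,t) = R u(x,t) for every rotation about the x₃-axis
    (haxi : ∀ α : ℝ, ∀ x : Euc 3, ∀ t < (0:ℝ), u (rotZ α x) t = rotZ α (u x t))
    -- u has no swirl: -x₂ u₁ + x₁ u₂ = 0 for almost every (x,t)
    (hnoswirl : ∀ᵐ q ∂(volume.restrict (Set.univ ×ˢ Set.Iio 0 : Set (Euc 3 × ℝ))),
      -(q.1 1) * u q.1 q.2 0 + q.1 0 * u q.1 q.2 1 = 0) :
    ∃ b₃ : ℝ → ℝ, Measurable b₃ ∧ (∃ B : ℝ, ∀ t < (0:ℝ), |b₃ t| ≤ B) ∧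
      ∀ᵐ q ∂(volume.restrict (Set.univ ×ˢ Set.Iio 0 : Set (Euc 3 × ℝ))),
        u q.1 q.2 0 = 0 ∧ u q.1 q.2 1 = 0 ∧ u q.1 q.2 2 = b₃ q.2 := by
  have H := hweak.sol hmeas hbd
  have hM : 0 ≤ M := (norm_nonneg _).trans (hbd 0 (-1) (by norm_num))
  obtain ⟨b, hb1, hb2, hb3⟩ := H.exists_vertical (sym_mol H.umeas haxi hnoswirl) hM (fun p => by
    unfold cut
    split_ifs with h
    · exact (PiLp.norm_apply_le _ 2).trans (hbd _ _ h)
    · simpa using hM)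
  refine ⟨b, hb1, ⟨M, fun t _ => hb2 t⟩, ?_⟩
  rw [ae_restrict_iff' (MeasurableSet.univ.prod measurableSet_Iio)]
  filter_upwards [hb3] with q hq hq0
  have hq1 : q.2 < 0 := hq0.2
  simpa [cut, hq1] using hq hq1

end
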